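/- Let d ≥ 2 and let B be a collision kernel satisfying the standing assumptions (1.1). Let (μ_t^N)_{t≥0} be a Kac process with collision kernel B. Let p ∈ [2,∞) and q ∈ (2,∞) with p ≤ q. There is a constant C₁ = C₁(B,p,q) < ∞ such that for all t ≥ 0, 𝔼(∫|v|^q μ_t^N(dv)) ≤ C₁ (1 + t^{p−q}) ∫|v|^p μ_0^N(dv). Moreover, there is a constant C₂ = C₂(B,q) < ∞ such that for all t ≥ 0, 𝔼(sup_{s≤t} ∫|v|^q μ_s^N(dv)) ≤ (1 + C₂ t) ∫|v|^q μ_0^N(dv), and there is a constant C₃ = C₃(B,p,q) < ∞ such that for all t ≥ 0, 𝔼(sup_{s≤t} ∫(1+|v|^p) |μ_s^N − μ_0^N|(dv)) ≤ C₃ (t + t^{q−p}) ∫|v|^q μ_0^N(dv), where |μ_s^N − μ_0^N| denotes the total variation measure of the signed measure μ_s^N − μ_0^N. -/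

import Mathlib

open MeasureTheory ProbabilityTheory Filter
open scoped ENNReal NNReal RealInnerProductSpace

noncomputable section

abbrev Vd (d : ℕ) := EuclideanSpace ℝ (Fin d)

namespace KacModel

variable {d : ℕ}

/-- Post-collision velocity `v' = (v+v*)/2 + |v-v*|σ/2`. -/
def postV (v vs σ : Vd d) : Vd d := (2:ℝ)⁻¹ • (v + vs) + ((2:ℝ)⁻¹ * ‖v - vs‖) • σ

/-- Post-collision velocity `v'_* = (v+v*)/2 - |v-v*|σ/2`. -/
def postVs (v vs σ : Vd d) : Vd d := (2:ℝ)⁻¹ • (v + vs) - ((2:ℝ)⁻¹ * ‖v - vs‖) • σ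

/-- The unit sphere `S^{d-1}` regarded as a subset of `ℝ^d`. -/
def unitSphere (d : ℕ) : Set (Vd d) := {σ | ‖σ‖ = 1}

/-- Standing assumptions (1.1) on a collision kernel, regarded as a family of
measures on `ℝ^d` carried by the unit sphere. -/
structure IsCollisionKernel (B : Vd d → Measure (Vd d)) : Prop where
  measurable : ∀ s : Set (Vd d), MeasurableSet s → Measurable fun v => B v s
  prob : ∀ u : Vd d, ‖u‖ = 1 → IsProbabilityMeasure (B u)
  support : ∀ u : Vd d, ‖u‖ = 1 → B u ((unitSphere d \ {u, -u})ᶜ) = 0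
  scaling : ∀ (c : ℝ), 0 ≤ c → ∀ u : Vd d, ‖u‖ = 1 →
    B (c • u) = ENNReal.ofReal c • B u
  symm : ∀ (R : Vd d ≃ₗᵢ[ℝ] Vd d) (u : Vd d), ‖u‖ = 1 → B (R u) = (B u).map R

/-- Total variation distance between two finite measures (dual formulation). -/
def tvDist {E : Type*} [MeasurableSpace E] (μ ν : Measure E) : ℝ :=
  ⨆ f : {f : E → ℝ // Measurable f ∧ ∀ x, |f x| ≤ 1},
    ((∫ x, f.1 x ∂μ) - ∫ x, f.1 x ∂ν)

/-- The Lipschitz assumption (1.2). -/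
def IsLipschitzKernel (B : Vd d → Measure (Vd d)) (κ : ℝ) : Prop :=
  1 ≤ κ ∧ ∀ v v' : Vd d, tvDist (B v) (B v') ≤ κ * ‖v - v'‖

/-- The Boltzmann sphere 𝒮. -/
def boltzmannSphere (d : ℕ) : Set (Measure (Vd d)) :=
  {μ | IsProbabilityMeasure μ ∧ (∫ v, v ∂μ) = 0 ∧ (∫ v, ‖v‖ ^ 2 ∂μ) = 1}

/-- 𝒮_N : normalized empirical measures in the Boltzmann sphere. -/
def empiricalSphere (d N : ℕ) : Set (Measure (Vd d)) :=
  {μ | μ ∈ boltzmannSphere d ∧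
    ∃ x : Fin N → Vd d, μ = (N : ℝ≥0∞)⁻¹ • ∑ i, Measure.dirac (x i)}

/-- The class ℱ of test functions. -/
def testF (d : ℕ) : Set (Vd d → ℝ) :=
  {f | (∀ v, |f v / (1 + ‖v‖ ^ 2)| ≤ 1) ∧
    ∀ v v', |f v / (1 + ‖v‖ ^ 2) - f v' / (1 + ‖v'‖ ^ 2)| ≤ ‖v - v'‖}

/-- The weighted Wasserstein distance W. -/
def Wdist (μ ν : Measure (Vd d)) : ℝ :=
  ⨆ f : testF d, ((∫ v, (f : Vd d → ℝ) v ∂μ) - ∫ v, (f : Vd d → ℝ) v ∂ν)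

/-- The p-th moment `∫ |v|^p dμ`, as a lower integral. -/
def momentL (p : ℝ) (μ : Measure (Vd d)) : ℝ≥0∞ :=
  ∫⁻ v, (‖v‖₊ : ℝ≥0∞) ^ p ∂μ

/-- Total variation measure |μ - ν| of the difference of two finite measures. -/
def tvMeasure {E : Type*} [MeasurableSpace E] (μ ν : Measure E) : Measure E :=
  (μ - ν) + (ν - μ)

/-- The post-collision update `μ^{v,v_*,σ}` of an empirical measure. -/
def collUpdate (N : ℕ) (μ : Measure (Vd d)) (v vs σ : Vd d) : Measure (Vd d) :=
  μ + (N : ℝ≥0∞)⁻¹ • (Measure.dirac (postV v vs σ) + Measure.dirac (postVs v vs σ))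
    - (N : ℝ≥0∞)⁻¹ • (Measure.dirac v + Measure.dirac vs)

/-- The generator 𝒢 of the Kac process. -/
def kacGen (B : Vd d → Measure (Vd d)) (N : ℕ) (F : Measure (Vd d) → ℝ)
    (μ : Measure (Vd d)) : ℝ :=
  N * ∫ v, (∫ vs, (∫ σ, (F (collUpdate N μ v vs σ) - F μ) ∂(B (v - vs))) ∂μ) ∂μ

/-- A Kac process with collision kernel `B` and particle number `N`:
a càdlàg adapted 𝒮_N-valued process solving the martingale problem for 𝒢. -/
structure IsKacProcess {Ω : Type*} [m : MeasurableSpace Ω]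
    (B : Vd d → Measure (Vd d)) (N : ℕ) (P : Measure Ω)
    (𝓕 : Filtration ℝ m) (μp : ℝ → Ω → Measure (Vd d)) : Prop where
  mem : ∀ t ω, μp t ω ∈ empiricalSphere d N
  adapted : ∀ f ∈ testF d, Adapted 𝓕 fun t ω => ∫ v, f v ∂(μp t ω)
  rightCont : ∀ ω, ∀ f ∈ testF d, ∀ t : ℝ,
    ContinuousWithinAt (fun s => ∫ v, f v ∂(μp s ω)) (Set.Ici t) t
  leftLim : ∀ ω, ∀ f ∈ testF d, ∀ t : ℝ, 0 < t →
    ∃ L : ℝ, Tendsto (fun s => ∫ v, f v ∂(μp s ω)) (nhdsWithin t (Set.Iio t)) (nhds L)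
  martingale : ∀ G : Measure (Vd d) → ℝ, Measurable G → (∃ M : ℝ, ∀ ν, |G ν| ≤ M) →
    Martingale (fun t ω => G (μp t ω) - ∫ s in Set.Ioc (0:ℝ) t, kacGen B N G (μp s ω)) 𝓕 P

/-- `⟨f, Q(μ,ν)⟩`, the Boltzmann collision integral. -/
def QInt (B : Vd d → Measure (Vd d)) (f : Vd d → ℝ) (μ ν : Measure (Vd d)) : ℝ :=
  ∫ v, (∫ vs, (∫ σ, (f (postV v vs σ) + f (postVs v vs σ) - f v - f vs) ∂(B (v - vs))) ∂ν) ∂μ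

/-- Measure solution of the spatially homogeneous Boltzmann equation, started at time τ. -/
def IsBoltzmannSolutionFrom (B : Vd d → Measure (Vd d)) (τ : ℝ)
    (μt : ℝ → Measure (Vd d)) : Prop :=
  (∀ t, τ ≤ t → μt t ∈ boltzmannSphere d) ∧
  ∀ f : Vd d → ℝ, Measurable f → (∃ M, ∀ v, |f v| ≤ M) → HasCompactSupport f →
    ∀ t, τ ≤ t →
      (∫ v, f v ∂(μt t)) = (∫ v, f v ∂(μt τ)) + ∫ s in Set.Ioc τ t, QInt B f (μt s) (μt s)

/-- Measure solution of the spatially homogeneous Boltzmann equation (start time 0). -/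
def IsBoltzmannSolution (B : Vd d → Measure (Vd d)) (μt : ℝ → Measure (Vd d)) : Prop :=
  IsBoltzmannSolutionFrom B 0 μt

/-- Local boundedness in 𝒮(p) from time τ on. -/
def LocBddMomentFrom (p τ : ℝ) (μt : ℝ → Measure (Vd d)) : Prop :=
  ∀ T, τ ≤ T → ∃ M : ℝ≥0∞, M ≠ ⊤ ∧ ∀ t ∈ Set.Icc τ T, momentL p (μt t) ≤ M

/-- Sample mean. -/
def sampleMean {Ω : Type*} {N : ℕ} (Vs : Fin N → Ω → Vd d) (ω : Ω) : Vd d :=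
  (N : ℝ)⁻¹ • ∑ i, Vs i ω

/-- Sample mean square. -/
def sampleQ {Ω : Type*} {N : ℕ} (Vs : Fin N → Ω → Vd d) (ω : Ω) : ℝ :=
  (N : ℝ)⁻¹ * ∑ i, ‖Vs i ω‖ ^ 2

/-- Sample variance. -/
def sampleS {Ω : Type*} {N : ℕ} (Vs : Fin N → Ω → Vd d) (ω : Ω) : ℝ :=
  sampleQ Vs ω - ‖sampleMean Vs ω‖ ^ 2

/-- The rescaled empirical distribution μ̃^N. -/
def rescaledEmpirical {Ω : Type*} {N : ℕ} (Vs : Fin N → Ω → Vd d)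
    (μdef : Measure (Vd d)) (ω : Ω) : Measure (Vd d) :=
  if 0 < sampleS Vs ω then
    (N : ℝ≥0∞)⁻¹ • ∑ i, Measure.dirac
      ((Real.sqrt (sampleS Vs ω))⁻¹ • (Vs i ω - sampleMean Vs ω))
  else μdef

/-- The N-sample empirical distribution. -/
def empMeasure {Ω : Type*} {N : ℕ} (Vs : Fin N → Ω → Vd d) (ω : Ω) : Measure (Vd d) :=
  (N : ℝ≥0∞)⁻¹ • ∑ i, Measure.dirac (Vs i ω)

end KacModel

open KacModel

namespace KacModel
variable {d : ℕ}

lemma rpow_tangent {x y r : ℝ} (hx : 0 < x) (hy : 0 ≤ y) (hr : 1 ≤ r) :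
    x ^ r - y ^ r ≤ r * x ^ (r - 1) * (x - y) := by
  have h1 : -1 ≤ (y - x) / x := by
    rw [le_div_iff₀ hx]; linarith
  have h := one_add_mul_self_le_rpow_one_add h1 hr
  have h2 : 1 + (y - x) / x = y / x := by field_simp; ring
  rw [h2, Real.div_rpow hy hx.le] at h
  have hxr : 0 < x ^ r := Real.rpow_pos_of_pos hx r
  rw [le_div_iff₀ hxr] at h
  have h3 : x ^ (r - 1) = x ^ r / x := by
    rw [Real.rpow_sub hx, Real.rpow_one]
  rw [h3]
  have : (1 + r * ((y - x) / x)) * x ^ r = x ^ r - r * (x ^ r / x) * (x - y) := by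
    field_simp; ring
  linarith

lemma rpow_lip {x y r : ℝ} (hx : 0 ≤ x) (hx1 : x ≤ 1) (hy : 0 ≤ y) (hr : 1 ≤ r) :
    x ^ r - y ^ r ≤ r * |x - y| := by
  rcases hx.eq_or_lt with h | h
  · subst h
    rw [Real.zero_rpow (by linarith)]
    have := Real.rpow_nonneg hy r
    have : 0 ≤ r * |0 - y| := by positivity
    linarith
  · refine (rpow_tangent h hy hr).trans ?_
    have h1 : x ^ (r - 1) ≤ 1 := Real.rpow_le_one hx hx1 (by linarith)
    have h0 : 0 ≤ x ^ (r - 1) := Real.rpow_nonneg hx _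
    calc r * x ^ (r - 1) * (x - y) ≤ r * x ^ (r - 1) * |x - y| := by
          gcongr; exact le_abs_self _
      _ ≤ r * 1 * |x - y| := by gcongr
      _ = _ := by ring

/-- The Povzner profile. -/
def psi (r ξ : ℝ) : ℝ := ((1 + ξ) / 2) ^ r + ((1 - ξ) / 2) ^ r

lemma psi_neg (r ξ : ℝ) : psi r (-ξ) = psi r ξ := by
  unfold psi; rw [add_comm]; congr 3; ring

lemma psi_lip {r x y : ℝ} (hr : 1 ≤ r) (hx : |x| ≤ 1) (hy : |y| ≤ 1) :
    psi r x ≤ psi r y + r * |x - y| := by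
  rw [abs_le] at hx hy
  have h1 := rpow_lip (x := (1 + x) / 2) (y := (1 + y) / 2) (by linarith) (by linarith)
    (by linarith) hr
  have h2 := rpow_lip (x := (1 - x) / 2) (y := (1 - y) / 2) (by linarith) (by linarith)
    (by linarith) hr
  have e1 : |(1 + x) / 2 - (1 + y) / 2| = |x - y| / 2 := by
    rw [show (1 + x) / 2 - (1 + y) / 2 = (x - y) / 2 by ring, abs_div]; simp
  have e2 : |(1 - x) / 2 - (1 - y) / 2| = |x - y| / 2 := by
    rw [show (1 - x) / 2 - (1 - y) / 2 = -((x - y) / 2) by ring, abs_neg, abs_div]; simp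
  rw [e1] at h1; rw [e2] at h2
  unfold psi; linarith

lemma psi_le_one {r x : ℝ} (hr : 1 ≤ r) (hx : |x| ≤ 1) : psi r x ≤ 1 := by
  rw [abs_le] at hx
  have h1 : ((1 + x) / 2) ^ r ≤ (1 + x) / 2 :=
    Real.rpow_le_self_of_le_one (by linarith) (by linarith) hr
  have h2 : ((1 - x) / 2) ^ r ≤ (1 - x) / 2 :=
    Real.rpow_le_self_of_le_one (by linarith) (by linarith) hr
  unfold psi; linarith

lemma psi_nonneg {r x : ℝ} (hx : |x| ≤ 1) : 0 ≤ psi r x := by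
  rw [abs_le] at hx
  have h1 := Real.rpow_nonneg (x := (1 + x) / 2) (by linarith) r
  have h2 := Real.rpow_nonneg (x := (1 - x) / 2) (by linarith) r
  unfold psi; linarith

lemma psi_lt_one {r x : ℝ} (hr : 1 < r) (hx : |x| < 1) : psi r x < 1 := by
  rw [abs_lt] at hx
  have h1 : ((1 + x) / 2) ^ r < (1 + x) / 2 := by
    have := Real.rpow_lt_rpow_of_exponent_gt (x := (1 + x) / 2) (by linarith) (by linarith) hr
    rwa [Real.rpow_one] at this
  have h2 : ((1 - x) / 2) ^ r < (1 - x) / 2 := by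
    have := Real.rpow_lt_rpow_of_exponent_gt (x := (1 - x) / 2) (by linarith) (by linarith) hr
    rwa [Real.rpow_one] at this
  unfold psi; linarith

lemma psi_measurable (r : ℝ) : Measurable (psi r) := by
  unfold psi; fun_prop

/-- Real inequality behind the pointwise Povzner estimate, ordered case. -/
lemma real_pov {a b r s : ℝ} (ha : 0 < a) (hb : 0 ≤ b) (hab : b ≤ a) (hr : 1 < r)
    (hs0 : 0 ≤ s) (hs : s ≤ 1) :
    (a ^ 2 + b ^ 2) ^ r * s + 6 * r * ((a ^ 2 + b ^ 2) ^ (r - 1) * (a * b))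
      ≤ a ^ (2 * r) * s + 7 * r * 2 ^ (r - 1) * (a ^ (2 * r - 1) * b) := by
  have hE : 0 < a ^ 2 + b ^ 2 := by positivity
  have hE2 : (a ^ 2 + b ^ 2) ^ (r - 1) ≤ 2 ^ (r - 1) * a ^ (2 * r - 2) := by
    calc (a ^ 2 + b ^ 2) ^ (r - 1) ≤ (2 * a ^ 2) ^ (r - 1) := by
          apply Real.rpow_le_rpow hE.le _ (by linarith)
          nlinarith
      _ = _ := by
          rw [Real.mul_rpow (by norm_num) (by positivity), ← Real.rpow_natCast a 2,
            ← Real.rpow_mul ha.le]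
          congr 2; push_cast; ring
  have ht := rpow_tangent (y := a ^ 2) hE (by positivity) hr.le
  have e1 : (a ^ 2) ^ r = a ^ (2 * r) := by
    rw [← Real.rpow_natCast a 2, ← Real.rpow_mul ha.le]; norm_num
  rw [e1] at ht
  have e2 : a ^ (2 * r - 1) = a ^ (2 * r - 2) * a := by
    rw [← Real.rpow_add_one ha.ne']; congr 1; ring
  set P := (a ^ 2 + b ^ 2) ^ (r - 1)
  set Q := a ^ (2 * r - 2)
  have hQ : 0 ≤ Q := Real.rpow_nonneg ha.le _
  have hP : 0 ≤ P := Real.rpow_nonneg hE.le _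
  have h1 : (a ^ 2 + b ^ 2) ^ r ≤ a ^ (2 * r) + r * P * b ^ 2 := by linarith
  have h2 : P * b ^ 2 ≤ P * (a * b) := by gcongr; nlinarith
  have h3 : P * (a * b) ≤ 2 ^ (r - 1) * Q * (a * b) := by gcongr
  have h4 : (a ^ 2 + b ^ 2) ^ r * s ≤ (a ^ (2 * r) + r * P * b ^ 2) * s := by gcongr
  have h5 : r * P * b ^ 2 * s ≤ r * P * b ^ 2 * 1 := by gcongr
  rw [e2]
  nlinarith

lemma postV_normSq (v w σ : Vd d) (hσ : ‖σ‖ = 1) :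
    ‖postV v w σ‖ ^ 2 = (‖v‖ ^ 2 + ‖w‖ ^ 2) / 2 + ‖v - w‖ * ⟪v + w, σ⟫ / 2 := by
  unfold postV
  have h1 := norm_add_sq_real ((2:ℝ)⁻¹ • (v + w)) (((2:ℝ)⁻¹ * ‖v - w‖) • σ)
  have h2 := parallelogram_law_with_norm ℝ v w
  rw [h1, norm_smul, norm_smul, inner_smul_left, inner_smul_right, hσ]
  simp only [norm_mul, norm_inv, Real.norm_ofNat, norm_norm, conj_trivial]
  nlinarith

lemma postVs_normSq (v w σ : Vd d) (hσ : ‖σ‖ = 1) :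
    ‖postVs v w σ‖ ^ 2 = (‖v‖ ^ 2 + ‖w‖ ^ 2) / 2 - ‖v - w‖ * ⟪v + w, σ⟫ / 2 := by
  unfold postVs
  have h1 := norm_sub_sq_real ((2:ℝ)⁻¹ • (v + w)) (((2:ℝ)⁻¹ * ‖v - w‖) • σ)
  have h2 := parallelogram_law_with_norm ℝ v w
  rw [h1, norm_smul, norm_smul, inner_smul_left, inner_smul_right, hσ]
  simp only [norm_mul, norm_inv, Real.norm_ofNat, norm_norm, conj_trivial]
  nlinarith

lemma postV_norm_le (v w σ : Vd d) (hσ : ‖σ‖ = 1) :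
    ‖postV v w σ‖ ^ 2 ≤ ‖v‖ ^ 2 + ‖w‖ ^ 2 := by
  have h1 := postV_normSq v w σ hσ
  have h2 := postVs_normSq v w σ hσ
  have := sq_nonneg ‖postVs v w σ‖
  linarith

lemma postVs_norm_le (v w σ : Vd d) (hσ : ‖σ‖ = 1) :
    ‖postVs v w σ‖ ^ 2 ≤ ‖v‖ ^ 2 + ‖w‖ ^ 2 := by
  have h1 := postV_normSq v w σ hσ
  have h2 := postVs_normSq v w σ hσ
  have := sq_nonneg ‖postV v w σ‖
  linarith

/-- collision increment of `|v|^q` -/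
def delt (q : ℝ) (v w σ : Vd d) : ℝ :=
  ‖postV v w σ‖ ^ q + ‖postVs v w σ‖ ^ q - ‖v‖ ^ q - ‖w‖ ^ q

def povK (q : ℝ) : ℝ := 7 * (q / 2) * 2 ^ (q / 2 - 1)

lemma rpow_sq_half {x q : ℝ} (hx : 0 ≤ x) : (x ^ 2) ^ (q / 2) = x ^ q := by
  rw [← Real.rpow_natCast x 2, ← Real.rpow_mul hx]; congr 1; push_cast; ring

set_option maxHeartbeats 1000000 in
/-- Pointwise Povzner estimate. -/
lemma delt_le {q : ℝ} (hq : 2 < q) (v w σ : Vd d) (hσ : ‖σ‖ = 1) (hvw : v ≠ w) (c : ℝ)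
    (hc : ‖v - w‖ * c = ⟪v - w, σ⟫) (hc1 : |c| ≤ 1) :
    delt q v w σ ≤ -(1 - psi (q / 2) c) * (‖v‖ ^ q + ‖w‖ ^ q)
      + povK q * (max ‖v‖ ‖w‖ ^ (q - 1) * min ‖v‖ ‖w‖) := by
  set a := ‖v‖ with ha
  set b := ‖w‖ with hb
  have ha0 : 0 ≤ a := norm_nonneg _
  have hb0 : 0 ≤ b := norm_nonneg _
  have hpos : 0 < a ∨ 0 < b := by
    by_contra h; push Not at h
    have h1 : ‖v‖ = 0 := le_antisymm h.1 ha0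
    have h2 : ‖w‖ = 0 := le_antisymm h.2 hb0
    rw [norm_eq_zero] at h1 h2
    exact hvw (h1.trans h2.symm)
  have hE : 0 < a ^ 2 + b ^ 2 := by
    rcases hpos with h | h <;> positivity
  set E := a ^ 2 + b ^ 2 with hEdef
  have hX := postV_normSq v w σ hσ
  have hY := postVs_normSq v w σ hσ
  set ξ := ‖v - w‖ * ⟪v + w, σ⟫ / E with hξ
  have hEξ : E * ξ = ‖v - w‖ * ⟪v + w, σ⟫ := by rw [hξ]; field_simp
  have hX' : ‖postV v w σ‖ ^ 2 = E * ((1 + ξ) / 2) := by rw [hX, ← hEξ]; ring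
  have hY' : ‖postVs v w σ‖ ^ 2 = E * ((1 - ξ) / 2) := by rw [hY, ← hEξ]; ring
  have hξ1 : 0 ≤ (1 + ξ) / 2 := by
    have := sq_nonneg ‖postV v w σ‖; rw [hX'] at this
    exact nonneg_of_mul_nonneg_right this hE
  have hξ2 : 0 ≤ (1 - ξ) / 2 := by
    have := sq_nonneg ‖postVs v w σ‖; rw [hY'] at this
    exact nonneg_of_mul_nonneg_right this hE
  have hξabs : |ξ| ≤ 1 := by rw [abs_le]; constructor <;> linarith
  have hr : 1 < q / 2 := by linarith
  have hsum : ‖postV v w σ‖ ^ q + ‖postVs v w σ‖ ^ q = E ^ (q / 2) * psi (q / 2) ξ := by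
    rw [← rpow_sq_half (norm_nonneg (postV v w σ)), ← rpow_sq_half (norm_nonneg (postVs v w σ)),
      hX', hY', Real.mul_rpow hE.le hξ1, Real.mul_rpow hE.le hξ2, psi]
    ring
  have hvwab : ‖v - w‖ ≤ a + b := norm_sub_le _ _
  have hin : |⟪v, w⟫| ≤ a * b := abs_real_inner_le_norm v w
  have hwσ : |⟪w, σ⟫| ≤ b := by simpa [hσ] using abs_real_inner_le_norm w σ
  have hvσ : |⟪v, σ⟫| ≤ a := by simpa [hσ] using abs_real_inner_le_norm v σ
  have hns : ‖v - w‖ ^ 2 = a ^ 2 - 2 * ⟪v, w⟫ + b ^ 2 := norm_sub_sq_real v w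
  have hn0 := norm_nonneg (v - w)
  rw [inner_sub_left] at hc
  rw [inner_add_left] at hEξ
  have key : psi (q / 2) ξ ≤ psi (q / 2) c + (q / 2) * (6 * (a * b) / E) := by
    have hq0 : 0 ≤ q / 2 := by linarith
    rcases le_total b a with h | h
    · refine (psi_lip hr.le hξabs hc1).trans ?_
      gcongr
      rw [le_div_iff₀ hE]
      have : (ξ - c) * E = -2 * ⟪v, w⟫ * c + 2 * ‖v - w‖ * ⟪w, σ⟫ := by
        have e1 : E = ‖v - w‖ ^ 2 + 2 * ⟪v, w⟫ := by rw [hns]; ring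
        have : c * E = ‖v - w‖ * (⟪v, σ⟫ - ⟪w, σ⟫) + 2 * ⟪v, w⟫ * c := by
          rw [e1, ← hc]; ring
        linarith
      rw [← abs_of_pos hE, ← abs_mul, this]
      refine (abs_add_le _ _).trans ?_
      rw [abs_mul, abs_mul, abs_mul, abs_mul, abs_of_nonneg hn0]
      have t1 : |⟪v, w⟫| * |c| ≤ a * b * 1 := by gcongr
      have t2 : ‖v - w‖ * |⟪w, σ⟫| ≤ (a + b) * b := by gcongr
      simp only [abs_neg, abs_two]
      nlinarith
    · have hlip := psi_lip (y := -c) hr.le hξabs (by rwa [abs_neg])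
      rw [psi_neg (q / 2) c] at hlip
      refine hlip.trans ?_
      gcongr
      rw [le_div_iff₀ hE]
      have : (ξ - -c) * E = 2 * ⟪v, w⟫ * c + 2 * ‖v - w‖ * ⟪v, σ⟫ := by
        have e1 : E = ‖v - w‖ ^ 2 + 2 * ⟪v, w⟫ := by rw [hns]; ring
        have : c * E = ‖v - w‖ * (⟪v, σ⟫ - ⟪w, σ⟫) + 2 * ⟪v, w⟫ * c := by
          rw [e1, ← hc]; ring
        linarith
      rw [← abs_of_pos hE, ← abs_mul, this]
      refine (abs_add_le _ _).trans ?_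
      rw [abs_mul, abs_mul, abs_mul, abs_mul, abs_of_nonneg hn0]
      have t1 : |⟪v, w⟫| * |c| ≤ a * b * 1 := by gcongr
      have t2 : ‖v - w‖ * |⟪v, σ⟫| ≤ (a + b) * a := by gcongr
      simp only [abs_two]
      nlinarith
  have hψ0 := psi_nonneg (r := q / 2) hc1
  have hψ1 := psi_le_one hr.le hc1
  have hEr : E ^ (q / 2) = E ^ (q / 2 - 1) * E := by
    rw [← Real.rpow_add_one hE.ne']; congr 1; ring
  have step : E ^ (q / 2) * psi (q / 2) ξ
      ≤ E ^ (q / 2) * psi (q / 2) c + 6 * (q / 2) * (E ^ (q / 2 - 1) * (a * b)) := by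
    calc E ^ (q / 2) * psi (q / 2) ξ
        ≤ E ^ (q / 2) * (psi (q / 2) c + (q / 2) * (6 * (a * b) / E)) := by gcongr
      _ = E ^ (q / 2) * psi (q / 2) c + E ^ (q / 2) * ((q / 2) * (6 * (a * b) / E)) := by ring
      _ = _ := by
        congr 1
        rw [hEr]; field_simp
  have hqa := Real.rpow_nonneg ha0 q
  have hqb := Real.rpow_nonneg hb0 q
  have hdel : delt q v w σ = E ^ (q / 2) * psi (q / 2) ξ - a ^ q - b ^ q := by
    rw [delt, hsum]
  rw [hdel]
  rcases le_total b a with h | h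
  · have ha1 : 0 < a := by
      rcases hpos with h' | h'
      · exact h'
      · linarith
    rw [max_eq_left h, min_eq_right h]
    have := real_pov ha1 hb0 h hr hψ0 hψ1
    rw [show 2 * (q / 2) = q by ring] at this
    have h3 : 0 ≤ b ^ q * psi (q / 2) c := by positivity
    unfold povK
    linarith
  · have hb1 : 0 < b := by
      rcases hpos with h' | h'
      · linarith
      · exact h'
    rw [max_eq_right h, min_eq_left h]
    have := real_pov hb1 ha0 h hr hψ0 hψ1
    rw [show 2 * (q / 2) = q by ring, add_comm (b ^ 2), mul_comm b a] at this
    have h3 : 0 ≤ a ^ q * psi (q / 2) c := by positivity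
    unfold povK
    linarith

end KacModel

namespace KacModel
variable {d : ℕ}

lemma exists_unit (hd : 2 ≤ d) : ∃ u : Vd d, ‖u‖ = 1 :=
  ⟨EuclideanSpace.single ⟨0, by omega⟩ 1, by simp⟩

lemma B_zero (hd : 2 ≤ d) {B : Vd d → Measure (Vd d)} (hB : IsCollisionKernel B) : B 0 = 0 := by
  obtain ⟨u, hu⟩ := exists_unit hd
  have := hB.scaling 0 le_rfl u hu
  simpa using this

/-- the unit direction -/
def dirU (x : Vd d) : Vd d := ‖x‖⁻¹ • x

lemma dirU_norm {x : Vd d} (hx : x ≠ 0) : ‖dirU x‖ = 1 := by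
  have : ‖x‖ ≠ 0 := norm_ne_zero_iff.mpr hx
  simp [dirU, norm_smul, this]

lemma B_eq {B : Vd d → Measure (Vd d)} (hB : IsCollisionKernel B) {x : Vd d} (hx : x ≠ 0) :
    B x = ENNReal.ofReal ‖x‖ • B (dirU x) := by
  have h0 : ‖x‖ ≠ 0 := norm_ne_zero_iff.mpr hx
  have := hB.scaling ‖x‖ (norm_nonneg x) (dirU x) (dirU_norm hx)
  rw [← this, dirU, smul_smul, mul_inv_cancel₀ h0, one_smul]

lemma B_mass (hd : 2 ≤ d) {B : Vd d → Measure (Vd d)} (hB : IsCollisionKernel B) (x : Vd d) :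
    B x Set.univ = ENNReal.ofReal ‖x‖ := by
  by_cases hx : x = 0
  · subst hx; simp [B_zero hd hB]
  · have := hB.prob _ (dirU_norm hx)
    rw [B_eq hB hx]; simp

lemma B_ae_unit {B : Vd d → Measure (Vd d)} (hB : IsCollisionKernel B) {u : Vd d} (hu : ‖u‖ = 1) :
    ∀ᵐ σ ∂(B u), ‖σ‖ = 1 ∧ |⟪u, σ⟫| < 1 := by
  have h := hB.support u hu
  rw [← compl_mem_ae_iff, compl_compl] at h
  filter_upwards [h] with σ hσ
  obtain ⟨h1, h2⟩ := hσ
  have h1 : ‖σ‖ = 1 := h1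
  refine ⟨h1, ?_⟩
  simp only [Set.mem_insert_iff, Set.mem_singleton_iff, not_or] at h2
  have hle : |⟪u, σ⟫| ≤ 1 := by simpa [hu, h1] using abs_real_inner_le_norm u σ
  refine lt_of_le_of_ne hle ?_
  intro he
  rcases (abs_eq (by norm_num)).mp he with h | h
  · exact h2.1 ((inner_eq_one_iff_of_norm_eq_one (𝕜 := ℝ) hu h1).mp h).symm
  · have h' : ⟪u, -σ⟫ = 1 := by rw [inner_neg_right, h]; norm_num
    have := (inner_eq_one_iff_of_norm_eq_one (𝕜 := ℝ) hu (by rwa [norm_neg])).mp h'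
    exact h2.2 (by rw [this]; simp)

lemma B_ae_norm (hd : 2 ≤ d) {B : Vd d → Measure (Vd d)} (hB : IsCollisionKernel B) (x : Vd d) :
    ∀ᵐ σ ∂(B x), ‖σ‖ = 1 := by
  by_cases hx : x = 0
  · subst hx; simp [B_zero hd hB]
  · rw [B_eq hB hx]
    apply Measure.ae_smul_measure
    filter_upwards [B_ae_unit hB (dirU_norm hx)] with σ hσ using hσ.1

lemma kappa_const {B : Vd d → Measure (Vd d)} (hB : IsCollisionKernel B) (r : ℝ) {u u' : Vd d}
    (hu : ‖u‖ = 1) (hu' : ‖u'‖ = 1) :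
    ∫ σ, psi r ⟪u, σ⟫ ∂(B u) = ∫ σ, psi r ⟪u', σ⟫ ∂(B u') := by
  let R : Vd d ≃ₗᵢ[ℝ] Vd d := Submodule.reflection (Submodule.span ℝ {u - u'})ᗮ
  have hR : R u = u' := Submodule.reflection_sub (hu.trans hu'.symm)
  have hm : AEStronglyMeasurable (fun σ => psi r ⟪u', σ⟫) ((B u).map R) := by
    apply Measurable.aestronglyMeasurable
    exact (psi_measurable r).comp (by fun_prop)
  rw [← hR, hB.symm R u hu, hR, integral_map R.continuous.measurable.aemeasurable hm]
  congr 1; ext σ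
  rw [← hR, R.inner_map_map]

lemma exists_beta (hd : 2 ≤ d) {B : Vd d → Measure (Vd d)} (hB : IsCollisionKernel B) {r : ℝ}
    (hr : 1 < r) : ∃ β : ℝ, 0 < β ∧ ∀ u : Vd d, ‖u‖ = 1 →
      (Integrable (fun σ => psi r ⟪u, σ⟫) (B u)) ∧ ∫ σ, psi r ⟪u, σ⟫ ∂(B u) = 1 - β := by
  have hint : ∀ u : Vd d, ‖u‖ = 1 → Integrable (fun σ => psi r ⟪u, σ⟫) (B u) := by
    intro u hu
    have := hB.prob u hu
    refine Integrable.of_bound (C := 1) ?_ ?_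
    · apply Measurable.aestronglyMeasurable
      exact (psi_measurable r).comp (by fun_prop)
    · filter_upwards [B_ae_unit hB hu] with σ hσ
      rw [Real.norm_of_nonneg (psi_nonneg hσ.2.le)]
      exact psi_le_one hr.le hσ.2.le
  obtain ⟨u₀, hu₀⟩ := exists_unit hd
  have := hB.prob u₀ hu₀
  refine ⟨1 - ∫ σ, psi r ⟪u₀, σ⟫ ∂(B u₀), ?_, ?_⟩
  · have h1 : 1 - ∫ σ, psi r ⟪u₀, σ⟫ ∂(B u₀) = ∫ σ, (1 - psi r ⟪u₀, σ⟫) ∂(B u₀) := by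
      rw [integral_sub (integrable_const _) (hint u₀ hu₀)]; simp
    rw [h1]
    have hpos : ∀ᵐ σ ∂(B u₀), 0 < 1 - psi r ⟪u₀, σ⟫ := by
      filter_upwards [B_ae_unit hB hu₀] with σ hσ
      linarith [psi_lt_one hr hσ.2]
    rw [integral_pos_iff_support_of_nonneg_ae (hpos.mono fun σ h => h.le)
      ((integrable_const _).sub (hint u₀ hu₀))]
    have : (B u₀) (Function.support fun σ => 1 - psi r ⟪u₀, σ⟫) = 1 := by
      have h2 : (Function.support fun σ => 1 - psi r ⟪u₀, σ⟫) ∈ ae (B u₀) := by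
        filter_upwards [hpos] with σ hσ using hσ.ne'
      rw [measure_congr (eventuallyEq_univ.mpr h2)]; exact measure_univ
    rw [this]; norm_num
  · intro u hu
    refine ⟨hint u hu, ?_⟩
    rw [kappa_const hB r hu hu₀]; ring

lemma delt_measurable (q : ℝ) (v w : Vd d) : Measurable (fun σ => delt q v w σ) := by
  unfold delt postV postVs; fun_prop

/-- real bounds -/
lemma max_min_le {a b q : ℝ} (ha : 0 ≤ a) (hb : 0 ≤ b) (hq : 2 < q) :
    (a + b) * (max a b ^ (q - 1) * min a b) ≤ 2 * (a ^ q * b + a * b ^ q) := by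
  have key : ∀ x y : ℝ, 0 ≤ y → y ≤ x → (x + y) * (x ^ (q - 1) * y) ≤ 2 * (x ^ q * y) := by
    intro x y hy hxy
    rcases (hy.trans hxy).eq_or_lt with h | h
    · have : y = 0 := by linarith
      subst this; simp
    · have e : x ^ q = x ^ (q - 1) * x := by
        rw [← Real.rpow_add_one h.ne']; congr 1; ring
      have := Real.rpow_nonneg h.le (q - 1)
      rw [e]
      have : x ^ (q - 1) * y * y ≤ x ^ (q - 1) * y * x := by gcongr
      linarith
  rcases le_total b a with h | h
  · rw [max_eq_left h, min_eq_right h]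
    have := key a b hb h
    have : 0 ≤ a * b ^ q := by positivity
    linarith
  · rw [max_eq_right h, min_eq_left h]
    have := key b a ha h
    have : 0 ≤ a ^ q * b := by positivity
    linarith

lemma cross_le {a b q δ : ℝ} (ha : 0 ≤ a) (hb : 0 ≤ b) (hq : 2 < q) (hδ : |a - b| ≤ δ) :
    a ^ (q + 1) + b ^ (q + 1) - 2 * (a ^ q * b + a * b ^ q) ≤ δ * (a ^ q + b ^ q) := by
  have e : ∀ x : ℝ, 0 ≤ x → x ^ (q + 1) = x ^ q * x := fun x hx =>
    Real.rpow_add_one' hx (by linarith)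
  rw [e a ha, e b hb]
  have h1 : 0 ≤ a ^ q := by positivity
  have h2 : 0 ≤ b ^ q := by positivity
  have h3 : |a - b| * (a ^ q + b ^ q) ≤ δ * (a ^ q + b ^ q) := by gcongr
  refine le_trans ?_ h3
  have m1 := le_abs_self (a - b)
  have m2 := neg_abs_le (a - b)
  have m3 : (a - b) * a ^ q ≤ |a - b| * a ^ q := by gcongr
  have m4 : -(a - b) * b ^ q ≤ |a - b| * b ^ q := by gcongr; linarith
  have : 0 ≤ a ^ q * b := by positivity
  have : 0 ≤ a * b ^ q := by positivity
  linarith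

lemma povK_nonneg {q : ℝ} (hq : 2 < q) : 0 ≤ povK q := by
  unfold povK; positivity

/-- positivity-free bound used for the supremum -/
lemma delt_le' {q : ℝ} (hq : 2 < q) (v w σ : Vd d) (hσ : ‖σ‖ = 1) (hvw : v ≠ w) :
    delt q v w σ ≤ povK q * (max ‖v‖ ‖w‖ ^ (q - 1) * min ‖v‖ ‖w‖) := by
  have hn : ‖v - w‖ ≠ 0 := norm_ne_zero_iff.mpr (sub_ne_zero.mpr hvw)
  have hn' := norm_nonneg (v - w)
  have hle : |⟪v - w, σ⟫ / ‖v - w‖| ≤ 1 := by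
    rw [abs_div, abs_of_nonneg hn']
    apply div_le_one_of_le₀ _ hn'
    simpa [hσ] using abs_real_inner_le_norm (v - w) σ
  have h := delt_le hq v w σ hσ hvw (⟪v - w, σ⟫ / ‖v - w‖) (by field_simp) hle
  have h1 := psi_le_one (r := q / 2) (by linarith) hle
  have h2 : 0 ≤ ‖v‖ ^ q + ‖w‖ ^ q := by positivity
  nlinarith

/-- norm bounds on the collision increment -/
lemma delt_integrable (hd : 2 ≤ d) {B : Vd d → Measure (Vd d)} (hB : IsCollisionKernel B)
    {q : ℝ} (hq : 2 < q) (v w x : Vd d) : Integrable (fun σ => delt q v w σ) (B x) := by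
  have : IsFiniteMeasure (B x) := ⟨by rw [B_mass hd hB]; exact ENNReal.ofReal_lt_top⟩
  have hp : ∀ y : Vd d, ‖y‖ ^ 2 ≤ ‖v‖ ^ 2 + ‖w‖ ^ 2 →
      ‖y‖ ^ q ≤ (‖v‖ ^ 2 + ‖w‖ ^ 2) ^ (q / 2) := by
    intro y hy
    rw [← rpow_sq_half (norm_nonneg y)]
    exact Real.rpow_le_rpow (by positivity) hy (by linarith)
  refine Integrable.of_bound (C := 2 * (‖v‖ ^ 2 + ‖w‖ ^ 2) ^ (q / 2) + ‖v‖ ^ q + ‖w‖ ^ q)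
    (delt_measurable q v w).aestronglyMeasurable ?_
  filter_upwards [B_ae_norm hd hB x] with σ hσ
  have h1 := hp _ (postV_norm_le v w σ hσ)
  have h2 := hp _ (postVs_norm_le v w σ hσ)
  have h3 : 0 ≤ ‖postV v w σ‖ ^ q := by positivity
  have h4 : 0 ≤ ‖postVs v w σ‖ ^ q := by positivity
  have h5 : 0 ≤ ‖v‖ ^ q := by positivity
  have h6 : 0 ≤ ‖w‖ ^ q := by positivity
  rw [Real.norm_eq_abs, abs_le, delt]
  constructor <;> linarith

/-- integrated Povzner -/
lemma povzner (hd : 2 ≤ d) {B : Vd d → Measure (Vd d)} (hB : IsCollisionKernel B)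
    {q : ℝ} (hq : 2 < q) : ∃ β C : ℝ, 0 < β ∧ 0 ≤ C ∧ ∀ v w : Vd d,
      ∫ σ, delt q v w σ ∂(B (v - w)) ≤ -β * (‖v‖ ^ (q + 1) + ‖w‖ ^ (q + 1))
        + C * (‖v‖ ^ q * ‖w‖ + ‖v‖ * ‖w‖ ^ q) := by
  obtain ⟨β, hβ, hint⟩ := exists_beta hd hB (r := q / 2) (by linarith)
  have hK := povK_nonneg hq
  refine ⟨β, 2 * povK q + 2 * β, hβ, by positivity, ?_⟩
  intro v w
  have hmm := max_min_le (norm_nonneg v) (norm_nonneg w) hq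
  have hcr := cross_le (norm_nonneg v) (norm_nonneg w) hq (abs_norm_sub_norm_le v w)
  by_cases hvw : v = w
  · subst hvw
    rw [sub_self, B_zero hd hB, integral_zero_measure]
    simp only [sub_self, norm_zero, zero_mul] at hcr
    have h0 : 0 ≤ ‖v‖ ^ q * ‖v‖ + ‖v‖ * ‖v‖ ^ q := by positivity
    nlinarith
  · have hx : v - w ≠ 0 := sub_ne_zero.mpr hvw
    have hn : ‖v - w‖ ≠ 0 := norm_ne_zero_iff.mpr hx
    set u := dirU (v - w) with hu
    have hu1 : ‖u‖ = 1 := dirU_norm hx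
    have := hB.prob u hu1
    obtain ⟨hi, hv⟩ := hint u hu1
    set Mm := max ‖v‖ ‖w‖ ^ (q - 1) * min ‖v‖ ‖w‖ with hMm
    have hMm0 : 0 ≤ Mm := by positivity
    rw [B_eq hB hx, integral_smul_measure, ENNReal.toReal_ofReal (norm_nonneg _), smul_eq_mul]
    have hle : ∫ σ, delt q v w σ ∂(B u) ≤
        ∫ σ, ((psi (q / 2) ⟪u, σ⟫ - 1) * (‖v‖ ^ q + ‖w‖ ^ q) + povK q * Mm) ∂(B u) := by
      apply integral_mono_ae (delt_integrable hd hB hq v w u)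
      · exact ((hi.sub (integrable_const _)).mul_const _).add (integrable_const _)
      · filter_upwards [B_ae_unit hB hu1] with σ hσ
        have := delt_le hq v w σ hσ.1 hvw ⟪u, σ⟫ (by
          rw [hu, dirU, inner_smul_left]
          simp only [conj_trivial]
          field_simp) hσ.2.le
        linarith
    have hi2 : Integrable (fun σ => (psi (q / 2) ⟪u, σ⟫ - 1) * (‖v‖ ^ q + ‖w‖ ^ q)) (B u) :=
      (hi.sub (integrable_const _)).mul_const _
    rw [integral_add hi2 (integrable_const _),
      integral_mul_const, integral_sub hi (integrable_const _), hv] at hle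
    simp only [integral_const, probReal_univ, smul_eq_mul, one_mul] at hle
    have hnn := norm_nonneg (v - w)
    have h1 : ‖v - w‖ * ∫ σ, delt q v w σ ∂(B u)
        ≤ ‖v - w‖ * ((1 - β - 1) * (‖v‖ ^ q + ‖w‖ ^ q) + povK q * Mm) := by gcongr
    have h2 : ‖v - w‖ * Mm ≤ (‖v‖ + ‖w‖) * Mm := by gcongr; exact norm_sub_le _ _
    have h3 : povK q * (‖v - w‖ * Mm) ≤ povK q * (2 * (‖v‖ ^ q * ‖w‖ + ‖v‖ * ‖w‖ ^ q)) := by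
      exact mul_le_mul_of_nonneg_left (h2.trans hmm) hK
    have h4 := mul_le_mul_of_nonneg_left hcr hβ.le
    linarith

end KacModel

namespace KacModel
variable {d : ℕ}

/-- empirical measure of a configuration -/
def emp {N : ℕ} (x : Fin N → Vd d) : Measure (Vd d) :=
  (N : ℝ≥0∞)⁻¹ • ∑ i, Measure.dirac (x i)

/-- real moment -/
def mo (q : ℝ) (ν : Measure (Vd d)) : ℝ := ∫ v, ‖v‖ ^ q ∂ν

variable {N : ℕ} {x : Fin N → Vd d}

lemma integrable_emp (f : Vd d → ℝ) (hN : N ≠ 0) : Integrable f (emp x) := by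
  unfold emp
  apply Integrable.smul_measure
  · rw [integrable_finsetSum_measure]
    intro i _
    exact integrable_dirac (by simp)
  · simp [hN]

lemma integral_emp {F : Type*} [NormedAddCommGroup F] [NormedSpace ℝ F] [CompleteSpace F]
    (f : Vd d → F) : ∫ v, f v ∂(emp x) = (N : ℝ)⁻¹ • ∑ i, f (x i) := by
  unfold emp
  rw [integral_smul_measure, integral_finsetSum_measure]
  · simp
  · intro i _; exact integrable_dirac (by simp)

lemma lintegral_emp (f : Vd d → ℝ≥0∞) :
    ∫⁻ v, f v ∂(emp x) = (N : ℝ≥0∞)⁻¹ * ∑ i, f (x i) := by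
  unfold emp
  rw [lintegral_smul_measure, lintegral_finsetSum_measure]
  simp

/-- configurations on the Boltzmann sphere -/
def Good (x : Fin N → Vd d) : Prop := N ≠ 0 ∧ ∑ i, ‖x i‖ ^ 2 = N

lemma mem_emp {ν : Measure (Vd d)} (h : ν ∈ empiricalSphere d N) :
    ∃ x : Fin N → Vd d, ν = emp x ∧ Good x := by
  obtain ⟨⟨hp, _, h2⟩, x, rfl⟩ := h
  refine ⟨x, rfl, ?_⟩
  change IsProbabilityMeasure (emp x) at hp
  change ∫ v, ‖v‖ ^ 2 ∂(emp x) = 1 at h2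
  have hN : N ≠ 0 := by
    rintro rfl
    have : (emp x) Set.univ = 1 := hp.measure_univ
    simp [emp] at this
  refine ⟨hN, ?_⟩
  rw [integral_emp, smul_eq_mul] at h2
  have : (N : ℝ) ≠ 0 := by exact_mod_cast hN
  field_simp at h2
  exact h2

lemma emp_prob (hN : N ≠ 0) : IsProbabilityMeasure (emp x) := by
  constructor
  have : (N : ℝ≥0∞) ≠ 0 := by exact_mod_cast hN
  simp [emp, ENNReal.inv_mul_cancel this]

lemma Good.norm_le (h : Good x) (i : Fin N) : ‖x i‖ ^ 2 ≤ N := by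
  rw [← h.2]
  exact Finset.single_le_sum (f := fun i => ‖x i‖ ^ 2) (fun j _ => by positivity) (Finset.mem_univ i)

lemma Good.pos (h : Good x) : (0 : ℝ) < N := by
  have := h.1
  positivity

lemma mo_emp (q : ℝ) : mo q (emp x) = (N : ℝ)⁻¹ * ∑ i, ‖x i‖ ^ q := by
  rw [mo, integral_emp, smul_eq_mul]

lemma mo_nonneg (q : ℝ) (ν : Measure (Vd d)) : 0 ≤ mo q ν :=
  integral_nonneg fun v => by positivity

lemma momentL_emp (q : ℝ) (hq : 0 ≤ q) (hN : N ≠ 0) :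
    momentL q (emp x) = ENNReal.ofReal (mo q (emp x)) := by
  rw [mo, ofReal_integral_eq_lintegral_ofReal (integrable_emp _ hN)
    (ae_of_all _ fun v => by positivity), momentL]
  congr 1; ext v
  rw [← ENNReal.ofReal_rpow_of_nonneg (norm_nonneg v) hq, ofReal_norm]
  rfl

lemma mo_two (h : Good x) : mo 2 (emp x) = 1 := by
  rw [mo_emp]
  have := h.2
  have hp := h.pos
  simp only [Real.rpow_two]
  rw [this]; field_simp

lemma avg_mono (f g : Fin N → ℝ) (h : ∀ i, f i ≤ g i) :
    (N : ℝ)⁻¹ * ∑ i, f i ≤ (N : ℝ)⁻¹ * ∑ i, g i := by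
  gcongr with i _; exact h i

lemma mo_one_le (h : Good x) : mo 1 (emp x) ≤ 1 := by
  have hp := h.pos
  have h2 := h.2
  rw [mo_emp]
  refine (avg_mono _ (fun i => (1 + ‖x i‖ ^ 2) / 2) ?_).trans ?_
  · intro i; rw [Real.rpow_one]; nlinarith [sq_nonneg (‖x i‖ - 1)]
  · rw [← Finset.sum_div, Finset.sum_add_distrib, h2]
    simp only [Finset.sum_const, Finset.card_univ, Fintype.card_fin, nsmul_eq_mul, mul_one]
    apply le_of_eq; field_simp; norm_num

lemma one_le_mo (h : Good x) {r : ℝ} (hr : 2 ≤ r) : 1 ≤ mo r (emp x) := by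
  have hp := h.pos
  have h2 := h.2
  rw [mo_emp]
  refine le_trans ?_ (avg_mono (fun i => 1 + (r / 2) * (‖x i‖ ^ 2 - 1)) _ ?_)
  · rw [Finset.sum_add_distrib, ← Finset.mul_sum, Finset.sum_sub_distrib, h2]
    simp only [Finset.sum_const, Finset.card_univ, Fintype.card_fin, nsmul_eq_mul, mul_one]
    apply le_of_eq; field_simp; ring
  · intro i
    have := one_add_mul_self_le_rpow_one_add (s := ‖x i‖ ^ 2 - 1) (p := r / 2)
      (by nlinarith [sq_nonneg ‖x i‖]) (by linarith)
    rw [show 1 + (‖x i‖ ^ 2 - 1) = ‖x i‖ ^ 2 by ring, rpow_sq_half (norm_nonneg _)] at this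
    exact this

lemma Good.rpow_le (h : Good x) {q : ℝ} (hq : 0 ≤ q) (i : Fin N) :
    ‖x i‖ ^ q ≤ (N : ℝ) ^ (q / 2) := by
  rw [← rpow_sq_half (norm_nonneg _)]
  exact Real.rpow_le_rpow (by positivity) (h.norm_le i) (by linarith)

lemma mo_le (h : Good x) {q : ℝ} (hq : 0 ≤ q) : mo q (emp x) ≤ (N : ℝ) ^ (q / 2) := by
  have hp := h.pos
  rw [mo_emp]
  refine (avg_mono _ (fun i => (N : ℝ) ^ (q / 2)) (h.rpow_le hq)).trans ?_
  simp only [Finset.sum_const, Finset.card_univ, Fintype.card_fin, nsmul_eq_mul]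
  apply le_of_eq; field_simp

/-- interpolation -/
lemma mo_interp (h : Good x) {p q A : ℝ} (hp : 0 ≤ p) (hpq : p ≤ q) (hA : 0 < A) :
    A * mo q (emp x) ≤ mo (q + 1) (emp x) + A ^ (q + 1 - p) * mo p (emp x) := by
  have hn := h.pos
  simp only [mo_emp]
  have : ∀ i, A * ‖x i‖ ^ q ≤ ‖x i‖ ^ (q + 1) + A ^ (q + 1 - p) * ‖x i‖ ^ p := by
    intro i
    have h0 := norm_nonneg (x i)
    set a := ‖x i‖
    rw [Real.rpow_add_one' h0 (by linarith)]
    rcases le_total A a with hc | hc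
    · have : A * a ^ q ≤ a * a ^ q := by gcongr
      have : 0 ≤ A ^ (q + 1 - p) * a ^ p := by positivity
      linarith
    · rcases h0.eq_or_lt with h00 | h00
      · rw [← h00]
        have h1 : 0 ≤ A ^ (q + 1 - p) * (0:ℝ) ^ p := by positivity
        rcases (hp.trans hpq).eq_or_lt with hq0 | hq0
        · have : p = 0 := by linarith
          subst this; subst hq0; simp
        · rw [Real.zero_rpow hq0.ne']; simpa using h1
      · have e : a ^ q = a ^ (q - p) * a ^ p := by rw [← Real.rpow_add h00]; congr 1; ring
        have e2 : A ^ (q + 1 - p) = A * A ^ (q - p) := by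
          rw [mul_comm, ← Real.rpow_add_one hA.ne']; congr 1; ring
        have h3 : a ^ (q - p) ≤ A ^ (q - p) := Real.rpow_le_rpow h0 hc (by linarith)
        have h4 : A * a ^ q ≤ A * A ^ (q - p) * a ^ p := by
          rw [e, mul_assoc]; gcongr
        rw [e2]
        have : 0 ≤ a ^ q * a := by positivity
        linarith
  have h2 := avg_mono _ _ this
  rw [← Finset.mul_sum, Finset.sum_add_distrib, ← Finset.mul_sum] at h2
  linarith

lemma kacGen_emp (B : Vd d → Measure (Vd d)) (G : Measure (Vd d) → ℝ) :
    kacGen B N G (emp x) = N * ((N : ℝ)⁻¹ * ∑ i, ((N : ℝ)⁻¹ * ∑ j,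
      ∫ σ, (G (collUpdate N (emp x) (x i) (x j) σ) - G (emp x)) ∂(B (x i - x j)))) := by
  rw [kacGen, integral_emp, smul_eq_mul]
  congr 3; ext i
  rw [integral_emp, smul_eq_mul]

lemma kacGen_le (hN : Good x) (B : Vd d → Measure (Vd d)) (G : Measure (Vd d) → ℝ)
    (D : Fin N → Fin N → ℝ)
    (hD : ∀ i j, ∫ σ, (G (collUpdate N (emp x) (x i) (x j) σ) - G (emp x)) ∂(B (x i - x j))
      ≤ (N : ℝ)⁻¹ * D i j) :
    kacGen B N G (emp x) ≤ (N : ℝ)⁻¹ * ∑ i, ((N : ℝ)⁻¹ * ∑ j, D i j) := by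
  have hp := hN.pos
  rw [kacGen_emp]
  calc _ ≤ (N : ℝ) * ((N : ℝ)⁻¹ * ∑ i, ((N : ℝ)⁻¹ * ∑ j, (N : ℝ)⁻¹ * D i j)) := by
        gcongr with i _ j _; exact hD i j
    _ = _ := by
        simp only [← Finset.mul_sum]
        field_simp

lemma pair_le {i j : Fin N} (hij : x i ≠ x j) :
    (N : ℝ≥0∞)⁻¹ • (Measure.dirac (x i) + Measure.dirac (x j)) ≤ emp x := by
  unfold emp
  have hne : i ≠ j := fun h => hij (by rw [h])
  have : Measure.dirac (x i) + Measure.dirac (x j) ≤ ∑ i, Measure.dirac (x i) := by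
    rw [← Finset.sum_pair (f := fun i => Measure.dirac (x i)) hne]
    refine Measure.le_iff.2 fun s _ => ?_
    rw [Measure.finsetSum_apply, Measure.finsetSum_apply]
    exact Finset.sum_le_sum_of_subset (Finset.subset_univ _)
  intro s
  simp only [Measure.smul_apply, smul_eq_mul]
  gcongr

lemma coll_id (hN : N ≠ 0) {i j : Fin N} (hij : x i ≠ x j) (σ : Vd d) :
    collUpdate N (emp x) (x i) (x j) σ +
      (N : ℝ≥0∞)⁻¹ • (Measure.dirac (x i) + Measure.dirac (x j)) =
    emp x + (N : ℝ≥0∞)⁻¹ • (Measure.dirac (postV (x i) (x j) σ) +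
      Measure.dirac (postVs (x i) (x j) σ)) := by
  unfold collUpdate
  have : IsFiniteMeasure ((N : ℝ≥0∞)⁻¹ • (Measure.dirac (x i) + Measure.dirac (x j))) := by
    constructor
    have : (N : ℝ≥0∞)⁻¹ < ⊤ := by
      rw [ENNReal.inv_lt_top]; positivity
    simp only [Measure.smul_apply, smul_eq_mul]
    exact ENNReal.mul_lt_top this (by simp)
  apply Measure.sub_add_cancel_of_le
  refine (pair_le hij).trans ?_
  exact Measure.le_add_right le_rfl

/-- clamped functional -/
def clampF (H : ℝ) (L : Measure (Vd d) → ℝ≥0∞) (ν : Measure (Vd d)) : ℝ :=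
  (min (L ν) (ENNReal.ofReal H)).toReal

lemma clampF_meas (H : ℝ) {L : Measure (Vd d) → ℝ≥0∞} (hL : Measurable L) :
    Measurable (clampF H L) := by
  unfold clampF
  exact (hL.min measurable_const).ennreal_toReal

lemma clampF_nonneg (H : ℝ) (L : Measure (Vd d) → ℝ≥0∞) (ν) : 0 ≤ clampF H L ν :=
  ENNReal.toReal_nonneg

lemma clampF_le {H : ℝ} (hH : 0 ≤ H) (L : Measure (Vd d) → ℝ≥0∞) (ν) : clampF H L ν ≤ H := by
  unfold clampF
  exact ENNReal.toReal_le_of_le_ofReal hH (min_le_right _ _)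

lemma clampF_abs {H : ℝ} (hH : 0 ≤ H) (L : Measure (Vd d) → ℝ≥0∞) (ν) : |clampF H L ν| ≤ H := by
  rw [abs_of_nonneg (clampF_nonneg H L ν)]; exact clampF_le hH L ν

lemma clampF_sub_le {H e : ℝ} (he : 0 ≤ e) {L : Measure (Vd d) → ℝ≥0∞} {α ν : Measure (Vd d)}
    (h : L α ≤ L ν + ENNReal.ofReal e) : clampF H L α - clampF H L ν ≤ e := by
  unfold clampF
  have h1 : min (L α) (ENNReal.ofReal H) ≤ min (L ν) (ENNReal.ofReal H) + ENNReal.ofReal e := by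
    rw [← min_add_add_right]
    exact min_le_min h le_self_add
  have h2 := ENNReal.toReal_mono (by simp) h1
  rw [ENNReal.toReal_add (by simp) (by simp), ENNReal.toReal_ofReal he] at h2
  linarith

lemma clampF_eq {H : ℝ} {L : Measure (Vd d) → ℝ≥0∞} {ν : Measure (Vd d)}
    (h : L ν ≤ ENNReal.ofReal H) : clampF H L ν = (L ν).toReal := by
  rw [clampF, min_eq_left h]

lemma integral_le_const {α : Type*} [MeasurableSpace α] {μ : Measure α} [IsFiniteMeasure μ]
    {f : α → ℝ} {c : ℝ} (hc : 0 ≤ c) (h : ∀ᵐ a ∂μ, f a ≤ c) : ∫ a, f a ∂μ ≤ μ.real Set.univ * c := by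
  by_cases hf : Integrable f μ
  · refine (integral_mono_ae hf (integrable_const c) h).trans ?_
    simp
  · rw [integral_undef hf]; positivity

lemma kacGen_pos_le (hd : 2 ≤ d) {B : Vd d → Measure (Vd d)} (hB : IsCollisionKernel B)
    (hN : Good x) (G : Measure (Vd d) → ℝ) (c : ℝ) (e : Fin N → Fin N → ℝ) (he : ∀ i j, 0 ≤ e i j)
    (h : ∀ i j, x i ≠ x j → ∀ σ, ‖σ‖ = 1 →
      G (collUpdate N (emp x) (x i) (x j) σ) - G (emp x) ≤ (N : ℝ)⁻¹ * e i j) :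
    kacGen B N (fun ν => max (G ν - c) 0) (emp x) ≤
      (N : ℝ)⁻¹ * ∑ i, ((N : ℝ)⁻¹ * ∑ j, ‖x i - x j‖ * e i j) := by
  have hp := hN.pos
  apply kacGen_le hN
  intro i j
  by_cases hij : x i = x j
  · rw [hij, sub_self, B_zero hd hB]; simp
  · have hf : IsFiniteMeasure (B (x i - x j)) :=
      ⟨by rw [B_mass hd hB]; exact ENNReal.ofReal_lt_top⟩
    refine (integral_le_const (c := (N : ℝ)⁻¹ * e i j) ?_ ?_).trans ?_
    · have := he i j; positivity
    · filter_upwards [B_ae_norm hd hB (x i - x j)] with σ hσ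
      have h1 := h i j hij σ hσ
      have h2 : 0 ≤ (N : ℝ)⁻¹ * e i j := by have := he i j; positivity
      rw [sub_le_iff_le_add]
      apply max_le
      · have := le_max_left (G (emp x) - c) 0; linarith
      · have := le_max_right (G (emp x) - c) 0; linarith
    · rw [Measure.real, B_mass hd hB, ENNReal.toReal_ofReal (norm_nonneg _)]
      apply le_of_eq; ring

/-- bound of the generator on a bounded functional -/
lemma kacGen_abs_le (hd : 2 ≤ d) {B : Vd d → Measure (Vd d)} (hB : IsCollisionKernel B)
    (hN : Good x) (G : Measure (Vd d) → ℝ) {M : ℝ} (hM : ∀ ν, |G ν| ≤ M) :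
    |kacGen B N G (emp x)| ≤ N * (4 * M * (N : ℝ) ^ (1 / 2 : ℝ)) := by
  have hp := hN.pos
  have hM0 : 0 ≤ M := (abs_nonneg _).trans (hM 0)
  set K := 4 * M * (N : ℝ) ^ (1 / 2 : ℝ) with hK
  have hterm : ∀ i j, |∫ σ, (G (collUpdate N (emp x) (x i) (x j) σ) - G (emp x)) ∂(B (x i - x j))|
      ≤ K := by
    intro i j
    have hf : IsFiniteMeasure (B (x i - x j)) :=
      ⟨by rw [B_mass hd hB]; exact ENNReal.ofReal_lt_top⟩
    have h1 := norm_integral_le_of_norm_le_const (μ := B (x i - x j))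
      (f := fun σ => G (collUpdate N (emp x) (x i) (x j) σ) - G (emp x)) (C := 2 * M)
      (ae_of_all _ fun σ => by
        have := abs_sub (G (collUpdate N (emp x) (x i) (x j) σ)) (G (emp x))
        have := hM (collUpdate N (emp x) (x i) (x j) σ)
        have := hM (emp x)
        rw [Real.norm_eq_abs]; linarith)
    rw [Real.norm_eq_abs, Measure.real, B_mass hd hB, ENNReal.toReal_ofReal (norm_nonneg _)] at h1
    refine h1.trans ?_
    have h2 := norm_sub_le (x i) (x j)
    have h3 := hN.rpow_le (q := 1) (by norm_num) i
    have h4 := hN.rpow_le (q := 1) (by norm_num) j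
    rw [Real.rpow_one] at h3 h4
    have : 2 * M * ‖x i - x j‖ ≤ 2 * M * (2 * (N : ℝ) ^ (1 / 2 : ℝ)) := by gcongr; linarith
    rw [hK]; linarith
  rw [kacGen_emp, abs_mul, abs_mul, abs_of_pos hp, abs_of_pos (inv_pos.mpr hp)]
  gcongr
  have hcard : ∀ (f : Fin N → ℝ), (∀ i, |f i| ≤ K) → (N : ℝ)⁻¹ * |∑ i, f i| ≤ K := by
    intro f hf
    calc (N : ℝ)⁻¹ * |∑ i, f i| ≤ (N : ℝ)⁻¹ * ∑ i, |f i| := by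
          gcongr; exact Finset.abs_sum_le_sum_abs _ _
      _ ≤ (N : ℝ)⁻¹ * ∑ i, K := avg_mono _ _ hf
      _ = K := by
          simp only [Finset.sum_const, Finset.card_univ, Fintype.card_fin, nsmul_eq_mul]
          field_simp
  apply hcard
  intro i
  rw [abs_mul, abs_of_pos (inv_pos.mpr hp)]
  exact hcard _ (hterm i)

end KacModel

namespace KacModel
variable {d : ℕ}
variable {N : ℕ} {x : Fin N → Vd d}

lemma avg_pair (hN : (0:ℝ) < N) (f g : Fin N → ℝ) :
    (N : ℝ)⁻¹ * ∑ i, ((N : ℝ)⁻¹ * ∑ j, (f i + g j)) =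
      (N : ℝ)⁻¹ * ∑ i, f i + (N : ℝ)⁻¹ * ∑ j, g j := by
  simp only [Finset.sum_add_distrib, Finset.sum_const, Finset.card_univ, Fintype.card_fin,
    nsmul_eq_mul, mul_add]
  simp only [← mul_assoc, inv_mul_cancel₀ hN.ne', one_mul]

lemma avg_prod (f g : Fin N → ℝ) :
    (N : ℝ)⁻¹ * ∑ i, ((N : ℝ)⁻¹ * ∑ j, (f i * g j)) =
      ((N : ℝ)⁻¹ * ∑ i, f i) * ((N : ℝ)⁻¹ * ∑ j, g j) := by
  simp only [← Finset.mul_sum, ← Finset.sum_mul]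
  ring

lemma avg2_mono (f g : Fin N → Fin N → ℝ) (h : ∀ i j, f i j ≤ g i j) :
    (N : ℝ)⁻¹ * ∑ i, ((N : ℝ)⁻¹ * ∑ j, f i j) ≤ (N : ℝ)⁻¹ * ∑ i, ((N : ℝ)⁻¹ * ∑ j, g i j) :=
  avg_mono _ _ fun i => avg_mono _ _ (h i)

lemma avg2_add (f g : Fin N → Fin N → ℝ) :
    (N : ℝ)⁻¹ * ∑ i, ((N : ℝ)⁻¹ * ∑ j, (f i j + g i j)) =
    (N : ℝ)⁻¹ * ∑ i, ((N : ℝ)⁻¹ * ∑ j, f i j) + (N : ℝ)⁻¹ * ∑ i, ((N : ℝ)⁻¹ * ∑ j, g i j) := by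
  simp only [Finset.sum_add_distrib, mul_add]

lemma avg2_smul (c : ℝ) (f : Fin N → Fin N → ℝ) :
    (N : ℝ)⁻¹ * ∑ i, ((N : ℝ)⁻¹ * ∑ j, (c * f i j)) =
    c * ((N : ℝ)⁻¹ * ∑ i, ((N : ℝ)⁻¹ * ∑ j, f i j)) := by
  simp only [← Finset.mul_sum]; ring

lemma momentL_meas (q : ℝ) : Measurable (momentL q : Measure (Vd d) → ℝ≥0∞) := by
  unfold momentL
  apply Measure.measurable_lintegral
  fun_prop

lemma lint_dirac2 (f : Vd d → ℝ≥0∞) (a b : Vd d) :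
    ∫⁻ v, f v ∂((N : ℝ≥0∞)⁻¹ • (Measure.dirac a + Measure.dirac b)) =
      (N : ℝ≥0∞)⁻¹ * (f a + f b) := by
  rw [lintegral_smul_measure, lintegral_add_measure]; simp

lemma lint_coll (hN : N ≠ 0) {i j : Fin N} (hij : x i ≠ x j) (σ : Vd d) (f : Vd d → ℝ≥0∞) :
    ∫⁻ v, f v ∂(collUpdate N (emp x) (x i) (x j) σ) + (N : ℝ≥0∞)⁻¹ * (f (x i) + f (x j)) =
    ∫⁻ v, f v ∂(emp x) +
      (N : ℝ≥0∞)⁻¹ * (f (postV (x i) (x j) σ) + f (postVs (x i) (x j) σ)) := by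
  have := coll_id (x := x) hN hij σ
  have h2 := congrArg (fun ρ => ∫⁻ v, f v ∂ρ) this
  simp only [lintegral_add_measure _ (emp x), lintegral_add_measure _ (collUpdate _ _ _ _ _)] at h2
  rw [lint_dirac2, lint_dirac2] at h2
  exact h2

lemma nn_rpow (v : Vd d) {q : ℝ} (hq : 0 ≤ q) :
    (‖v‖₊ : ℝ≥0∞) ^ q = ENNReal.ofReal (‖v‖ ^ q) := by
  rw [← ENNReal.ofReal_rpow_of_nonneg (norm_nonneg v) hq, ofReal_norm]; rfl

lemma ninv (hN : (0:ℝ) < N) : (N : ℝ≥0∞)⁻¹ = ENNReal.ofReal ((N : ℝ)⁻¹) := by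
  rw [ENNReal.ofReal_inv_of_pos hN, ENNReal.ofReal_natCast]

lemma momentL_coll (h : Good x) {q : ℝ} (hq : 0 ≤ q) {i j : Fin N} (hij : x i ≠ x j) (σ : Vd d) :
    momentL q (collUpdate N (emp x) (x i) (x j) σ) =
      ENNReal.ofReal (mo q (emp x) + (N : ℝ)⁻¹ * delt q (x i) (x j) σ) := by
  have hp := h.pos
  have h1 := lint_coll h.1 hij σ (fun v => (‖v‖₊ : ℝ≥0∞) ^ q)
  change momentL q _ + _ = momentL q (emp x) + _ at h1
  rw [momentL_emp q hq h.1, ninv hp] at h1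
  simp only [nn_rpow _ hq] at h1
  have m0 := mo_nonneg q (emp x)
  rw [← ENNReal.ofReal_add (by positivity) (by positivity),
    ← ENNReal.ofReal_add (by positivity) (by positivity), ← ENNReal.ofReal_mul (by positivity),
    ← ENNReal.ofReal_mul (by positivity), ← ENNReal.ofReal_add (by positivity) (by positivity)] at h1
  have h2 := ENNReal.eq_sub_of_add_eq ENNReal.ofReal_ne_top h1
  rw [h2, ← ENNReal.ofReal_sub _ (by positivity)]
  congr 1
  unfold delt; ring

/-- cutoff level -/
def Hq (N : ℕ) (q : ℝ) : ℝ := 3 * (2 * N : ℝ) ^ (q / 2)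

/-- bounded version of the moment functional -/
def Gq (N : ℕ) (q : ℝ) : Measure (Vd d) → ℝ := clampF (Hq N q) (momentL q)

lemma Hq_nonneg (N : ℕ) (q : ℝ) : 0 ≤ Hq N q := by unfold Hq; positivity

lemma mo_le_H (h : Good x) {q : ℝ} (hq : 0 ≤ q) : mo q (emp x) ≤ Hq N q := by
  have := mo_le h hq
  have hp := h.pos
  have h2 : (N : ℝ) ^ (q / 2) ≤ (2 * N : ℝ) ^ (q / 2) :=
    Real.rpow_le_rpow hp.le (by linarith) (by linarith)
  have : 0 ≤ (N : ℝ) ^ (q / 2) := by positivity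
  unfold Hq; linarith

lemma Gq_emp (h : Good x) {q : ℝ} (hq : 0 ≤ q) : Gq N q (emp x) = mo q (emp x) := by
  unfold Gq
  rw [clampF_eq, momentL_emp q hq h.1, ENNReal.toReal_ofReal (mo_nonneg _ _)]
  rw [momentL_emp q hq h.1]
  exact ENNReal.ofReal_le_ofReal (mo_le_H h hq)

lemma sq_rpow_le {a M q : ℝ} (ha : 0 ≤ a) (h : a ^ 2 ≤ M) (hq : 0 ≤ q) : a ^ q ≤ M ^ (q / 2) := by
  rw [← rpow_sq_half ha]
  exact Real.rpow_le_rpow (by positivity) h (by linarith)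

lemma Gq_coll (h : Good x) {q : ℝ} (hq : 0 ≤ q) {i j : Fin N} (hij : x i ≠ x j) {σ : Vd d}
    (hσ : ‖σ‖ = 1) : Gq N q (collUpdate N (emp x) (x i) (x j) σ) - Gq N q (emp x) =
      (N : ℝ)⁻¹ * delt q (x i) (x j) σ := by
  have hp := h.pos
  have h1 := momentL_coll h hq hij σ
  have hN1 : (N : ℝ)⁻¹ ≤ 1 := by
    apply inv_le_one_of_one_le₀
    have := h.1
    exact_mod_cast Nat.one_le_iff_ne_zero.mpr this
  have hi := h.norm_le i
  have hj := h.norm_le j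
  have hv := sq_rpow_le (norm_nonneg _) ((postV_norm_le (x i) (x j) σ hσ).trans
    (show _ ≤ (2 * N : ℝ) by linarith)) hq
  have hvs := sq_rpow_le (norm_nonneg _) ((postVs_norm_le (x i) (x j) σ hσ).trans
    (show _ ≤ (2 * N : ℝ) by linarith)) hq
  have hm := mo_le h hq
  have h2 : (N : ℝ) ^ (q / 2) ≤ (2 * N : ℝ) ^ (q / 2) :=
    Real.rpow_le_rpow hp.le (by linarith) (by linarith)
  -- nonnegativity
  have hpos : 0 ≤ mo q (emp x) + (N : ℝ)⁻¹ * delt q (x i) (x j) σ := by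
    have h3 : (N : ℝ)⁻¹ * (‖x i‖ ^ q + ‖x j‖ ^ q) ≤ mo q (emp x) := by
      rw [mo_emp]
      gcongr
      have hne : i ≠ j := fun h => hij (by rw [h])
      rw [← Finset.sum_pair (f := fun i => ‖x i‖ ^ q) hne]
      exact Finset.sum_le_sum_of_subset_of_nonneg (Finset.subset_univ _)
        (fun _ _ _ => by positivity)
    have h4 : 0 ≤ (N : ℝ)⁻¹ * (‖postV (x i) (x j) σ‖ ^ q + ‖postVs (x i) (x j) σ‖ ^ q) := by
      positivity
    unfold delt
    nlinarith
  have hle : mo q (emp x) + (N : ℝ)⁻¹ * delt q (x i) (x j) σ ≤ Hq N q := by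
    have h5 : delt q (x i) (x j) σ ≤ 2 * (2 * N : ℝ) ^ (q / 2) := by
      unfold delt
      have : 0 ≤ ‖x i‖ ^ q := by positivity
      have : 0 ≤ ‖x j‖ ^ q := by positivity
      linarith
    have h6 : 0 ≤ 2 * (2 * N : ℝ) ^ (q / 2) := by positivity
    have h7 : (N : ℝ)⁻¹ * delt q (x i) (x j) σ ≤ 1 * (2 * (2 * N : ℝ) ^ (q / 2)) :=
      (mul_le_mul_of_nonneg_left h5 (by positivity)).trans
        (mul_le_mul_of_nonneg_right hN1 h6)
    unfold Hq; linarith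
  rw [Gq_emp h hq]
  unfold Gq
  rw [clampF_eq (by rw [h1]; exact ENNReal.ofReal_le_ofReal hle), h1, ENNReal.toReal_ofReal hpos]
  ring

lemma Gq_meas (N : ℕ) (q : ℝ) : Measurable (Gq N q : Measure (Vd d) → ℝ) :=
  clampF_meas _ (momentL_meas q)

lemma Gq_abs (N : ℕ) (q : ℝ) (ν : Measure (Vd d)) : |Gq N q ν| ≤ Hq N q :=
  clampF_abs (Hq_nonneg N q) _ ν

lemma gen_moment (hd : 2 ≤ d) {B : Vd d → Measure (Vd d)} (hB : IsCollisionKernel B)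
    {q : ℝ} (hq : 2 < q) : ∃ β C : ℝ, 0 < β ∧ 0 ≤ C ∧ ∀ (N : ℕ) (x : Fin N → Vd d), Good x →
      kacGen B N (Gq N q) (emp x) ≤ -β * mo (q + 1) (emp x) + C * mo q (emp x) := by
  obtain ⟨β, C, hβ, hC, hpov⟩ := povzner hd hB hq
  refine ⟨2 * β, 2 * C, by positivity, by positivity, ?_⟩
  intro N x h
  have hp := h.pos
  refine (kacGen_le h B _ (fun i j => -β * (‖x i‖ ^ (q + 1) + ‖x j‖ ^ (q + 1))
        + C * (‖x i‖ ^ q * ‖x j‖ + ‖x i‖ * ‖x j‖ ^ q)) ?_).trans ?_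
  · intro i j
    by_cases hij : x i = x j
    · rw [hij, sub_self, B_zero hd hB]
      have := hpov (x j) (x j)
      rw [sub_self, B_zero hd hB] at this
      simp only [integral_zero_measure] at this ⊢
      positivity
    · have : ∫ σ, (Gq N q (collUpdate N (emp x) (x i) (x j) σ) - Gq N q (emp x)) ∂(B (x i - x j))
          = ∫ σ, (N : ℝ)⁻¹ * delt q (x i) (x j) σ ∂(B (x i - x j)) := by
        apply integral_congr_ae
        filter_upwards [B_ae_norm hd hB (x i - x j)] with σ hσ
        exact Gq_coll h (by linarith) hij hσ
      rw [this, integral_const_mul]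
      gcongr
      exact hpov _ _
  · rw [avg2_add, avg2_smul, avg2_smul,
      avg_pair hp (fun i => ‖x i‖ ^ (q + 1)) (fun i => ‖x i‖ ^ (q + 1)), avg2_add, avg_prod, avg_prod]
    rw [← mo_emp, ← mo_emp]
    have h1 : (N : ℝ)⁻¹ * ∑ j, ‖x j‖ = mo 1 (emp x) := by rw [mo_emp]; simp
    rw [h1]
    have h2 := mo_one_le h
    have h3 := mo_nonneg q (emp x)
    have h4 : C * (mo q (emp x) * mo 1 (emp x)) ≤ C * (mo q (emp x) * 1) := by gcongr
    nlinarith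

lemma gen_pos (hd : 2 ≤ d) {B : Vd d → Measure (Vd d)} (hB : IsCollisionKernel B)
    {q : ℝ} (hq : 2 < q) (h : Good x) (c : ℝ) :
    kacGen B N (fun ν => max (Gq N q ν - c) 0) (emp x) ≤ 4 * povK q * mo q (emp x) := by
  have hp := h.pos
  have hK := povK_nonneg hq
  refine (kacGen_pos_le hd hB h (Gq N q) c
    (fun i j => povK q * (max ‖x i‖ ‖x j‖ ^ (q - 1) * min ‖x i‖ ‖x j‖)) ?_ ?_).trans ?_
  · intro i j; positivity
  · intro i j hij σ hσ
    rw [Gq_coll h (by linarith) hij hσ]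
    gcongr
    exact delt_le' hq _ _ _ hσ hij
  · refine (avg2_mono _ (fun i j => (2 * povK q) * (‖x i‖ ^ q * ‖x j‖ + ‖x i‖ * ‖x j‖ ^ q))
      ?_).trans ?_
    · intro i j
      have h1 := max_min_le (norm_nonneg (x i)) (norm_nonneg (x j)) hq
      have h2 := norm_sub_le (x i) (x j)
      calc _ ≤ (‖x i‖ + ‖x j‖) * (povK q * (max ‖x i‖ ‖x j‖ ^ (q - 1) * min ‖x i‖ ‖x j‖)) := by
            gcongr
        _ = povK q * ((‖x i‖ + ‖x j‖) * (max ‖x i‖ ‖x j‖ ^ (q - 1) * min ‖x i‖ ‖x j‖)) := by ring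
        _ ≤ povK q * (2 * (‖x i‖ ^ q * ‖x j‖ + ‖x i‖ * ‖x j‖ ^ q)) := by gcongr
        _ = _ := by ring
    · rw [avg2_smul, avg2_add, avg_prod, avg_prod, ← mo_emp]
      have h1 : (N : ℝ)⁻¹ * ∑ j, ‖x j‖ = mo 1 (emp x) := by rw [mo_emp]; simp
      rw [h1]
      have h2 := mo_one_le h
      have h3 := mo_nonneg q (emp x)
      have h4 : povK q * (mo q (emp x) * mo 1 (emp x)) ≤ povK q * (mo q (emp x) * 1) := by gcongr
      nlinarith

end KacModel

namespace KacModel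
variable {d : ℕ}
variable {N : ℕ} {x : Fin N → Vd d}

/-- weight -/
def wt (p : ℝ) (v : Vd d) : ℝ≥0∞ := 1 + (‖v‖₊ : ℝ≥0∞) ^ p

lemma wt_meas (p : ℝ) : Measurable (wt p : Vd d → ℝ≥0∞) := by
  unfold wt; fun_prop

/-- weighted total variation to a finitely supported measure -/
def Phi (p : ℝ) (S : Finset (Vd d)) (μ0 ν : Measure (Vd d)) : ℝ≥0∞ :=
  ∫⁻ v in (↑S : Set (Vd d))ᶜ, wt p v ∂ν +
    ∑ y ∈ S, wt p y * ((ν {y} - μ0 {y}) + (μ0 {y} - ν {y}))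

lemma Phi_meas (p : ℝ) (S : Finset (Vd d)) (μ0 : Measure (Vd d)) :
    Measurable (Phi p S μ0) := by
  unfold Phi
  apply Measurable.add
  · have : (fun ν : Measure (Vd d) => ∫⁻ v in (↑S : Set (Vd d))ᶜ, wt p v ∂ν) =
        fun ν => ∫⁻ v, ((↑S : Set (Vd d))ᶜ).indicator (wt p) v ∂ν := by
      ext ν; rw [lintegral_indicator S.measurableSet.compl]
    rw [this]
    exact Measure.measurable_lintegral ((wt_meas p).indicator S.measurableSet.compl)
  · apply Finset.measurable_fun_sum
    intro y _
    have h := Measure.measurable_coe (measurableSet_singleton y)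
    exact ((h.sub measurable_const).add (measurable_const.sub h)).const_mul _

lemma lint_split (S : Finset (Vd d)) (f : Vd d → ℝ≥0∞) (ρ : Measure (Vd d)) :
    ∫⁻ v in (↑S : Set (Vd d))ᶜ, f v ∂ρ + ∑ y ∈ S, f y * ρ {y} = ∫⁻ v, f v ∂ρ := by
  rw [← lintegral_finset, add_comm, lintegral_add_compl _ S.measurableSet]

lemma Phi_lip (p : ℝ) (S : Finset (Vd d)) (μ0 : Measure (Vd d)) {α ν ρ ρ' : Measure (Vd d)}
    (h : α + ρ = ν + ρ') :
    Phi p S μ0 α ≤ Phi p S μ0 ν + (∫⁻ v, wt p v ∂ρ' + ∫⁻ v, wt p v ∂ρ) := by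
  have h1 : ∫⁻ v in (↑S : Set (Vd d))ᶜ, wt p v ∂α ≤ ∫⁻ v in (↑S : Set (Vd d))ᶜ, wt p v ∂ν +
      ∫⁻ v in (↑S : Set (Vd d))ᶜ, wt p v ∂ρ' := by
    rw [← lintegral_add_measure, ← Measure.restrict_add, ← h, Measure.restrict_add,
      lintegral_add_measure]
    exact le_self_add
  have h2 : ∀ y, wt p y * ((α {y} - μ0 {y}) + (μ0 {y} - α {y})) ≤
      wt p y * ((ν {y} - μ0 {y}) + (μ0 {y} - ν {y})) + (wt p y * ρ' {y} + wt p y * ρ {y}) := by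
    intro y
    have hy : α {y} + ρ {y} = ν {y} + ρ' {y} := by
      rw [← Measure.add_apply, h, Measure.add_apply]
    rw [← mul_add, ← mul_add]
    apply mul_le_mul' le_rfl
    have a1 : α {y} - μ0 {y} ≤ (ν {y} - μ0 {y}) + ρ' {y} := by
      rw [tsub_le_iff_right]
      calc α {y} ≤ ν {y} + ρ' {y} := by rw [← hy]; exact le_self_add
        _ ≤ (ν {y} - μ0 {y} + μ0 {y}) + ρ' {y} := by gcongr; exact le_tsub_add
        _ = _ := by ring
    have a2 : μ0 {y} - α {y} ≤ (μ0 {y} - ν {y}) + ρ {y} := by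
      rw [tsub_le_iff_right]
      calc μ0 {y} ≤ μ0 {y} - ν {y} + ν {y} := le_tsub_add
        _ ≤ μ0 {y} - ν {y} + (α {y} + ρ {y}) := by rw [hy]; gcongr; exact le_self_add
        _ = _ := by ring
    calc _ ≤ ((ν {y} - μ0 {y}) + ρ' {y}) + ((μ0 {y} - ν {y}) + ρ {y}) := add_le_add a1 a2
      _ = _ := by ring
  have h3 := Finset.sum_le_sum (fun y (_ : y ∈ S) => h2 y)
  rw [Finset.sum_add_distrib, Finset.sum_add_distrib] at h3
  have h4 := lint_split S (wt p) ρ'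
  have h5 := lint_split S (wt p) ρ
  unfold Phi
  calc _ ≤ _ := add_le_add h1 h3
    _ ≤ (∫⁻ v in (↑S : Set (Vd d))ᶜ, wt p v ∂ν +
        ∑ y ∈ S, wt p y * ((ν {y} - μ0 {y}) + (μ0 {y} - ν {y}))) +
        ((∫⁻ v in (↑S : Set (Vd d))ᶜ, wt p v ∂ρ' + ∑ y ∈ S, wt p y * ρ' {y}) +
         (∫⁻ v in (↑S : Set (Vd d))ᶜ, wt p v ∂ρ + ∑ y ∈ S, wt p y * ρ {y})) := by
        have : ∀ a b c d e f : ℝ≥0∞, (a + b) + (c + (d + e)) ≤ (a + c) + ((b + d) + (f + e)) := by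
          intro a b c d e f
          calc (a + b) + (c + (d + e)) = (a + c) + ((b + d) + (0 + e)) := by ring
            _ ≤ _ := by gcongr; exact zero_le
        exact this _ _ _ _ _ _
    _ = _ := by rw [h4, h5]

lemma Phi_self (p : ℝ) (S : Finset (Vd d)) (μ0 : Measure (Vd d)) (hS : μ0 (↑S : Set (Vd d))ᶜ = 0) :
    Phi p S μ0 μ0 = 0 := by
  unfold Phi
  rw [Measure.restrict_eq_zero.2 hS]; simp

lemma Phi_le (p : ℝ) (S : Finset (Vd d)) (μ0 ν : Measure (Vd d))
    (hS : μ0 (↑S : Set (Vd d))ᶜ = 0) :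
    Phi p S μ0 ν ≤ ∫⁻ v, wt p v ∂ν + ∫⁻ v, wt p v ∂μ0 := by
  have := Phi_lip p S μ0 (α := ν) (ν := μ0) (ρ := μ0) (ρ' := ν) (by rw [add_comm])
  rwa [Phi_self p S μ0 hS, zero_add] at this

lemma atoms_sum (S : Finset (Vd d)) (μ0 : Measure (Vd d)) (hS : μ0 (↑S : Set (Vd d))ᶜ = 0) :
    μ0 = ∑ y ∈ S, μ0 {y} • Measure.dirac y := by
  refine Measure.ext_of_lintegral _ fun f hf => ?_
  rw [← lint_split S, Measure.restrict_eq_zero.2 hS, lintegral_finsetSum_measure]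
  simp [lintegral_smul_measure, mul_comm]

lemma tv_le_Phi (p : ℝ) (S : Finset (Vd d)) (μ0 ν : Measure (Vd d)) [IsFiniteMeasure μ0]
    [IsFiniteMeasure ν] (hS : μ0 (↑S : Set (Vd d))ᶜ = 0) :
    ∫⁻ v, wt p v ∂(tvMeasure ν μ0) ≤ Phi p S μ0 ν := by
  set τ : Measure (Vd d) := ν.restrict (↑S : Set (Vd d))ᶜ +
    ∑ y ∈ S, (ν {y} - μ0 {y}) • Measure.dirac y with hτ
  set τ' : Measure (Vd d) := ∑ y ∈ S, (μ0 {y} - ν {y}) • Measure.dirac y with hτ'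
  have hν : ν = ν.restrict (↑S : Set (Vd d))ᶜ + ∑ y ∈ S, ν {y} • Measure.dirac y := by
    refine Measure.ext_of_lintegral _ fun f hf => ?_
    rw [← lint_split S, lintegral_add_measure, lintegral_finsetSum_measure]
    simp [lintegral_smul_measure, mul_comm]
  have hμ := atoms_sum S μ0 hS
  have h1 : ν ≤ τ + μ0 := by
    refine Measure.le_iff.2 fun s hs => ?_
    conv_lhs => rw [hν]
    conv_rhs => rw [hμ]
    simp only [hτ, Measure.add_apply, Measure.finsetSum_apply, Measure.smul_apply, smul_eq_mul]
    rw [add_assoc, ← Finset.sum_add_distrib]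
    gcongr with y hy
    rw [← add_mul]
    gcongr
    exact le_tsub_add
  have h2 : μ0 ≤ τ' + ν := by
    refine Measure.le_iff.2 fun s hs => ?_
    conv_lhs => rw [hμ]
    conv_rhs => rw [hν]
    simp only [hτ', Measure.add_apply, Measure.finsetSum_apply, Measure.smul_apply, smul_eq_mul]
    rw [add_left_comm, ← Finset.sum_add_distrib]
    refine le_trans ?_ le_add_self
    gcongr with y hy
    rw [← add_mul]
    gcongr
    exact le_tsub_add
  have h3 : tvMeasure ν μ0 ≤ τ + τ' := by
    unfold tvMeasure
    exact add_le_add (Measure.sub_le_of_le_add h1) (Measure.sub_le_of_le_add h2)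
  refine (lintegral_mono' h3 le_rfl).trans ?_
  rw [hτ, hτ', lintegral_add_measure, lintegral_add_measure, lintegral_finsetSum_measure,
    lintegral_finsetSum_measure, add_assoc, ← Finset.sum_add_distrib]
  unfold Phi
  gcongr with y hy
  simp only [lintegral_smul_measure, lintegral_dirac, smul_eq_mul]
  apply le_of_eq; ring

/-- cutoff level for Phi -/
def HP (N : ℕ) (p : ℝ) : ℝ := 2 * (1 + (N : ℝ) ^ (p / 2))

lemma wt_emp (h : Good x) {p : ℝ} (hp : 0 ≤ p) :
    ∫⁻ v, wt p v ∂(emp x) = ENNReal.ofReal (1 + mo p (emp x)) := by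
  have := emp_prob (x := x) h.1
  unfold wt
  rw [lintegral_add_left measurable_const, ENNReal.ofReal_add zero_le_one (mo_nonneg _ _),
    ← momentL_emp p hp h.1]
  simp [momentL]

lemma Phi_le_HP {N : ℕ} {x x0 : Fin N → Vd d} (h : Good x) (h0 : Good x0) {p : ℝ} (hp : 0 ≤ p) (S : Finset (Vd d))
    (hS : emp x0 (↑S : Set (Vd d))ᶜ = 0) : Phi p S (emp x0) (emp x) ≤ ENNReal.ofReal (HP N p) := by
  refine (Phi_le p S _ _ hS).trans ?_
  have := mo_nonneg p (emp x)
  have := mo_nonneg p (emp x0)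
  rw [wt_emp h hp, wt_emp h0 hp, ← ENNReal.ofReal_add (by positivity) (by positivity)]
  apply ENNReal.ofReal_le_ofReal
  have := mo_le h hp
  have := mo_le h0 hp
  unfold HP; linarith

/-- bounded version of Phi -/
def GP (N : ℕ) (p : ℝ) (S : Finset (Vd d)) (μ0 : Measure (Vd d)) : Measure (Vd d) → ℝ :=
  clampF (HP N p) (Phi p S μ0)

/-- constant -/
def KP (p : ℝ) : ℝ := 12 + 8 * 2 ^ (p / 2)

lemma rpow_sum_le {a b p : ℝ} (ha : 0 ≤ a) (hb : 0 ≤ b) (hp : 0 ≤ p) :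
    (a ^ 2 + b ^ 2) ^ (p / 2) ≤ 2 ^ (p / 2) * (a ^ p + b ^ p) := by
  have key : ∀ a b : ℝ, 0 ≤ a → 0 ≤ b → a ≤ b →
      (a ^ 2 + b ^ 2) ^ (p / 2) ≤ 2 ^ (p / 2) * (a ^ p + b ^ p) := by
    intro a b ha hb hab
    calc (a ^ 2 + b ^ 2) ^ (p / 2) ≤ (2 * b ^ 2) ^ (p / 2) := by
          apply Real.rpow_le_rpow (by positivity) (by nlinarith) (by linarith)
      _ = 2 ^ (p / 2) * b ^ p := by
          rw [Real.mul_rpow (by norm_num) (by positivity), rpow_sq_half hb]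
      _ ≤ _ := by
          gcongr
          have : 0 ≤ a ^ p := by positivity
          linarith
  rcases le_total a b with h | h
  · exact key a b ha hb h
  · have := key b a hb ha h
    rw [add_comm (a ^ 2), add_comm (a ^ p)]; exact this

lemma cheb {a b p : ℝ} (ha : 0 ≤ a) (hb : 0 ≤ b) (hp : 0 ≤ p) :
    (a + b) * (a ^ p + b ^ p) ≤ 2 * (a ^ (p + 1) + b ^ (p + 1)) := by
  rw [Real.rpow_add_one' ha (by linarith), Real.rpow_add_one' hb (by linarith)]
  have : 0 ≤ (a - b) * (a ^ p - b ^ p) := by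
    rcases le_total a b with h | h
    · have := Real.rpow_le_rpow ha h hp
      nlinarith
    · have := Real.rpow_le_rpow hb h hp
      nlinarith
  nlinarith

lemma gen_Phi (hd : 2 ≤ d) {B : Vd d → Measure (Vd d)} (hB : IsCollisionKernel B)
    {p : ℝ} (hp : 2 ≤ p) (h : Good x) (S : Finset (Vd d)) (μ0 : Measure (Vd d)) (c : ℝ) :
    kacGen B N (fun ν => max (GP N p S μ0 ν - c) 0) (emp x) ≤ KP p * mo (p + 1) (emp x) := by
  have hn := h.pos
  have hp0 : 0 ≤ p := by linarith
  set K : ℝ := 2 ^ (p / 2) with hK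
  have hK0 : 0 ≤ K := by positivity
  refine (kacGen_pos_le hd hB h (GP N p S μ0) c
    (fun i j => 4 + (1 + 2 * K) * (‖x i‖ ^ p + ‖x j‖ ^ p)) ?_ ?_).trans ?_
  · intro i j; positivity
  · intro i j hij σ hσ
    apply clampF_sub_le (by positivity)
    refine (Phi_lip p S μ0 (coll_id h.1 hij σ)).trans ?_
    gcongr
    rw [lint_dirac2, lint_dirac2, ninv hn]
    unfold wt
    simp only [nn_rpow _ hp0]
    rw [← ENNReal.ofReal_one, ← ENNReal.ofReal_add (by positivity) (by positivity),
      ← ENNReal.ofReal_add (by positivity) (by positivity),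
      ← ENNReal.ofReal_add (by positivity) (by positivity),
      ← ENNReal.ofReal_mul (by positivity), ← ENNReal.ofReal_add (by positivity) (by positivity),
      ← ENNReal.ofReal_add (by positivity) (by positivity),
      ← ENNReal.ofReal_add (by positivity) (by positivity),
      ← ENNReal.ofReal_mul (by positivity), ← ENNReal.ofReal_add (by positivity) (by positivity),
      ← mul_add]
    apply ENNReal.ofReal_le_ofReal
    apply mul_le_mul_of_nonneg_left _ (by positivity)
    have h1 := sq_rpow_le (norm_nonneg _) (postV_norm_le (x i) (x j) σ hσ) hp0
    have h2 := sq_rpow_le (norm_nonneg _) (postVs_norm_le (x i) (x j) σ hσ) hp0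
    have h3 := rpow_sum_le (norm_nonneg (x i)) (norm_nonneg (x j)) hp0
    rw [← hK] at h3
    nlinarith
  · refine (avg2_mono _ (fun i j => 4 * (‖x i‖ + ‖x j‖) + (2 * (1 + 2 * K)) *
      (‖x i‖ ^ (p + 1) + ‖x j‖ ^ (p + 1))) ?_).trans ?_
    · intro i j
      have h1 := cheb (norm_nonneg (x i)) (norm_nonneg (x j)) hp0
      calc _ ≤ (‖x i‖ + ‖x j‖) * (4 + (1 + 2 * K) * (‖x i‖ ^ p + ‖x j‖ ^ p)) := by
            gcongr; exact norm_sub_le _ _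
        _ = 4 * (‖x i‖ + ‖x j‖) + (1 + 2 * K) * ((‖x i‖ + ‖x j‖) * (‖x i‖ ^ p + ‖x j‖ ^ p)) := by
            ring
        _ ≤ 4 * (‖x i‖ + ‖x j‖) + (1 + 2 * K) * (2 * (‖x i‖ ^ (p + 1) + ‖x j‖ ^ (p + 1))) := by
            gcongr
        _ = _ := by ring
    · rw [avg2_add, avg2_smul, avg2_smul,
        avg_pair hn (fun i => ‖x i‖ ^ (p + 1)) (fun i => ‖x i‖ ^ (p + 1)),
        avg_pair hn (fun i => ‖x i‖) (fun i => ‖x i‖), ← mo_emp]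
      have h1 : (N : ℝ)⁻¹ * ∑ j, ‖x j‖ = mo 1 (emp x) := by rw [mo_emp]; simp
      rw [h1]
      have h2 := mo_one_le h
      have h3 := one_le_mo h (r := p + 1) (by linarith)
      unfold KP
      rw [← hK]
      nlinarith

end KacModel

namespace KacModel
variable {d : ℕ}
variable {N : ℕ} {x : Fin N → Vd d}

lemma inv_sq_lip {a b : ℝ} (ha : 0 ≤ a) (hb : 0 ≤ b) :
    |1 / (1 + a ^ 2) - 1 / (1 + b ^ 2)| ≤ |a - b| := by
  have h1 : (0:ℝ) < 1 + a ^ 2 := by positivity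
  have h2 : (0:ℝ) < 1 + b ^ 2 := by positivity
  have e : 1 / (1 + a ^ 2) - 1 / (1 + b ^ 2) = (b - a) * ((a + b) / ((1 + a ^ 2) * (1 + b ^ 2))) := by
    field_simp; ring
  rw [e, abs_mul, abs_sub_comm b a, abs_of_nonneg (a := (a + b) / _) (by positivity)]
  have : (a + b) / ((1 + a ^ 2) * (1 + b ^ 2)) ≤ 1 := by
    rw [div_le_one (by positivity)]
    nlinarith [sq_nonneg (a - 1), sq_nonneg (b - 1), sq_nonneg (a * b), sq_nonneg a, sq_nonneg b]
  calc _ ≤ |a - b| * 1 := by gcongr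
    _ = _ := mul_one _

lemma lip_testF {f : Vd d → ℝ} {L : ℝ≥0} {M : ℝ} (hf : LipschitzWith L f) (hM : ∀ v, |f v| ≤ M) :
    ∃ ε : ℝ, 0 < ε ∧ (fun v => ε * f v) ∈ testF d := by
  have hM0 : 0 ≤ M := (abs_nonneg _).trans (hM 0)
  have hL0 : (0:ℝ) ≤ L := L.2
  have hpos : 0 < (L : ℝ) + M + 1 := by positivity
  refine ⟨((L : ℝ) + M + 1)⁻¹, by positivity, ?_, ?_⟩
  · intro v
    have h1 : (1:ℝ) ≤ 1 + ‖v‖ ^ 2 := by nlinarith [sq_nonneg ‖v‖]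
    rw [abs_div, abs_mul, abs_of_pos (inv_pos.mpr hpos), abs_of_pos (by linarith : 0 < 1 + ‖v‖ ^ 2)]
    rw [div_le_one (by linarith)]
    refine le_trans ?_ h1
    rw [inv_mul_le_one₀ hpos]
    linarith [hM v]
  · intro v w
    have h3 := inv_sq_lip (norm_nonneg v) (norm_nonneg w)
    have h4 := abs_norm_sub_norm_le v w
    have h5 : |f v - f w| ≤ L * ‖v - w‖ := by
      have := hf.dist_le_mul v w
      rwa [Real.dist_eq, dist_eq_norm] at this
    have h6 : |1 / (1 + ‖v‖ ^ 2)| ≤ 1 := by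
      rw [abs_of_nonneg (by positivity), div_le_one (by positivity)]
      nlinarith [sq_nonneg ‖v‖]
    have e : (((L : ℝ) + M + 1)⁻¹ * f v) / (1 + ‖v‖ ^ 2) - (((L : ℝ) + M + 1)⁻¹ * f w) / (1 + ‖w‖ ^ 2)
        = ((L : ℝ) + M + 1)⁻¹ * ((f v - f w) * (1 / (1 + ‖v‖ ^ 2)) +
          f w * (1 / (1 + ‖v‖ ^ 2) - 1 / (1 + ‖w‖ ^ 2))) := by ring
    simp only [e]
    rw [abs_mul, abs_of_pos (inv_pos.mpr hpos), inv_mul_le_iff₀ hpos]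
    refine (abs_add_le _ _).trans ?_
    rw [abs_mul, abs_mul]
    have a1 : |f v - f w| * |1 / (1 + ‖v‖ ^ 2)| ≤ (L * ‖v - w‖) * 1 := by gcongr
    have a2 : |f w| * |1 / (1 + ‖v‖ ^ 2) - 1 / (1 + ‖w‖ ^ 2)| ≤ M * ‖v - w‖ := by
      gcongr
      · exact hM w
      · exact h3.trans h4
    have := norm_nonneg (v - w)
    nlinarith

lemma meas_of_lip {α : Type*} {mα : MeasurableSpace α} (κ : α → Measure (Vd d))
    (hprob : ∀ a, IsProbabilityMeasure (κ a))
    (h : ∀ (f : Vd d → ℝ) (L : ℝ≥0) (M : ℝ), LipschitzWith L f → (∀ v, |f v| ≤ M) →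
      Measurable fun a => ∫ v, f v ∂(κ a)) : Measurable κ := by
  apply Measurable.measure_of_isPiSystem_of_isProbabilityMeasure
    (S := {s | IsClosed s}) (by rw [← borel_eq_generateFrom_isClosed]; exact BorelSpace.measurable_eq)
    isPiSystem_isClosed
  intro s hs
  have hs : IsClosed s := hs
  have hpos : ∀ n : ℕ, (0:ℝ) < 1 / (n + 1) := fun n => by positivity
  refine measurable_of_tendsto_metrizable
    (f := fun n a => ∫⁻ v, (thickenedIndicator (hpos n) s v : ℝ≥0∞) ∂(κ a)) ?_ ?_
  · intro n
    have e : ∀ a, ∫⁻ v, (thickenedIndicator (hpos n) s v : ℝ≥0∞) ∂(κ a) =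
        ENNReal.ofReal (∫ v, (thickenedIndicator (hpos n) s v : ℝ) ∂(κ a)) := by
      intro a
      rw [ofReal_integral_eq_lintegral_ofReal]
      · simp
      · refine Integrable.of_bound (C := 1) ?_ ?_
        · exact (NNReal.continuous_coe.comp (thickenedIndicator (hpos n) s).continuous).aestronglyMeasurable
        · refine ae_of_all _ fun v => ?_
          simpa using thickenedIndicator_le_one (hpos n) s v
      · exact ae_of_all _ fun v => NNReal.coe_nonneg _
    simp only [e]
    apply Measurable.ennreal_ofReal
    apply h _ (((1:ℝ) / (n + 1)).toNNReal⁻¹) 1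
    · have := lipschitzWith_thickenedIndicator (hpos n) s
      intro v w
      have h2 := this v w
      rw [edist_nndist] at h2 ⊢
      exact h2
    · intro v
      simpa using thickenedIndicator_le_one (hpos n) s v
  · rw [tendsto_pi_nhds]
    intro a
    exact tendsto_lintegral_thickenedIndicator_of_isClosed (κ a) hs hpos
      tendsto_one_div_add_atTop_nhds_zero_nat

section process
variable {Ω : Type*} [m : MeasurableSpace Ω] {B : Vd d → Measure (Vd d)} {P : Measure Ω}
  {𝓕 : Filtration ℝ m} {μp : ℝ → Ω → Measure (Vd d)}

lemma mem_prob {ν : Measure (Vd d)} (h : ν ∈ empiricalSphere d N) : IsProbabilityMeasure ν := h.1.1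

lemma rc_lip (hK : IsKacProcess B N P 𝓕 μp) {f : Vd d → ℝ} {L : ℝ≥0} {M : ℝ}
    (hf : LipschitzWith L f) (hM : ∀ v, |f v| ≤ M) (ω : Ω) (t : ℝ) :
    ContinuousWithinAt (fun s => ∫ v, f v ∂(μp s ω)) (Set.Ici t) t := by
  obtain ⟨ε, hε, h⟩ := lip_testF hf hM
  have h1 := hK.rightCont ω _ h t
  simp only [integral_const_mul] at h1
  have h2 := h1.const_mul ε⁻¹
  simpa [← mul_assoc, inv_mul_cancel₀ hε.ne'] using h2

lemma ad_lip (hK : IsKacProcess B N P 𝓕 μp) {f : Vd d → ℝ} {L : ℝ≥0} {M : ℝ}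
    (hf : LipschitzWith L f) (hM : ∀ v, |f v| ≤ M) (t : ℝ) :
    Measurable[𝓕 t] (fun ω => ∫ v, f v ∂(μp t ω)) := by
  obtain ⟨ε, hε, h⟩ := lip_testF hf hM
  have h1 := hK.adapted _ h t
  simp only [integral_const_mul] at h1
  have h2 := Measurable.const_mul (m := 𝓕 t) h1 ε⁻¹
  simpa [← mul_assoc, inv_mul_cancel₀ hε.ne'] using h2

lemma rc_bcf (hK : IsKacProcess B N P 𝓕 μp) (f : BoundedContinuousFunction (Vd d) ℝ)
    (ω : Ω) (t : ℝ) :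
    ContinuousWithinAt (fun s => ∫ v, f v ∂(μp s ω)) (Set.Ici t) t := by
  let Q : ℝ → ProbabilityMeasure (Vd d) := fun s => ⟨μp s ω, mem_prob (hK.mem s ω)⟩
  have h : Tendsto Q (nhdsWithin t (Set.Ici t)) (nhds (Q t)) := by
    rw [tendsto_iff_forall_lipschitz_integral_tendsto]
    rintro f ⟨C, hC⟩ ⟨L, hL⟩
    refine rc_lip hK (M := |f 0| + C) hL ?_ ω t
    intro v
    have := hC v 0
    rw [Real.dist_eq] at this
    have := abs_sub_abs_le_abs_sub (f v) (f 0)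
    linarith
  rw [ProbabilityMeasure.tendsto_iff_forall_integral_tendsto] at h
  exact h f

lemma meas_ad (hK : IsKacProcess B N P 𝓕 μp) (t : ℝ) : Measurable[𝓕 t] (μp t) :=
  meas_of_lip (mα := 𝓕 t) _ (fun ω => mem_prob (hK.mem t ω)) fun f L M hf hM => ad_lip hK hf hM t

lemma meas_t (hK : IsKacProcess B N P 𝓕 μp) (t : ℝ) : Measurable (μp t) :=
  (meas_ad hK t).mono (𝓕.le t) le_rfl

lemma floor_tendsto (s : ℝ) : Tendsto (fun n : ℕ => ((⌊((n:ℝ) + 1) * s⌋ : ℝ) + 1) / ((n:ℝ) + 1))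
    atTop (nhdsWithin s (Set.Ici s)) := by
  rw [tendsto_nhdsWithin_iff]
  have hle : ∀ n : ℕ, s ≤ ((⌊((n:ℝ) + 1) * s⌋ : ℝ) + 1) / ((n:ℝ) + 1) := by
    intro n
    rw [le_div_iff₀ (by positivity), mul_comm]
    exact (Int.lt_floor_add_one _).le
  refine ⟨?_, Eventually.of_forall hle⟩
  refine tendsto_of_tendsto_of_tendsto_of_le_of_le (g := fun _ => s)
    (h := fun n : ℕ => s + 1 / ((n:ℝ) + 1)) tendsto_const_nhds ?_ hle ?_
  · have := tendsto_one_div_add_atTop_nhds_zero_nat (𝕜 := ℝ)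
    simpa using this.const_add s
  · intro n
    have hn : (0:ℝ) < (n:ℝ) + 1 := by positivity
    simp only
    rw [div_le_iff₀ hn, add_mul s, one_div, inv_mul_cancel₀ hn.ne']
    have := Int.floor_le (((n:ℝ) + 1) * s)
    linarith

lemma meas_joint (hK : IsKacProcess B N P 𝓕 μp) :
    Measurable (fun z : ℝ × Ω => μp z.1 z.2) := by
  refine meas_of_lip _ (fun z => mem_prob (hK.mem _ _)) fun f L M hf hM => ?_
  refine measurable_of_tendsto_metrizable
    (f := fun (n : ℕ) (z : ℝ × Ω) =>
      ∫ v, f v ∂(μp (((⌊((n:ℝ) + 1) * z.1⌋ : ℝ) + 1) / ((n:ℝ) + 1)) z.2)) ?_ ?_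
  · intro n
    have h1 : Measurable (fun y : ℤ × Ω => ∫ v, f v ∂(μp (((y.1 : ℝ) + 1) / ((n:ℝ) + 1)) y.2)) := by
      apply measurable_from_prod_countable_right
      intro k
      exact (ad_lip hK hf hM (((k : ℝ) + 1) / ((n:ℝ) + 1))).mono (𝓕.le _) le_rfl
    have h2 : Measurable (fun z : ℝ × Ω => ((⌊((n:ℝ) + 1) * z.1⌋, z.2) : ℤ × Ω)) := by
      fun_prop
    exact h1.comp h2
  · rw [tendsto_pi_nhds]
    intro z
    exact (rc_lip hK hf hM z.2 z.1).tendsto.comp (floor_tendsto z.1)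

end process

/-- the normalised collision kernel -/
def kB {B : Vd d → Measure (Vd d)} (hB : IsCollisionKernel B) : Kernel (Vd d) (Vd d) where
  toFun u := B (dirU u)
  measurable' := by
    have : Measurable (dirU : Vd d → Vd d) := by unfold dirU; fun_prop
    have h2 : Measurable B := Measure.measurable_of_measurable_coe _ hB.measurable
    exact h2.comp this

lemma kB_fin (hd : 2 ≤ d) {B : Vd d → Measure (Vd d)} (hB : IsCollisionKernel B) :
    IsFiniteKernel (kB hB) := by
  refine ⟨⟨1, by simp, fun u => ?_⟩⟩
  change B (dirU u) Set.univ ≤ 1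
  rw [B_mass hd hB]
  by_cases h : u = 0
  · subst h; simp [dirU]
  · rw [dirU_norm h]; simp

lemma B_int (hd : 2 ≤ d) {B : Vd d → Measure (Vd d)} (hB : IsCollisionKernel B) (u : Vd d)
    (f : Vd d → ℝ) : ∫ σ, f σ ∂(B u) = ‖u‖ * ∫ σ, f σ ∂(kB hB u) := by
  by_cases h : u = 0
  · subst h; simp [B_zero hd hB]
  · rw [B_eq hB h, integral_smul_measure, ENNReal.toReal_ofReal (norm_nonneg _)]; rfl

/-- admissibility of a collision -/
def Adm (N : ℕ) (ν : Measure (Vd d)) (v w : Vd d) : Prop :=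
  v ≠ w ∧ (N : ℝ≥0∞)⁻¹ ≤ ν {v} ∧ (N : ℝ≥0∞)⁻¹ ≤ ν {w}

lemma adm_pair_le {ν : Measure (Vd d)} {v w : Vd d} (h : Adm N ν v w) :
    (N : ℝ≥0∞)⁻¹ • (Measure.dirac v + Measure.dirac w) ≤ ν := by
  obtain ⟨hvw, h1, h2⟩ := h
  refine Measure.le_iff.2 fun s hs => ?_
  simp only [Measure.smul_apply, Measure.add_apply, Measure.dirac_apply' _ hs, smul_eq_mul]
  have hsub : ∀ y ∈ s, (N : ℝ≥0∞)⁻¹ ≤ ν {y} → (N : ℝ≥0∞)⁻¹ ≤ ν s := fun y hy h =>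
    h.trans (measure_mono (Set.singleton_subset_iff.mpr hy))
  by_cases hv : v ∈ s <;> by_cases hw : w ∈ s
  · have : ν {v} + ν {w} ≤ ν s := by
      rw [← measure_union (by simpa using hvw) (measurableSet_singleton w)]
      exact measure_mono (by intro y hy; rcases hy with rfl | rfl <;> assumption)
    simp only [hv, hw, Set.indicator_of_mem, Pi.one_apply, mul_add, mul_one]
    exact (add_le_add h1 h2).trans this
  · simpa [hv, hw] using hsub v hv h1
  · simpa [hv, hw] using hsub w hw h2
  · simp [hv, hw]

lemma adm_emp (hN : Good x) {i j : Fin N} (hij : x i ≠ x j) : Adm N (emp x) (x i) (x j) := by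
  have key : ∀ i, (N : ℝ≥0∞)⁻¹ ≤ emp x {x i} := by
    intro i
    unfold emp
    simp only [Measure.smul_apply, Measure.finsetSum_apply, smul_eq_mul]
    have : (1 : ℝ≥0∞) ≤ ∑ j, (Measure.dirac (x j)) {x i} := by
      refine le_trans ?_ (Finset.single_le_sum (f := fun j => (Measure.dirac (x j)) {x i})
        (fun _ _ => zero_le) (Finset.mem_univ i))
      simp
    calc (N : ℝ≥0∞)⁻¹ = (N : ℝ≥0∞)⁻¹ * 1 := (mul_one _).symm
      _ ≤ _ := by gcongr
  exact ⟨hij, key i, key j⟩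

lemma post_meas : Measurable (fun z : (Vd d × Vd d) × Vd d => postV z.1.1 z.1.2 z.2) ∧
    Measurable (fun z : (Vd d × Vd d) × Vd d => postVs z.1.1 z.1.2 z.2) := by
  unfold postV postVs
  constructor <;> fun_prop

open Classical in
/-- truncated update -/
def Uf (N : ℕ) (ν : Measure (Vd d)) (v w σ : Vd d) : Measure (Vd d) :=
  if Adm N ν v w then collUpdate N ν v w σ else 0

lemma Uf_meas {α : Type*} [MeasurableSpace α] (hN : N ≠ 0) (κ : α → Measure (Vd d)) (hκ : Measurable κ)
    (hp : ∀ a, IsProbabilityMeasure (κ a)) :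
    Measurable (fun z : ((α × Vd d) × Vd d) × Vd d => Uf N (κ z.1.1.1) z.1.1.2 z.1.2 z.2) := by
  let k : Kernel α (Vd d) := ⟨κ, hκ⟩
  have hk : IsMarkovKernel k := ⟨hp⟩
  have hsing : Measurable (fun z : α × Vd d => κ z.1 {z.2}) := by
    let k2 : Kernel (α × Vd d) (Vd d) := k.comap Prod.fst measurable_fst
    have hk2 : IsMarkovKernel k2 := by infer_instance
    have ht : MeasurableSet {y : (α × Vd d) × Vd d | y.2 = y.1.2} :=
      measurableSet_eq_fun (by fun_prop) (by fun_prop)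
    have := Kernel.measurable_kernel_prodMk_left (κ := k2) ht
    exact this
  have hA : MeasurableSet {z : ((α × Vd d) × Vd d) × Vd d | Adm N (κ z.1.1.1) z.1.1.2 z.1.2} := by
    have a1 : MeasurableSet {z : ((α × Vd d) × Vd d) × Vd d | z.1.1.2 ≠ z.1.2} :=
      (measurableSet_eq_fun (by fun_prop) (by fun_prop)).compl
    have a2 : MeasurableSet {z : ((α × Vd d) × Vd d) × Vd d |
        (N : ℝ≥0∞)⁻¹ ≤ κ z.1.1.1 {z.1.1.2}} := by
      apply measurableSet_le measurable_const
      exact hsing.comp (f := fun z : ((α × Vd d) × Vd d) × Vd d => (z.1.1.1, z.1.1.2)) (by fun_prop)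
    have a3 : MeasurableSet {z : ((α × Vd d) × Vd d) × Vd d |
        (N : ℝ≥0∞)⁻¹ ≤ κ z.1.1.1 {z.1.2}} := by
      apply measurableSet_le measurable_const
      exact hsing.comp (f := fun z : ((α × Vd d) × Vd d) × Vd d => (z.1.1.1, z.1.2)) (by fun_prop)
    exact a1.inter (a2.inter a3)
  apply Measure.measurable_of_measurable_coe
  intro s hs
  have hfin : ∀ v w : Vd d, IsFiniteMeasure ((N : ℝ≥0∞)⁻¹ • (Measure.dirac v + Measure.dirac w)) := by
    intro v w
    constructor
    have : (N : ℝ≥0∞)⁻¹ < ⊤ := by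
      rw [ENNReal.inv_lt_top]; positivity
    simp only [Measure.smul_apply, smul_eq_mul]
    exact ENNReal.mul_lt_top this (by simp)
  classical
  have e : (fun z : ((α × Vd d) × Vd d) × Vd d => Uf N (κ z.1.1.1) z.1.1.2 z.1.2 z.2 s) =
      fun z => if Adm N (κ z.1.1.1) z.1.1.2 z.1.2 then
        (κ z.1.1.1 s + (N : ℝ≥0∞)⁻¹ * (s.indicator 1 (postV z.1.1.2 z.1.2 z.2) +
          s.indicator 1 (postVs z.1.1.2 z.1.2 z.2)))
        - (N : ℝ≥0∞)⁻¹ * (s.indicator 1 z.1.1.2 + s.indicator 1 z.1.2) else 0 := by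
    ext z
    unfold Uf
    by_cases h : Adm N (κ z.1.1.1) z.1.1.2 z.1.2
    · simp only [h, if_true]
      unfold collUpdate
      have := hfin z.1.1.2 z.1.2
      rw [Measure.sub_apply hs ((adm_pair_le h).trans (Measure.le_add_right le_rfl))]
      simp only [Measure.smul_apply, Measure.add_apply, Measure.dirac_apply' _ hs, smul_eq_mul]
    · simp [h]
  rw [e]
  apply Measurable.ite hA _ measurable_const
  have hi : Measurable (s.indicator (1 : Vd d → ℝ≥0∞)) := measurable_one.indicator hs
  have hks : Measurable (fun a => κ a s) := (Measure.measurable_coe hs).comp hκ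
  have hr : Measurable (fun z : ((α × Vd d) × Vd d) × Vd d => ((z.1.1.2, z.1.2), z.2)) := by fun_prop
  have h1 := hi.comp (post_meas.1.comp hr)
  have h2 := hi.comp (post_meas.2.comp hr)
  have h3 := hks.comp (f := fun z : ((α × Vd d) × Vd d) × Vd d => z.1.1.1) (by fun_prop)
  have h4 := hi.comp (f := fun z : ((α × Vd d) × Vd d) × Vd d => z.1.1.2) (by fun_prop)
  have h5 := hi.comp (f := fun z : ((α × Vd d) × Vd d) × Vd d => z.1.2) (by fun_prop)
  exact (h3.add ((h1.add h2).const_mul _)).sub ((h4.add h5).const_mul _)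

lemma kacGen_meas (hd : 2 ≤ d) {B : Vd d → Measure (Vd d)} (hB : IsCollisionKernel B)
    {α : Type*} [MeasurableSpace α] (κ : α → Measure (Vd d)) (hκ : Measurable κ)
    (hmem : ∀ a, κ a ∈ empiricalSphere d N) {G : Measure (Vd d) → ℝ} (hG : Measurable G) :
    Measurable (fun a => kacGen B N G (κ a)) := by
  by_cases hN : N = 0
  · subst hN; simp [kacGen]
  have hp : ∀ a, IsProbabilityMeasure (κ a) := fun a => mem_prob (hmem a)
  let k : Kernel α (Vd d) := ⟨κ, hκ⟩
  have hk : IsMarkovKernel k := ⟨hp⟩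
  have hkf := kB_fin hd hB
  let k1 : Kernel (α × Vd d) (Vd d) := k.comap Prod.fst measurable_fst
  have hk1 : IsMarkovKernel k1 := by infer_instance
  let k2 : Kernel ((α × Vd d) × Vd d) (Vd d) :=
    (kB hB).comap (fun z => z.1.2 - z.2) (by fun_prop)
  have hk2 : IsFiniteKernel k2 := by infer_instance
  have hU := Uf_meas hN κ hκ hp
  have f1 : StronglyMeasurable (fun z : ((α × Vd d) × Vd d) × Vd d =>
      G (Uf N (κ z.1.1.1) z.1.1.2 z.1.2 z.2) - G (κ z.1.1.1)) :=
    ((hG.comp hU).sub (hG.comp (hκ.comp (by fun_prop)))).stronglyMeasurable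
  have f2 : StronglyMeasurable (fun z : (α × Vd d) × Vd d => ‖z.1.2 - z.2‖ * ∫ σ,
      (G (Uf N (κ z.1.1) z.1.2 z.2 σ) - G (κ z.1.1)) ∂(k2 z)) := by
    refine StronglyMeasurable.mul ?_ (StronglyMeasurable.integral_kernel_prod_right' f1)
    exact (by fun_prop : Measurable fun z : (α × Vd d) × Vd d => ‖z.1.2 - z.2‖).stronglyMeasurable
  have f3 := StronglyMeasurable.integral_kernel_prod_right' (κ := k1) f2
  have f4 := StronglyMeasurable.integral_kernel_prod_right' (κ := k) f3
  have f5 := f4.measurable.const_mul (N : ℝ)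
  convert f5 using 2 with a
  obtain ⟨x, hx, hgood⟩ := mem_emp (hmem a)
  change kacGen B N G (κ a) = N * ∫ v, ∫ w, ‖v - w‖ * ∫ σ,
      (G (Uf N (κ a) v w σ) - G (κ a)) ∂(kB hB (v - w)) ∂(κ a) ∂(κ a)
  rw [hx, kacGen]
  congr 1
  rw [integral_emp, integral_emp]
  congr 1
  apply Finset.sum_congr rfl
  intro i _
  rw [integral_emp, integral_emp]
  congr 1
  apply Finset.sum_congr rfl
  intro j _
  rw [B_int hd hB]
  by_cases hij : x i = x j
  · rw [hij]; simp
  · congr 2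
    ext σ
    rw [Uf, if_pos (adm_emp hgood hij)]

end KacModel

namespace KacModel
variable {d : ℕ}
variable {N : ℕ} {x : Fin N → Vd d}

section process
variable {Ω : Type*} [m : MeasurableSpace Ω] {B : Vd d → Measure (Vd d)} {P : Measure Ω}
  {𝓕 : Filtration ℝ m} {μp : ℝ → Ω → Measure (Vd d)}

lemma proc_int [IsProbabilityMeasure P] (hK : IsKacProcess B N P 𝓕 μp) {G : Measure (Vd d) → ℝ}
    (hG : Measurable G) {M : ℝ} (hM : ∀ ν, |G ν| ≤ M) (t : ℝ) :
    Integrable (fun ω => G (μp t ω)) P :=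
  Integrable.of_bound (hG.comp (meas_t hK t)).aestronglyMeasurable M
    (ae_of_all _ fun ω => by simpa using hM _)

lemma time_int (hK : IsKacProcess B N P 𝓕 μp) {G : Measure (Vd d) → ℝ}
    (hG : Measurable G) {M : ℝ} (hM : ∀ ν, |G ν| ≤ M) (ω : Ω) (s t : ℝ) :
    IntegrableOn (fun r => G (μp r ω)) (Set.Ioc s t) := by
  refine Integrable.of_bound (C := M) ?_ (ae_of_all _ fun ω => by simpa using hM _)
  exact ((hG.comp (meas_joint hK)).comp measurable_prodMk_right).aestronglyMeasurable

lemma joint_int [IsProbabilityMeasure P] (hK : IsKacProcess B N P 𝓕 μp) {G : Measure (Vd d) → ℝ}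
    (hG : Measurable G) {M : ℝ} (hM : ∀ ν, |G ν| ≤ M) (s t : ℝ) (A : Set Ω) :
    Integrable (fun z : ℝ × Ω => G (μp z.1 z.2))
      ((volume.restrict (Set.Ioc s t)).prod (P.restrict A)) := by
  refine Integrable.of_bound (C := M) ?_ (ae_of_all _ fun ω => by simpa using hM _)
  exact (hG.comp (meas_joint hK)).aestronglyMeasurable

lemma gen_time_int (hd : 2 ≤ d) (hB : IsCollisionKernel B) (hK : IsKacProcess B N P 𝓕 μp)
    {G : Measure (Vd d) → ℝ}
    (hG : Measurable G) {M : ℝ} (hM : ∀ ν, |G ν| ≤ M) (ω : Ω) (s t : ℝ) :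
    IntegrableOn (fun r => kacGen B N G (μp r ω)) (Set.Ioc s t) := by
  refine Integrable.of_bound (C := N * (4 * M * (N : ℝ) ^ (1 / 2 : ℝ))) ?_ (ae_of_all _ fun r => ?_)
  · have := kacGen_meas hd hB (fun z : ℝ × Ω => μp z.1 z.2) (meas_joint hK)
      (fun z => hK.mem _ _) hG
    exact (this.comp measurable_prodMk_right).aestronglyMeasurable
  · obtain ⟨x, hx, hg⟩ := mem_emp (hK.mem r ω)
    rw [hx, Real.norm_eq_abs]
    exact kacGen_abs_le hd hB hg G hM

lemma dyn (hd : 2 ≤ d) (hB : IsCollisionKernel B) [IsProbabilityMeasure P]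
    (hK : IsKacProcess B N P 𝓕 μp) {G Γ : Measure (Vd d) → ℝ}
    (hG : Measurable G) {M : ℝ} (hM : ∀ ν, |G ν| ≤ M)
    (hΓ : Measurable Γ) {M' : ℝ} (hM' : ∀ ν, |Γ ν| ≤ M')
    (hle : ∀ x : Fin N → Vd d, Good x → kacGen B N G (emp x) ≤ Γ (emp x))
    {s t : ℝ} (hs : 0 ≤ s) (hst : s ≤ t) {A : Set Ω} (hA : MeasurableSet[𝓕 s] A) :
    ∫ ω in A, G (μp t ω) ∂P - ∫ ω in A, G (μp s ω) ∂P ≤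
      ∫ ω in A, (∫ r in Set.Ioc s t, Γ (μp r ω)) ∂P := by
  have hmart := hK.martingale G hG ⟨M, hM⟩
  have h1 := hmart.setIntegral_eq hst hA
  have hGi := fun t => proc_int hK hG hM t
  have hIi : ∀ t, Integrable (fun ω => ∫ s in Set.Ioc (0:ℝ) t, kacGen B N G (μp s ω)) P := by
    intro t
    have := (hGi t).sub (hmart.integrable t)
    refine this.congr (ae_of_all _ fun ω => ?_)
    simp
  rw [integral_sub (hGi s).integrableOn (hIi s).integrableOn,
    integral_sub (hGi t).integrableOn (hIi t).integrableOn] at h1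
  have h2 : ∫ ω in A, G (μp t ω) ∂P - ∫ ω in A, G (μp s ω) ∂P =
      ∫ ω in A, ((∫ s in Set.Ioc (0:ℝ) t, kacGen B N G (μp s ω)) -
        ∫ r in Set.Ioc (0:ℝ) s, kacGen B N G (μp r ω)) ∂P := by
    rw [integral_sub (hIi t).integrableOn (hIi s).integrableOn]; linarith
  rw [h2]
  apply integral_mono
  · exact ((hIi t).sub (hIi s)).integrableOn
  · exact (joint_int hK hΓ hM' s t A).integral_prod_right
  · intro ω
    simp only
    have e : Set.Ioc 0 t = Set.Ioc 0 s ∪ Set.Ioc s t := (Set.Ioc_union_Ioc_eq_Ioc hs hst).symm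
    rw [e, setIntegral_union (Set.Ioc_disjoint_Ioc_of_le le_rfl) measurableSet_Ioc
      (gen_time_int hd hB hK hG hM ω _ _) (gen_time_int hd hB hK hG hM ω _ _), add_sub_cancel_left]
    apply integral_mono (gen_time_int hd hB hK hG hM ω _ _) (time_int hK hΓ hM' ω _ _)
    intro r
    obtain ⟨x, hx, hg⟩ := mem_emp (hK.mem r ω)
    simp only [hx]
    exact hle x hg

lemma fub [IsProbabilityMeasure P] (hK : IsKacProcess B N P 𝓕 μp) {Γ : Measure (Vd d) → ℝ}
    (hΓ : Measurable Γ) {M' : ℝ} (hM' : ∀ ν, |Γ ν| ≤ M') (s t : ℝ) :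
    ∫ ω, (∫ r in Set.Ioc s t, Γ (μp r ω)) ∂P = ∫ r in Set.Ioc s t, (∫ ω, Γ (μp r ω) ∂P) := by
  have := joint_int hK hΓ hM' s t Set.univ
  rw [Measure.restrict_univ] at this
  exact (integral_integral_swap (f := fun r ω => Γ (μp r ω)) this).symm

lemma dynE (hd : 2 ≤ d) (hB : IsCollisionKernel B) [IsProbabilityMeasure P]
    (hK : IsKacProcess B N P 𝓕 μp) {G Γ : Measure (Vd d) → ℝ}
    (hG : Measurable G) {M : ℝ} (hM : ∀ ν, |G ν| ≤ M)
    (hΓ : Measurable Γ) {M' : ℝ} (hM' : ∀ ν, |Γ ν| ≤ M')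
    (hle : ∀ x : Fin N → Vd d, Good x → kacGen B N G (emp x) ≤ Γ (emp x))
    {s t : ℝ} (hs : 0 ≤ s) (hst : s ≤ t) :
    ∫ ω, G (μp t ω) ∂P - ∫ ω, G (μp s ω) ∂P ≤
      ∫ r in Set.Ioc s t, (∫ ω, Γ (μp r ω) ∂P) := by
  have := dyn hd hB hK hG hM hΓ hM' hle hs hst (A := Set.univ) MeasurableSet.univ
  simp only [Measure.restrict_univ] at this
  rwa [fub hK hΓ hM'] at this

lemma lip_exp (hd : 2 ≤ d) (hB : IsCollisionKernel B) [IsProbabilityMeasure P]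
    (hK : IsKacProcess B N P 𝓕 μp) {G : Measure (Vd d) → ℝ}
    (hG : Measurable G) {M : ℝ} (hM : ∀ ν, |G ν| ≤ M) :
    ContinuousOn (fun t => ∫ ω, G (μp t ω) ∂P) (Set.Ici 0) := by
  set K : ℝ := N * (4 * M * (N : ℝ) ^ (1 / 2 : ℝ)) with hKd
  have hM0 : 0 ≤ M := (abs_nonneg _).trans (hM 0)
  have hK0 : 0 ≤ K := by positivity
  have one : ∀ G : Measure (Vd d) → ℝ, Measurable G → (∀ ν, |G ν| ≤ M) → ∀ s t, 0 ≤ s → s ≤ t →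
      ∫ ω, G (μp t ω) ∂P - ∫ ω, G (μp s ω) ∂P ≤ K * (t - s) := by
    intro G hG hM s t hs hst
    refine (dynE hd hB hK hG hM (Γ := fun _ => K) measurable_const (M' := K)
      (fun _ => (abs_of_nonneg hK0).le) ?_ hs hst).trans ?_
    · intro x hx
      exact (le_abs_self _).trans (kacGen_abs_le hd hB hx G hM)
    · simp [hst, mul_comm]
  have two : ∀ s t, 0 ≤ s → s ≤ t →
      |∫ ω, G (μp t ω) ∂P - ∫ ω, G (μp s ω) ∂P| ≤ K * (t - s) := by
    intro s t hs hst
    have h1 := one G hG hM s t hs hst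
    have h2 := one (fun ν => - G ν) hG.neg (fun ν => by rw [abs_neg]; exact hM ν) s t hs hst
    simp only [integral_neg] at h2
    rw [abs_le]; constructor <;> linarith
  have : LipschitzOnWith K.toNNReal (fun t => ∫ ω, G (μp t ω) ∂P) (Set.Ici 0) := by
    apply LipschitzOnWith.of_dist_le_mul
    intro s hs t ht
    rw [Real.coe_toNNReal _ hK0, Real.dist_eq, Real.dist_eq]
    rcases le_total s t with h | h
    · rw [abs_sub_comm, abs_sub_comm s t, abs_of_nonneg (sub_nonneg.2 h)]
      exact two s t hs h
    · rw [abs_of_nonneg (sub_nonneg.2 h)]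
      exact two t s ht h
  exact this.continuousOn

lemma pos_incr (hd : 2 ≤ d) (hB : IsCollisionKernel B) [IsProbabilityMeasure P]
    (hK : IsKacProcess B N P 𝓕 μp) {F Γ : Measure (Vd d) → ℝ}
    (hF : Measurable F) {M : ℝ} (hM : ∀ ν, |F ν| ≤ M) (hF0 : ∀ ν, 0 ≤ F ν)
    (hΓ : Measurable Γ) {M' : ℝ} (hM' : ∀ ν, |Γ ν| ≤ M')
    (hle : ∀ c : ℝ, ∀ x : Fin N → Vd d, Good x →
      kacGen B N (fun ν => max (F ν - c) 0) (emp x) ≤ Γ (emp x))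
    {s t : ℝ} (hs : 0 ≤ s) (hst : s ≤ t) :
    ∫ ω, max (F (μp t ω) - F (μp s ω)) 0 ∂P ≤ ∫ r in Set.Ioc s t, (∫ ω, Γ (μp r ω) ∂P) := by
  rw [← fub hK hΓ hM']
  have hM0 : 0 ≤ M := (abs_nonneg _).trans (hM 0)
  have iF := fun t => proc_int hK hF hM t
  have iP : Integrable (fun ω => max (F (μp t ω) - F (μp s ω)) 0) P :=
    ((iF t).sub (iF s)).pos_part
  have iI : Integrable (fun ω => ∫ r in Set.Ioc s t, Γ (μp r ω)) P := by
    have := joint_int hK hΓ hM' s t Set.univ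
    rw [Measure.restrict_univ] at this
    exact this.integral_prod_right
  have key : ∀ n : ℕ, ∫ ω, max (F (μp t ω) - F (μp s ω)) 0 ∂P ≤
      ∫ ω, (∫ r in Set.Ioc s t, Γ (μp r ω)) ∂P + 1 / ((n : ℝ) + 1) := by
    intro n
    have hn : (0:ℝ) < (n:ℝ) + 1 := by positivity
    let A : ℕ → Set Ω := fun j => {ω | ⌊((n:ℝ) + 1) * F (μp s ω)⌋₊ = j}
    have hAm : ∀ j, MeasurableSet[𝓕 s] (A j) := by
      intro j
      have h1 : Measurable[𝓕 s] (fun ω => F (μp s ω)) := hF.comp (meas_ad hK s)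
      have h2 : Measurable[𝓕 s] (fun ω => ⌊((n:ℝ) + 1) * F (μp s ω)⌋₊) :=
        Nat.measurable_floor.comp (Measurable.const_mul (m := 𝓕 s) h1 _)
      exact h2 (measurableSet_singleton j)
    have hAm' : ∀ j, MeasurableSet (A j) := fun j => 𝓕.le s _ (hAm j)
    have hAd : Pairwise (Function.onFun Disjoint A) := by
      intro i j hij
      refine Set.disjoint_left.2 fun ω h1 h2 => hij ?_
      exact (show _ = i from h1).symm.trans h2
    have hAu : ⋃ j, A j = Set.univ := by
      ext ω; simp [A]
    let h : Ω → ℝ := fun ω => max (F (μp t ω) - F (μp s ω)) 0 -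
      ((∫ r in Set.Ioc s t, Γ (μp r ω)) + 1 / ((n : ℝ) + 1))
    have iS : Integrable (fun ω => (∫ r in Set.Ioc s t, Γ (μp r ω)) + 1 / ((n : ℝ) + 1)) P :=
      iI.add (integrable_const _)
    have hi : Integrable h P := iP.sub (iI.add (integrable_const _))
    have hj : ∀ j, ∫ ω in A j, h ω ∂P ≤ 0 := by
      intro j
      set c : ℝ := j / ((n:ℝ) + 1) with hc
      have hbd : ∀ ν, |max (F ν - c) 0| ≤ M := by
        intro ν
        rw [abs_of_nonneg (le_max_right _ _)]
        apply max_le _ hM0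
        have : 0 ≤ c := by positivity
        have := (le_abs_self _).trans (hM ν)
        linarith
      have hmeas : Measurable (fun ν => max (F ν - c) 0) := (hF.sub_const c).max measurable_const
      have h1 := dyn hd hB hK hmeas hbd hΓ hM' (hle c) hs hst (hAm j)
      have iG := fun t => proc_int hK hmeas hbd t
      have hpt : ∀ ω ∈ A j, c ≤ F (μp s ω) ∧ F (μp s ω) - c ≤ 1 / ((n:ℝ) + 1) := by
        intro ω hω
        have hω : ⌊((n:ℝ) + 1) * F (μp s ω)⌋₊ = j := hω
        have h0 : 0 ≤ ((n:ℝ) + 1) * F (μp s ω) := mul_nonneg hn.le (hF0 _)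
        have l1 := Nat.floor_le h0
        have l2 := Nat.lt_floor_add_one (((n:ℝ) + 1) * F (μp s ω))
        rw [hω] at l1 l2
        rw [hc]
        constructor
        · rw [div_le_iff₀ hn]; linarith
        · rw [sub_le_iff_le_add, ← add_div, le_div_iff₀ hn]; linarith
      have h2 : ∫ ω in A j, max (F (μp t ω) - F (μp s ω)) 0 ∂P ≤
          ∫ ω in A j, max (F (μp t ω) - c) 0 ∂P := by
        apply setIntegral_mono_on iP.integrableOn (iG t).integrableOn (hAm' j)
        intro ω hω
        have := (hpt ω hω).1
        exact max_le_max (by linarith) le_rfl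
      have h3 : ∫ ω in A j, max (F (μp s ω) - c) 0 ∂P ≤ ∫ ω in A j, 1 / ((n:ℝ) + 1) ∂P := by
        apply setIntegral_mono_on (iG s).integrableOn (integrable_const _).integrableOn (hAm' j)
        intro ω hω
        exact max_le (hpt ω hω).2 (by positivity)
      have h4 : ∫ ω in A j, h ω ∂P = ∫ ω in A j, max (F (μp t ω) - F (μp s ω)) 0 ∂P -
          (∫ ω in A j, (∫ r in Set.Ioc s t, Γ (μp r ω)) ∂P + ∫ ω in A j, 1 / ((n:ℝ) + 1) ∂P) := by
        rw [← integral_add iI.integrableOn (integrable_const _).integrableOn,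
          ← integral_sub iP.integrableOn iS.integrableOn]
      rw [h4]; linarith
    have h5 := hasSum_integral_iUnion (μ := P) (f := h) hAm' hAd hi.integrableOn
    rw [hAu, Measure.restrict_univ] at h5
    have h6 : ∫ ω, h ω ∂P ≤ 0 := hasSum_le hj h5 hasSum_zero
    have h7 : ∫ ω, h ω ∂P = ∫ ω, max (F (μp t ω) - F (μp s ω)) 0 ∂P -
        (∫ ω, (∫ r in Set.Ioc s t, Γ (μp r ω)) ∂P + 1 / ((n:ℝ) + 1)) := by
      change ∫ ω, (_ - (_ + _)) ∂P = _
      rw [integral_sub iP iS, integral_add iI (integrable_const _)]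
      simp
    linarith
  refine ge_of_tendsto' (x := atTop) ?_ key
  simpa using (tendsto_one_div_add_atTop_nhds_zero_nat (𝕜 := ℝ)).const_add
    (∫ ω, (∫ r in Set.Ioc s t, Γ (μp r ω)) ∂P)

end process
end KacModel

namespace KacModel
variable {d : ℕ}
variable {N : ℕ} {x : Fin N → Vd d}

section process
variable {Ω : Type*} [m : MeasurableSpace Ω] {B : Vd d → Measure (Vd d)} {P : Measure Ω}
  {𝓕 : Filtration ℝ m} {μp : ℝ → Ω → Measure (Vd d)}

lemma ceil_tendsto {s t : ℝ} (hs : 0 ≤ s) (ht : 0 < t) :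
    Tendsto (fun n : ℕ => (⌈s * ((n:ℝ) + 1) / t⌉₊ : ℝ) * t / ((n:ℝ) + 1)) atTop
      (nhdsWithin s (Set.Ici s)) := by
  have hb : ∀ n : ℕ, s ≤ (⌈s * ((n:ℝ) + 1) / t⌉₊ : ℝ) * t / ((n:ℝ) + 1) ∧
      (⌈s * ((n:ℝ) + 1) / t⌉₊ : ℝ) * t / ((n:ℝ) + 1) ≤ s + t * (1 / ((n:ℝ) + 1)) := by
    intro n
    have hn : (0:ℝ) < (n:ℝ) + 1 := by positivity
    have l1 := Nat.le_ceil (s * ((n:ℝ) + 1) / t)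
    have l2 := Nat.ceil_lt_add_one (show 0 ≤ s * ((n:ℝ) + 1) / t by positivity)
    rw [div_le_iff₀ ht] at l1
    constructor
    · rw [le_div_iff₀ hn]; exact l1
    · rw [div_le_iff₀ hn]
      have : (s + t * (1 / ((n:ℝ) + 1))) * ((n:ℝ) + 1) = (s * ((n:ℝ) + 1) / t + 1) * t := by
        field_simp
      rw [this]
      exact mul_le_mul_of_nonneg_right l2.le ht.le
  refine tendsto_nhdsWithin_iff.2 ⟨?_, Eventually.of_forall fun n => (hb n).1⟩
  refine tendsto_of_tendsto_of_tendsto_of_le_of_le tendsto_const_nhds ?_ (fun n => (hb n).1)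
    (fun n => (hb n).2)
  simpa using ((tendsto_one_div_add_atTop_nhds_zero_nat (𝕜 := ℝ)).const_mul t).const_add s

lemma sup_bound (hd : 2 ≤ d) (hB : IsCollisionKernel B) [IsProbabilityMeasure P]
    (hK : IsKacProcess B N P 𝓕 μp) {F Γ : Measure (Vd d) → ℝ}
    (hF : Measurable F) {M : ℝ} (hM : ∀ ν, |F ν| ≤ M) (hF0 : ∀ ν, 0 ≤ F ν)
    (hΓ : Measurable Γ) {M' : ℝ} (hM' : ∀ ν, |Γ ν| ≤ M')
    (hle : ∀ c : ℝ, ∀ x : Fin N → Vd d, Good x →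
      kacGen B N (fun ν => max (F ν - c) 0) (emp x) ≤ Γ (emp x))
    {μ0 : Measure (Vd d)} (h0 : ∀ ω, μp 0 ω = μ0)
    (hlsc : ∀ (ω : Ω) (s : ℝ) (u : ℕ → ℝ), Tendsto u atTop (nhdsWithin s (Set.Ici s)) →
      ENNReal.ofReal (F (μp s ω)) ≤ liminf (fun n => ENNReal.ofReal (F (μp (u n) ω))) atTop)
    {t : ℝ} (ht : 0 ≤ t) :
    ∫⁻ ω, ⨆ s ∈ Set.Icc (0:ℝ) t, ENNReal.ofReal (F (μp s ω)) ∂P ≤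
      ENNReal.ofReal (F μ0 + ∫ r in Set.Ioc 0 t, (∫ ω, Γ (μp r ω) ∂P)) := by
  rcases ht.eq_or_lt with rfl | ht'
  · simp [h0]
  let σ : ℕ → ℕ → ℝ := fun n k => (k:ℝ) * t / ((n:ℝ) + 1)
  let D : ℕ → ℕ → Ω → ℝ := fun n k ω => max (F (μp (σ n (k+1)) ω) - F (μp (σ n k) ω)) 0
  let Y : ℕ → Ω → ℝ := fun n ω => F μ0 + ∑ k ∈ Finset.range (n+1), D n k ω
  have hD0 : ∀ n k ω, 0 ≤ D n k ω := fun n k ω => le_max_right _ _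
  have hY0 : ∀ n ω, 0 ≤ Y n ω := fun n ω => add_nonneg (hF0 _) (Finset.sum_nonneg fun k _ => hD0 n k ω)
  have hFm : ∀ s, Measurable (fun ω => F (μp s ω)) := fun s => hF.comp (meas_t hK s)
  have hDm : ∀ n k, Measurable (D n k) := fun n k => ((hFm _).sub (hFm _)).max measurable_const
  have hYm : ∀ n, Measurable (Y n) := fun n =>
    measurable_const.add (Finset.measurable_fun_sum _ fun k _ => hDm n k)
  have hstep : ∀ n k ω, F (μp (σ n k) ω) ≤ F μ0 + ∑ j ∈ Finset.range k, D n j ω := by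
    intro n k ω
    induction k with
    | zero => simp [σ, h0]
    | succ k ih =>
      rw [Finset.sum_range_succ]
      have : F (μp (σ n (k+1)) ω) - F (μp (σ n k) ω) ≤ D n k ω := le_max_left _ _
      linarith
  have hFY : ∀ n k ω, k ≤ n + 1 → F (μp (σ n k) ω) ≤ Y n ω := by
    intro n k ω hk
    refine (hstep n k ω).trans (add_le_add le_rfl ?_)
    exact Finset.sum_le_sum_of_subset_of_nonneg (Finset.range_mono hk) fun j _ _ => hD0 n j ω
  have hsup : ∀ ω, ⨆ s ∈ Set.Icc (0:ℝ) t, ENNReal.ofReal (F (μp s ω)) ≤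
      liminf (fun n => ENNReal.ofReal (Y n ω)) atTop := by
    intro ω
    refine iSup₂_le fun s hs => ?_
    refine (hlsc ω s _ (ceil_tendsto hs.1 ht')).trans ?_
    refine liminf_le_liminf (Eventually.of_forall fun n => ENNReal.ofReal_le_ofReal ?_)
    refine hFY n _ ω ?_
    apply Nat.ceil_le.2
    rw [div_le_iff₀ ht']
    push_cast
    have : (0:ℝ) < (n:ℝ) + 1 := by positivity
    nlinarith [hs.2]
  set g : ℝ → ℝ := fun r => ∫ ω, Γ (μp r ω) ∂P with hg
  have hgi : ∀ a b, IntegrableOn g (Set.Ioc a b) := by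
    intro a b
    have := joint_int hK hΓ hM' a b Set.univ
    rw [Measure.restrict_univ] at this
    exact this.integral_prod_left
  have hEY : ∀ n, ∫⁻ ω, ENNReal.ofReal (Y n ω) ∂P ≤
      ENNReal.ofReal (F μ0 + ∫ r in Set.Ioc 0 t, g r) := by
    intro n
    have hn : (0:ℝ) < (n:ℝ) + 1 := by positivity
    have iD : ∀ k, Integrable (D n k) P := fun k =>
      ((proc_int hK hF hM _).sub (proc_int hK hF hM _)).pos_part
    have iS : Integrable (fun ω => ∑ k ∈ Finset.range (n+1), D n k ω) P :=
      integrable_finsetSum _ fun k _ => iD k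
    have iY : Integrable (Y n) P := (integrable_const _).add iS
    rw [← ofReal_integral_eq_lintegral_ofReal iY (ae_of_all _ (hY0 n))]
    apply ENNReal.ofReal_le_ofReal
    have e1 : ∫ ω, Y n ω ∂P = F μ0 + ∑ k ∈ Finset.range (n+1), ∫ ω, D n k ω ∂P := by
      change ∫ ω, (F μ0 + ∑ k ∈ Finset.range (n+1), D n k ω) ∂P = _
      rw [integral_add (integrable_const _) iS, integral_finsetSum _ fun k _ => iD k]
      simp
    rw [e1]
    have hσ0 : σ n 0 = 0 := by simp [σ]
    have hσ1 : σ n (n+1) = t := by simp only [σ]; push_cast; field_simp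
    have hσm : ∀ k, σ n k ≤ σ n (k+1) := by
      intro k; simp only [σ]; push_cast
      apply div_le_div_of_nonneg_right _ hn.le
      nlinarith
    have hσp : ∀ k, 0 ≤ σ n k := by intro k; simp only [σ]; positivity
    have e2 := intervalIntegral.sum_integral_adjacent_intervals (f := g) (μ := volume) (a := σ n)
      (n := n+1) (fun k _ => (intervalIntegrable_iff_integrableOn_Ioc_of_le (hσm k)).2 (hgi _ _))
    rw [hσ0, hσ1, intervalIntegral.integral_of_le ht] at e2
    rw [← e2]
    refine add_le_add le_rfl (Finset.sum_le_sum fun k _ => ?_)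
    rw [intervalIntegral.integral_of_le (hσm k)]
    exact pos_incr hd hB hK hF hM hF0 hΓ hM' hle (hσp k) (hσm k)
  calc ∫⁻ ω, ⨆ s ∈ Set.Icc (0:ℝ) t, ENNReal.ofReal (F (μp s ω)) ∂P
      ≤ ∫⁻ ω, liminf (fun n => ENNReal.ofReal (Y n ω)) atTop ∂P := lintegral_mono hsup
    _ ≤ liminf (fun n => ∫⁻ ω, ENNReal.ofReal (Y n ω) ∂P) atTop :=
        lintegral_liminf_le fun n => (hYm n).ennreal_ofReal
    _ ≤ liminf (fun _ : ℕ => ENNReal.ofReal (F μ0 + ∫ r in Set.Ioc 0 t, g r)) atTop :=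
        liminf_le_liminf (Eventually.of_forall hEY)
    _ = _ := liminf_const _

end process
end KacModel

namespace KacModel
variable {d : ℕ}
variable {N : ℕ} {x : Fin N → Vd d}

lemma emp_ae (hN : N ≠ 0) : ∀ᵐ v ∂(emp x), v ∈ Set.range x := by
  have hm : MeasurableSet (Set.range x) := (Set.finite_range x).measurableSet
  rw [ae_iff]
  have : emp x (Set.range x)ᶜ = 0 := by
    simp [emp, Measure.finsetSum_apply, Measure.dirac_apply' _ hm.compl]
  exact this

section process
variable {Ω : Type*} [m : MeasurableSpace Ω] {B : Vd d → Measure (Vd d)} {P : Measure Ω}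
  {𝓕 : Filtration ℝ m} {μp : ℝ → Ω → Measure (Vd d)}

lemma rc_cont (hK : IsKacProcess B N P 𝓕 μp) {f : Vd d → ℝ} (hf : Continuous f)
    (ω : Ω) (t : ℝ) :
    ContinuousWithinAt (fun s => ∫ v, f v ∂(μp s ω)) (Set.Ici t) t := by
  let χ : Vd d → ℝ := fun v => max 0 (min 1 ((N:ℝ) + 2 - ‖v‖))
  have hχ : Continuous χ := by fun_prop
  have hc : HasCompactSupport (fun v => f v * χ v) := by
    apply HasCompactSupport.intro (isCompact_closedBall (0 : Vd d) ((N:ℝ) + 2))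
    intro v hv
    have : (N:ℝ) + 2 < ‖v‖ := by simpa using hv
    have : χ v = 0 := max_eq_left ((min_le_right _ _).trans (by linarith))
    rw [this, mul_zero]
  obtain ⟨C, hC⟩ := (hf.mul hχ).bounded_above_of_compact_support hc
  have h := rc_bcf hK (BoundedContinuousFunction.ofNormedAddCommGroup _ (hf.mul hχ) C hC) ω t
  refine h.congr_of_eventuallyEq ?_ ?_
  · refine Eventually.of_forall fun s => ?_
    obtain ⟨x, hx, hg⟩ := mem_emp (hK.mem s ω)
    simp only [hx]
    refine integral_congr_ae ((emp_ae hg.1).mono ?_)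
    rintro _ ⟨i, rfl⟩
    have h1 := hg.norm_le i
    have h2 : ‖x i‖ ≤ (N:ℝ) + 1 := by
      have := hg.pos
      nlinarith [norm_nonneg (x i)]
    have : χ (x i) = 1 := by
      have : min 1 ((N:ℝ) + 2 - ‖x i‖) = 1 := min_eq_left (by linarith)
      simp [χ, this]
    simp [this]
  · obtain ⟨x, hx, hg⟩ := mem_emp (hK.mem t ω)
    simp only [hx]
    refine integral_congr_ae ((emp_ae hg.1).mono ?_)
    rintro _ ⟨i, rfl⟩
    have h1 := hg.norm_le i
    have h2 : ‖x i‖ ≤ (N:ℝ) + 1 := by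
      have := hg.pos
      nlinarith [norm_nonneg (x i)]
    have : χ (x i) = 1 := by
      have : min 1 ((N:ℝ) + 2 - ‖x i‖) = 1 := min_eq_left (by linarith)
      simp [χ, this]
    simp [this]

lemma Gq_mo (hK : IsKacProcess B N P 𝓕 μp) {q : ℝ} (hq : 0 ≤ q) (s : ℝ) (ω : Ω) :
    Gq N q (μp s ω) = mo q (μp s ω) := by
  obtain ⟨x, hx, hg⟩ := mem_emp (hK.mem s ω)
  rw [hx]; exact Gq_emp hg hq

lemma momentL_Gq (hK : IsKacProcess B N P 𝓕 μp) {q : ℝ} (hq : 0 ≤ q) (s : ℝ) (ω : Ω) :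
    momentL q (μp s ω) = ENNReal.ofReal (Gq N q (μp s ω)) := by
  obtain ⟨x, hx, hg⟩ := mem_emp (hK.mem s ω)
  rw [hx, Gq_emp hg hq, momentL_emp q hq hg.1]

lemma lsc_Gq (hK : IsKacProcess B N P 𝓕 μp) {q : ℝ} (hq : 0 ≤ q) (ω : Ω) (s : ℝ) (u : ℕ → ℝ)
    (hu : Tendsto u atTop (nhdsWithin s (Set.Ici s))) :
    ENNReal.ofReal (Gq N q (μp s ω)) ≤ liminf (fun n => ENNReal.ofReal (Gq N q (μp (u n) ω))) atTop := by
  have hf : Continuous (fun v : Vd d => ‖v‖ ^ q) := continuous_norm.rpow_const fun _ => Or.inr hq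
  have h := (rc_cont hK hf ω s).tendsto.comp hu
  have h2 := (ENNReal.continuous_ofReal.tendsto _).comp h
  simp only [Gq_mo hK hq]
  exact h2.liminf_eq.ge

end process

lemma set_int_split (S : Finset (Vd d)) (f : Vd d → ℝ) (hN : N ≠ 0) :
    ∫ v, f v ∂(emp x) = ∫ v in (↑S : Set (Vd d))ᶜ, f v ∂(emp x) + ∑ y ∈ S, (emp x).real {y} * f y := by
  have := emp_prob (x := x) hN
  rw [← integral_add_compl S.measurableSet (integrable_emp f hN), add_comm,
    setIntegral_finset S (integrable_emp f hN).integrableOn]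
  simp

/-- real weight -/
def wr (p : ℝ) (v : Vd d) : ℝ := 1 + ‖v‖ ^ p

lemma wr_nonneg (p : ℝ) (v : Vd d) : 0 ≤ wr p v := by unfold wr; positivity

lemma wt_wr {p : ℝ} (hp : 0 ≤ p) (v : Vd d) : wt p v = ENNReal.ofReal (wr p v) := by
  unfold wt wr
  rw [ENNReal.ofReal_add zero_le_one (by positivity), nn_rpow v hp]; simp

lemma tsub_abs {a b : ℝ≥0∞} (ha : a ≠ ⊤) (hb : b ≠ ⊤) :
    (a - b) + (b - a) = ENNReal.ofReal |a.toReal - b.toReal| := by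
  rcases le_total a b with h | h
  · have h' := (ENNReal.toReal_le_toReal ha hb).2 h
    rw [tsub_eq_zero_of_le h, zero_add, abs_sub_comm, abs_of_nonneg (sub_nonneg.2 h'),
      ENNReal.ofReal_sub _ ENNReal.toReal_nonneg, ENNReal.ofReal_toReal ha, ENNReal.ofReal_toReal hb]
  · have h' := (ENNReal.toReal_le_toReal hb ha).2 h
    rw [tsub_eq_zero_of_le h, add_zero, abs_of_nonneg (sub_nonneg.2 h'),
      ENNReal.ofReal_sub _ ENNReal.toReal_nonneg, ENNReal.ofReal_toReal ha, ENNReal.ofReal_toReal hb]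

lemma Phi_real {p : ℝ} (hp : 0 ≤ p) (S : Finset (Vd d)) (μ0 : Measure (Vd d)) [IsFiniteMeasure μ0]
    (hN : N ≠ 0) : Phi p S μ0 (emp x) = ENNReal.ofReal (∫ v in (↑S : Set (Vd d))ᶜ, wr p v ∂(emp x) +
      ∑ y ∈ S, wr p y * |(emp x).real {y} - μ0.real {y}|) := by
  have := emp_prob (x := x) hN
  unfold Phi
  rw [ENNReal.ofReal_add (integral_nonneg fun v => wr_nonneg p v)
    (Finset.sum_nonneg fun y _ => mul_nonneg (wr_nonneg p y) (abs_nonneg _)),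
    ENNReal.ofReal_sum_of_nonneg (fun y _ => mul_nonneg (wr_nonneg p y) (abs_nonneg _)),
    ofReal_integral_eq_lintegral_ofReal (integrable_emp _ hN).integrableOn
      (ae_of_all _ fun v => wr_nonneg p v)]
  congr 1
  · simp only [wt_wr hp]
  · refine Finset.sum_congr rfl fun y _ => ?_
    rw [ENNReal.ofReal_mul (wr_nonneg p y), wt_wr hp,
      tsub_abs (measure_ne_top _ _) (measure_ne_top _ _)]; rfl

lemma Phi_test {p : ℝ} (hp : 0 ≤ p) {x0 : Fin N → Vd d} (hN : N ≠ 0) (S : Finset (Vd d))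
    (hS : emp x0 (↑S : Set (Vd d))ᶜ = 0) (x : Fin N → Vd d) :
    ∃ f : Vd d → ℝ, Continuous f ∧
      Phi p S (emp x0) (emp x) ≤ ENNReal.ofReal (∫ v, f v ∂(emp x) - ∫ v, f v ∂(emp x0)) ∧
      ∀ y : Fin N → Vd d,
        ENNReal.ofReal (∫ v, f v ∂(emp y) - ∫ v, f v ∂(emp x0)) ≤ Phi p S (emp x0) (emp y) := by
  have := emp_prob (x := x0) hN
  classical
  let T : Finset (Vd d) := S ∪ Finset.univ.image x
  let Tp : Finset (Vd d) := T.filter fun y => (emp x0).real {y} ≤ (emp x).real {y}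
  let Tn : Finset (Vd d) := T.filter fun y => ¬ (emp x0).real {y} ≤ (emp x).real {y}
  have hdis : Disjoint (↑Tn : Set (Vd d)) (↑Tp : Set (Vd d)) := by
    rw [Finset.disjoint_coe]
    exact (Finset.disjoint_filter_filter_not _ _ _).symm
  obtain ⟨g, g0, g1, gI⟩ := exists_continuous_zero_one_of_isClosed
    Tn.finite_toSet.isClosed Tp.finite_toSet.isClosed hdis
  let h : Vd d → ℝ := fun v => 2 * g v - 1
  have hh : ∀ v, |h v| ≤ 1 := by
    intro v; have := gI v; rw [abs_le]; simp only [h]; constructor <;> linarith [this.1, this.2]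
  have hw : Continuous (wr p : Vd d → ℝ) := by
    unfold wr
    exact continuous_const.add (continuous_norm.rpow_const fun _ => Or.inr hp)
  have hfc : Continuous (fun v => wr p v * h v) :=
    hw.mul ((continuous_const.mul g.continuous).sub continuous_const)
  have hdec : ∀ y : Fin N → Vd d, ∫ v, wr p v * h v ∂(emp y) - ∫ v, wr p v * h v ∂(emp x0) =
      ∫ v in (↑S : Set (Vd d))ᶜ, wr p v * h v ∂(emp y) +
        ∑ z ∈ S, wr p z * (h z * ((emp y).real {z} - (emp x0).real {z})) := by
    intro y
    rw [set_int_split S _ hN, set_int_split (x := x0) S _ hN, Measure.restrict_eq_zero.2 hS]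
    simp only [integral_zero_measure, zero_add]
    rw [add_sub_assoc, ← Finset.sum_sub_distrib]
    congr 1
    exact Finset.sum_congr rfl fun z _ => by ring
  refine ⟨fun v => wr p v * h v, hfc, ?_, ?_⟩
  · rw [Phi_real hp S _ hN, hdec]
    apply ENNReal.ofReal_le_ofReal
    apply add_le_add
    · apply le_of_eq
      refine setIntegral_congr_ae S.measurableSet.compl ((emp_ae hN).mono ?_)
      rintro _ ⟨i, rfl⟩ hi
      have h1 : (emp x0).real {x i} = 0 := by
        rw [measureReal_def, measure_mono_null (Set.singleton_subset_iff.2 hi) hS]; rfl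
      have h2 : x i ∈ Tp := by
        simp only [Tp, T, Finset.mem_filter, Finset.mem_union, Finset.mem_image]
        exact ⟨Or.inr ⟨i, Finset.mem_univ _, rfl⟩, by rw [h1]; exact measureReal_nonneg⟩
      have h3 := g1 h2
      simp only [h, h3]; norm_num
    · refine Finset.sum_le_sum fun z hz => mul_le_mul_of_nonneg_left ?_ (wr_nonneg p z)
      by_cases hc : (emp x0).real {z} ≤ (emp x).real {z}
      · have h2 : z ∈ Tp := by
          simp only [Tp, T, Finset.mem_filter, Finset.mem_union]
          exact ⟨Or.inl hz, hc⟩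
        have h3 := g1 h2
        rw [abs_of_nonneg (sub_nonneg.2 hc)]
        simp only [h, h3]; apply le_of_eq; simp; ring
      · have h2 : z ∈ Tn := by
          simp only [Tn, T, Finset.mem_filter, Finset.mem_union]
          exact ⟨Or.inl hz, hc⟩
        have h3 := g0 h2
        rw [abs_of_neg (sub_neg.2 (not_le.1 hc))]
        simp only [h, h3]; apply le_of_eq; simp
  · intro y
    rw [Phi_real hp S _ hN, hdec]
    apply ENNReal.ofReal_le_ofReal
    apply add_le_add
    · apply integral_mono (integrable_emp _ hN).integrableOn (integrable_emp _ hN).integrableOn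
      intro v
      have := (abs_le.1 (hh v)).2
      simpa using mul_le_mul_of_nonneg_left this (wr_nonneg p v)
    · refine Finset.sum_le_sum fun z hz => mul_le_mul_of_nonneg_left ?_ (wr_nonneg p z)
      refine (le_abs_self _).trans ?_
      rw [abs_mul]
      exact mul_le_of_le_one_left (abs_nonneg _) (hh z)

section process
variable {Ω : Type*} [m : MeasurableSpace Ω] {B : Vd d → Measure (Vd d)} {P : Measure Ω}
  {𝓕 : Filtration ℝ m} {μp : ℝ → Ω → Measure (Vd d)}

lemma GP_Phi (hK : IsKacProcess B N P 𝓕 μp) {p : ℝ} (hp : 0 ≤ p) {x0 : Fin N → Vd d} (h0 : Good x0)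
    (S : Finset (Vd d)) (hS : emp x0 (↑S : Set (Vd d))ᶜ = 0) (s : ℝ) (ω : Ω) :
    ENNReal.ofReal (GP N p S (emp x0) (μp s ω)) = Phi p S (emp x0) (μp s ω) := by
  obtain ⟨x, hx, hg⟩ := mem_emp (hK.mem s ω)
  rw [hx]
  have h := Phi_le_HP hg h0 hp S hS
  rw [GP, clampF_eq h, ENNReal.ofReal_toReal (ne_top_of_le_ne_top ENNReal.ofReal_ne_top h)]

lemma lsc_GP (hK : IsKacProcess B N P 𝓕 μp) {p : ℝ} (hp : 0 ≤ p) {x0 : Fin N → Vd d} (h0 : Good x0)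
    (S : Finset (Vd d)) (hS : emp x0 (↑S : Set (Vd d))ᶜ = 0) (ω : Ω) (s : ℝ) (u : ℕ → ℝ)
    (hu : Tendsto u atTop (nhdsWithin s (Set.Ici s))) :
    ENNReal.ofReal (GP N p S (emp x0) (μp s ω)) ≤
      liminf (fun n => ENNReal.ofReal (GP N p S (emp x0) (μp (u n) ω))) atTop := by
  simp only [GP_Phi hK hp h0 S hS]
  obtain ⟨x, hx, hg⟩ := mem_emp (hK.mem s ω)
  obtain ⟨f, hf, h1, h2⟩ := Phi_test hp h0.1 S hS x
  have h := ((rc_cont hK hf ω s).tendsto.comp hu).sub_const (∫ v, f v ∂(emp x0))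
  have h3 := (ENNReal.continuous_ofReal.tendsto _).comp h
  rw [← hx] at h1
  refine h1.trans (h3.liminf_eq.ge.trans ?_)
  refine liminf_le_liminf (Eventually.of_forall fun n => ?_)
  obtain ⟨y, hy, hgy⟩ := mem_emp (hK.mem (u n) ω)
  simp only [Function.comp]
  rw [hy]
  exact h2 y

end process
end KacModel

namespace KacModel
variable {d : ℕ}
variable {N : ℕ} {x : Fin N → Vd d}

lemma cont_int {f : ℝ → ℝ} (hf : ContinuousOn f (Set.Ici 0)) {s t : ℝ} (hs : 0 ≤ s) :
    IntegrableOn f (Set.Ioc s t) :=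
  ((hf.mono fun r hr => hs.trans hr.1).integrableOn_Icc).mono_set Set.Ioc_subset_Icc_self

lemma gron {f : ℝ → ℝ} (hf : ContinuousOn f (Set.Ici 0)) {a b : ℝ} (ha : 0 < a) (hb : 0 ≤ b)
    (h : ∀ s t, 0 ≤ s → s ≤ t → f t - f s ≤ ∫ r in Set.Ioc s t, (-a * f r + b))
    {s t : ℝ} (hs : 0 ≤ s) (hst : s ≤ t) :
    f t ≤ Real.exp (-a * (t - s)) * f s + b / a := by
  have key := le_gronwallBound_of_liminf_deriv_right_le (f := f) (f' := fun x => -a * f x + b)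
    (δ := f s) (K := -a) (ε := b) (a := s) (b := t)
    (hf.mono fun r hr => hs.trans hr.1) ?_ le_rfl (fun x _ => le_rfl) t ⟨hst, le_rfl⟩
  · rw [gronwallBound_of_K_ne_0 (neg_ne_zero.2 ha.ne')] at key
    refine key.trans ?_
    have h1 := Real.exp_pos (-a * (t - s))
    have h2 : b / -a * (Real.exp (-a * (t - s)) - 1) = b / a - b / a * Real.exp (-a * (t - s)) := by
      rw [div_neg]; ring
    have : 0 ≤ b / a * Real.exp (-a * (t - s)) := by positivity
    beta_reduce
    rw [h2]; linarith
  · intro x hx r hr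
    have hx0 : 0 ≤ x := hs.trans hx.1
    obtain ⟨r', hr1, hr2⟩ := exists_between hr
    have hg : ContinuousOn (fun y => -a * f y + b) (Set.Ici 0) :=
      (continuousOn_const.mul hf).add continuousOn_const
    have hc : ContinuousWithinAt (fun y => -a * f y + b) (Set.Ici x) x :=
      (hg x hx0).mono (Set.Ici_subset_Ici.2 hx0)
    have ev : ∀ᶠ y in nhdsWithin x (Set.Ici x), -a * f y + b < r' := hc.eventually_lt_const hr1
    obtain ⟨u, hu, hsub⟩ := (mem_nhdsGE_iff_exists_Ico_subset).1 ev
    refine Eventually.frequently ?_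
    filter_upwards [Ioo_mem_nhdsGT hu] with z hz
    have hzx : 0 < z - x := sub_pos.2 hz.1
    have h1 : ∫ y in Set.Ioc x z, (-a * f y + b) ≤ ∫ y in Set.Ioc x z, r' := by
      apply setIntegral_mono_on (cont_int hg hx0) (by simp) measurableSet_Ioc
      intro y hy
      exact (hsub ⟨hy.1.le, hy.2.trans_lt hz.2⟩ : _ < _).le
    have h2 := h x z hx0 hz.1.le
    have h3 : ∫ y in Set.Ioc x z, r' = (z - x) * r' := by
      simp [hz.1.le]
    rw [inv_mul_lt_iff₀ hzx]
    nlinarith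

/-- expected moment -/
def ph {Ω : Type*} [MeasurableSpace Ω] (P : Measure Ω) (μp : ℝ → Ω → Measure (Vd d)) (N : ℕ)
    (q t : ℝ) : ℝ := ∫ ω, Gq N q (μp t ω) ∂P

section process
variable {Ω : Type*} [m : MeasurableSpace Ω] {B : Vd d → Measure (Vd d)} {P : Measure Ω}
  {𝓕 : Filtration ℝ m} {μp : ℝ → Ω → Measure (Vd d)}

lemma ph_cont (hd : 2 ≤ d) (hB : IsCollisionKernel B) [IsProbabilityMeasure P]
    (hK : IsKacProcess B N P 𝓕 μp) (q : ℝ) : ContinuousOn (ph P μp N q) (Set.Ici 0) :=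
  lip_exp hd hB hK (Gq_meas N q) (Gq_abs N q)

lemma Gq_nonneg (N : ℕ) (q : ℝ) (ν : Measure (Vd d)) : 0 ≤ Gq N q ν := clampF_nonneg _ _ _

lemma ph_nonneg (q t : ℝ) : 0 ≤ ph P μp N q t := integral_nonneg fun ω => Gq_nonneg _ _ _

lemma ph_le [IsProbabilityMeasure P] (hK : IsKacProcess B N P 𝓕 μp) (q t : ℝ) :
    ph P μp N q t ≤ Hq N q := by
  have : ph P μp N q t ≤ ∫ ω, Hq N q ∂P :=
    integral_mono (proc_int hK (Gq_meas N q) (Gq_abs N q) t) (integrable_const _)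
      fun ω => (le_abs_self _).trans (Gq_abs N q _)
  simpa using this

lemma ph_zero [IsProbabilityMeasure P] (hK : IsKacProcess B N P 𝓕 μp) {μ0 : Measure (Vd d)}
    (h0 : ∀ ω, μp 0 ω = μ0) {q : ℝ} (hq : 0 ≤ q) : ph P μp N q 0 = mo q μ0 := by
  obtain ⟨ω⟩ := P.nonempty_of_neZero
  have := Gq_mo hK hq 0 ω
  rw [h0] at this
  simp [ph, h0, this]

lemma ph_two [IsProbabilityMeasure P] (hK : IsKacProcess B N P 𝓕 μp) (t : ℝ) :
    ph P μp N 2 t = 1 := by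
  have : ∀ ω, Gq N 2 (μp t ω) = 1 := by
    intro ω
    obtain ⟨x, hx, hg⟩ := mem_emp (hK.mem t ω)
    rw [hx, Gq_emp hg (by norm_num), mo_two hg]
  simp [ph, this]

lemma mo0_one_le [IsProbabilityMeasure P] (hK : IsKacProcess B N P 𝓕 μp) {μ0 : Measure (Vd d)}
    (h0 : ∀ ω, μp 0 ω = μ0) {q : ℝ} (hq : 2 ≤ q) : 1 ≤ mo q μ0 := by
  obtain ⟨ω⟩ := P.nonempty_of_neZero
  obtain ⟨x, hx, hg⟩ := mem_emp (hK.mem 0 ω)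
  rw [← h0 ω, hx]
  exact one_le_mo hg hq

lemma drift (hd : 2 ≤ d) (hB : IsCollisionKernel B) {q : ℝ} (hq : 2 < q) :
    ∃ β C : ℝ, 0 < β ∧ 0 ≤ C ∧ ∀ {Ω : Type} [m : MeasurableSpace Ω] {P : Measure Ω}
      [IsProbabilityMeasure P] {𝓕 : Filtration ℝ m} {N : ℕ} {μp : ℝ → Ω → Measure (Vd d)},
      IsKacProcess B N P 𝓕 μp → ∀ {p M : ℝ}, 0 ≤ p → p ≤ q → (∀ t, 0 ≤ t → ph P μp N p t ≤ M) →
      ∀ {A a : ℝ}, 0 < A → 0 < a → β * A - C = a → ∀ {s t : ℝ}, 0 ≤ s → s ≤ t →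
        ph P μp N q t ≤ Real.exp (-a * (t - s)) * ph P μp N q s + β * A ^ (q + 1 - p) * M / a := by
  obtain ⟨β, C, hβ, hC, hgen⟩ := gen_moment hd hB hq
  refine ⟨β, C, hβ, hC, ?_⟩
  intro Ω m P _ 𝓕 N μp hK p M hp hpq hM A a hA ha haA s t hs hst
  have hM0 : 0 ≤ M := (ph_nonneg p 0).trans (hM 0 le_rfl)
  have hq0 : 0 ≤ q := by linarith
  set c : ℝ := β * A ^ (q + 1 - p) with hc
  have hc0 : 0 ≤ c := by positivity
  refine gron (ph_cont hd hB hK q) ha (by positivity) ?_ hs hst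
  intro s t hs hst
  have h1 := dynE hd hB hK (Gq_meas N q) (Gq_abs N q)
    (Γ := fun ν => -a * Gq N q ν + c * Gq N p ν)
    (((Gq_meas N q).const_mul _).add ((Gq_meas N p).const_mul _)) (M' := a * Hq N q + c * Hq N p)
    ?_ ?_ hs hst
  · refine h1.trans ?_
    have e : ∀ r, ∫ ω, (-a * Gq N q (μp r ω) + c * Gq N p (μp r ω)) ∂P =
        -a * ph P μp N q r + c * ph P μp N p r := by
      intro r
      rw [integral_add ((proc_int hK (Gq_meas N q) (Gq_abs N q) r).const_mul _)
        ((proc_int hK (Gq_meas N p) (Gq_abs N p) r).const_mul _), integral_const_mul,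
        integral_const_mul]; rfl
    simp only [e]
    have cq := ph_cont hd hB hK q
    have cp := ph_cont hd hB hK p
    apply setIntegral_mono_on
      (cont_int ((continuousOn_const.mul cq).add (continuousOn_const.mul cp)) hs)
      (cont_int ((continuousOn_const.mul cq).add continuousOn_const) hs) measurableSet_Ioc
    intro r hr
    have := mul_le_mul_of_nonneg_left (hM r (hs.trans hr.1.le)) hc0
    change -a * ph P μp N q r + c * ph P μp N p r ≤ -a * ph P μp N q r + c * M
    linarith
  · intro ν
    refine (abs_add_le _ _).trans ?_
    rw [abs_mul, abs_mul, abs_neg, abs_of_pos ha, abs_of_nonneg hc0]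
    exact add_le_add (mul_le_mul_of_nonneg_left (Gq_abs N q ν) ha.le)
      (mul_le_mul_of_nonneg_left (Gq_abs N p ν) hc0)
  · intro x hx
    have h2 := hgen N x hx
    have h3 := mul_le_mul_of_nonneg_left (mo_interp hx hp hpq hA) hβ.le
    rw [Gq_emp hx hq0, Gq_emp hx hp, hc, ← haA]
    linarith

lemma propag (hd : 2 ≤ d) (hB : IsCollisionKernel B) {q : ℝ} (hq : 2 ≤ q) :
    ∃ C : ℝ, 1 ≤ C ∧ ∀ {Ω : Type} [m : MeasurableSpace Ω] {P : Measure Ω}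
      [IsProbabilityMeasure P] {𝓕 : Filtration ℝ m} {N : ℕ} {μp : ℝ → Ω → Measure (Vd d)},
      IsKacProcess B N P 𝓕 μp → ∀ {μ0}, (∀ ω, μp 0 ω = μ0) → ∀ {t : ℝ}, 0 ≤ t →
        ph P μp N q t ≤ C * mo q μ0 := by
  rcases hq.eq_or_lt with rfl | hq
  · refine ⟨1, le_rfl, ?_⟩
    intro Ω m P _ 𝓕 N μp hK μ0 h0 t ht
    rw [ph_two hK, one_mul]
    exact mo0_one_le hK h0 le_rfl
  obtain ⟨β, C, hβ, hC, h⟩ := drift hd hB hq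
  set A : ℝ := (C + β) / β with hA
  have hA0 : 0 < A := by positivity
  refine ⟨1 + A ^ (q + 1 - 2), ?_, ?_⟩
  · have : 0 < A ^ (q + 1 - 2) := by positivity
    linarith
  intro Ω m P _ 𝓕 N μp hK μ0 h0 t ht
  have h1 := h hK (p := 2) (M := 1) (by norm_num) hq.le (fun t _ => (ph_two hK t).le) hA0 hβ
    (by rw [hA]; field_simp; ring) le_rfl ht
  rw [ph_zero hK h0 (by linarith)] at h1
  have h2 := mo0_one_le hK h0 hq.le
  have h3 : Real.exp (-β * (t - 0)) ≤ 1 := Real.exp_le_one_iff.2 (by nlinarith)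
  have h4 : β * A ^ (q + 1 - 2) * 1 / β = A ^ (q + 1 - 2) := by field_simp
  rw [h4] at h1
  have h5 : 0 < A ^ (q + 1 - 2) := by positivity
  nlinarith

lemma half_iter {u : ℝ → ℝ} {H K : ℝ} (hu : ∀ t, 0 < t → u t ≤ H)
    (h : ∀ t, 0 < t → ∃ s, 0 < s ∧ u t ≤ u s / 2 + K) (hK : 0 ≤ K) (hH : 0 ≤ H) :
    ∀ t, 0 < t → u t ≤ 2 * K := by
  have key : ∀ n : ℕ, ∀ t, 0 < t → u t ≤ H * (1/2) ^ n + 2 * K := by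
    intro n
    induction n with
    | zero => intro t ht; have := hu t ht; simp; linarith
    | succ n ih =>
      intro t ht
      obtain ⟨s, hs, h1⟩ := h t ht
      have := ih s hs
      rw [pow_succ]; linarith
  intro t ht
  refine ge_of_tendsto' (x := atTop) (f := fun n : ℕ => H * (1/2) ^ n + 2 * K) ?_ fun n => key n t ht
  simpa using ((tendsto_pow_atTop_nhds_zero_of_lt_one (r := (1/2:ℝ)) (by norm_num)
    (by norm_num)).const_mul H).add_const (2 * K)

lemma creation (hd : 2 ≤ d) (hB : IsCollisionKernel B) {p q : ℝ} (hp : 2 ≤ p) (hpq : p ≤ q)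
    (hq : 2 < q) :
    ∃ C : ℝ, 0 < C ∧ ∀ {Ω : Type} [m : MeasurableSpace Ω] {P : Measure Ω}
      [IsProbabilityMeasure P] {𝓕 : Filtration ℝ m} {N : ℕ} {μp : ℝ → Ω → Measure (Vd d)},
      IsKacProcess B N P 𝓕 μp → ∀ {μ0}, (∀ ω, μp 0 ω = μ0) → ∀ {t : ℝ}, 0 < t →
        ph P μp N q t ≤ C * (1 + t ^ (p - q)) * mo p μ0 := by
  obtain ⟨Cp, hCp, hprop⟩ := propag hd hB hp
  obtain ⟨β, C, hβ, hC, h⟩ := drift hd hB hq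
  set r : ℝ := q - p with hr
  have hr0 : 0 ≤ r := by linarith
  set D : ℝ := (C + 2 * (r + 1)) / β with hD
  have hD0 : 0 < D := by positivity
  set K : ℝ := β * D ^ (r + 1) / (2 * (r + 1)) with hKd
  have hK0 : 0 < K := by positivity
  refine ⟨2 * K * Cp, by positivity, ?_⟩
  intro Ω m P _ 𝓕 N μp hK μ0 h0 t ht
  set M : ℝ := Cp * mo p μ0 with hM
  have hM0 : 0 ≤ M := mul_nonneg (by linarith) (mo_nonneg _ _)
  have hMb : ∀ t, 0 ≤ t → ph P μp N p t ≤ M := fun t ht => hprop hK h0 ht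
  let θ : ℝ → ℝ := fun t => min t 1
  have hθ : ∀ t, 0 < t → 0 < θ t := fun t ht => lt_min ht one_pos
  have hθ1 : ∀ t, θ t ≤ 1 := fun t => min_le_right _ _
  have main : ∀ t, 0 < t → θ t ^ r * ph P μp N q t ≤ 2 * (K * M) := by
    refine half_iter (H := Hq N q) ?_ ?_ (by positivity) (Hq_nonneg N q)
    · intro t ht
      have h1 := ph_le hK q t
      have h2 : θ t ^ r ≤ 1 := Real.rpow_le_one (hθ t ht).le (hθ1 t) hr0
      have h3 : 0 ≤ θ t ^ r := (Real.rpow_pos_of_pos (hθ t ht) _).le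
      nlinarith [ph_nonneg (P := P) (μp := μp) (N := N) q t]
    · intro t ht
      have hθt := hθ t ht
      set τ := θ t with hτ
      have hτt : τ ≤ t := min_le_left _ _
      have hτ1 : τ ≤ 1 := hθ1 t
      have hs0 : 0 < t - τ / 2 := by linarith
      refine ⟨t - τ / 2, hs0, ?_⟩
      have hθs : τ / 2 ≤ θ (t - τ / 2) := le_min (by linarith) (by linarith)
      set a : ℝ := 2 * (r + 1) / τ with ha
      have ha0 : 0 < a := by positivity
      set A : ℝ := (C + a) / β with hA
      have hA0 : 0 < A := by positivity
      have h1 := h hK (p := p) (M := M) (by linarith) hpq hMb hA0 ha0 (by rw [hA]; field_simp; ring)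
        hs0.le (by linarith : t - τ / 2 ≤ t)
      have e1 : -a * (t - (t - τ / 2)) = -(r + 1) := by rw [ha]; field_simp; ring
      rw [e1] at h1
      have hAD : A ≤ D / τ := by
        rw [hA, hD, ha, div_div, div_le_div_iff₀ hβ (by positivity)]
        have : (C + 2 * (r + 1) / τ) * (β * τ) = (C * τ + 2 * (r + 1)) * β := by field_simp
        rw [this]
        apply mul_le_mul_of_nonneg_right _ hβ.le
        nlinarith
      have hAp : A ^ (q + 1 - p) ≤ D ^ (r + 1) / τ ^ (r + 1) := by
        rw [← Real.div_rpow hD0.le hθt.le, show q + 1 - p = r + 1 by rw [hr]; ring]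
        exact Real.rpow_le_rpow hA0.le hAD (by linarith)
      have hτr : 0 < τ ^ r := Real.rpow_pos_of_pos hθt _
      have hb : τ ^ r * (β * A ^ (q + 1 - p) * M / a) ≤ K * M := by
        calc τ ^ r * (β * A ^ (q + 1 - p) * M / a)
            ≤ τ ^ r * (β * (D ^ (r + 1) / τ ^ (r + 1)) * M / a) := by gcongr
          _ = K * M := by
            rw [Real.rpow_add_one hθt.ne', ha, hKd]; field_simp
      have h2 : Real.exp (-(r + 1)) * τ ^ r ≤ θ (t - τ / 2) ^ r / 2 := by
        have e2 : τ ^ r = 2 ^ r * (τ / 2) ^ r := by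
          rw [← Real.mul_rpow (by norm_num) (by positivity)]; congr 1; ring
        have e3 : (2:ℝ) ^ (r + 1) ≤ Real.exp (r + 1) := by
          rw [← Real.exp_one_rpow]
          exact Real.rpow_le_rpow (by norm_num) (by linarith [Real.add_one_le_exp (1:ℝ)]) (by linarith)
        rw [Real.rpow_add_one (by norm_num)] at e3
        have e4 : (τ / 2) ^ r ≤ θ (t - τ / 2) ^ r := Real.rpow_le_rpow (by positivity) hθs hr0
        have e5 : Real.exp (-(r + 1)) * 2 ^ r ≤ 1 / 2 := by
          rw [Real.exp_neg, inv_mul_le_iff₀ (Real.exp_pos _)]; linarith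
        have e6 : 0 ≤ (τ / 2) ^ r := by positivity
        rw [e2, ← mul_assoc]
        nlinarith
      have h3 := ph_nonneg (P := P) (μp := μp) (N := N) q (t - τ / 2)
      have h4 := mul_le_mul_of_nonneg_left h1 hτr.le
      have h5 := mul_le_mul_of_nonneg_right h2 h3
      nlinarith
  have h1 := main t ht
  have hp0 : 0 < θ t ^ r := Real.rpow_pos_of_pos (hθ t ht) _
  have h2 : ph P μp N q t ≤ 2 * (K * M) * (θ t ^ r)⁻¹ := by
    rw [← div_eq_mul_inv, le_div_iff₀ hp0]; linarith
  refine h2.trans ?_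
  have h3 : (θ t ^ r)⁻¹ ≤ 1 + t ^ (p - q) := by
    rw [← Real.rpow_neg (hθ t ht).le, show -r = p - q by rw [hr]; ring]
    have : 0 < t ^ (p - q) := Real.rpow_pos_of_pos ht _
    rcases min_cases t 1 with ⟨h, _⟩ | ⟨h, _⟩
    · simp only [θ, h]; linarith
    · simp only [θ, h, Real.one_rpow]; linarith
  calc 2 * (K * M) * (θ t ^ r)⁻¹ ≤ 2 * (K * M) * (1 + t ^ (p - q)) := by gcongr
    _ = _ := by rw [hM]; ring

end process
end KacModel

namespace KacModel
variable {d : ℕ}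
variable {N : ℕ} {x : Fin N → Vd d}

lemma mo_mono2 (h : Good x) {p q : ℝ} (hp : 0 ≤ p) (hpq : p ≤ q) (hq : 2 ≤ q) :
    mo p (emp x) ≤ 2 * mo q (emp x) := by
  have hn := h.pos
  have h1 := one_le_mo h hq
  have h2 : mo p (emp x) ≤ 1 + mo q (emp x) := by
    have e : 1 + mo q (emp x) = (N:ℝ)⁻¹ * ∑ i, (1 + ‖x i‖ ^ q) := by
      rw [mo_emp, Finset.sum_add_distrib, mul_add]
      simp [hn.ne']
    rw [e, mo_emp]
    apply avg_mono
    intro i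
    rcases le_total ‖x i‖ 1 with h | h
    · have := Real.rpow_le_one (norm_nonneg _) h hp
      have : 0 ≤ ‖x i‖ ^ q := by positivity
      linarith
    · have := Real.rpow_le_rpow_of_exponent_le h hpq
      linarith
  linarith

section process
variable {Ω : Type} [m : MeasurableSpace Ω] {B : Vd d → Measure (Vd d)} {P : Measure Ω}
  {𝓕 : Filtration ℝ m} {μp : ℝ → Ω → Measure (Vd d)}

lemma mu0_emp [IsProbabilityMeasure P] (hK : IsKacProcess B N P 𝓕 μp) {μ0 : Measure (Vd d)}
    (h0 : ∀ ω, μp 0 ω = μ0) : ∃ x0 : Fin N → Vd d, μ0 = emp x0 ∧ Good x0 := by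
  obtain ⟨ω⟩ := P.nonempty_of_neZero
  rw [← h0 ω]
  exact mem_emp (hK.mem 0 ω)

lemma lint_moment [IsProbabilityMeasure P] (hK : IsKacProcess B N P 𝓕 μp) {q : ℝ} (hq : 0 ≤ q) (t : ℝ) :
    ∫⁻ ω, momentL q (μp t ω) ∂P = ENNReal.ofReal (ph P μp N q t) := by
  simp only [momentL_Gq hK hq]
  exact (ofReal_integral_eq_lintegral_ofReal (proc_int hK (Gq_meas N q) (Gq_abs N q) t)
    (ae_of_all _ fun ω => Gq_nonneg _ _ _)).symm

lemma sup_moment (hd : 2 ≤ d) (hB : IsCollisionKernel B) {q : ℝ} (hq : 2 < q) :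
    ∃ C : ℝ, 0 ≤ C ∧ ∀ {Ω : Type} [m : MeasurableSpace Ω] {P : Measure Ω}
      [IsProbabilityMeasure P] {𝓕 : Filtration ℝ m} {N : ℕ} {μp : ℝ → Ω → Measure (Vd d)},
      IsKacProcess B N P 𝓕 μp → ∀ {μ0}, (∀ ω, μp 0 ω = μ0) → ∀ {t : ℝ}, 0 ≤ t →
        ∫⁻ ω, ⨆ s ∈ Set.Icc (0:ℝ) t, momentL q (μp s ω) ∂P ≤
          ENNReal.ofReal ((1 + C * t) * mo q μ0) := by
  obtain ⟨C, hC, hprop⟩ := propag hd hB hq.le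
  have hK0 : 0 ≤ povK q := povK_nonneg (by linarith)
  refine ⟨4 * povK q * C, by positivity, ?_⟩
  intro Ω m P _ 𝓕 N μp hK μ0 h0 t ht
  have hq0 : 0 ≤ q := by linarith
  simp only [momentL_Gq hK hq0]
  refine (sup_bound hd hB hK (Gq_meas N q) (Gq_abs N q) (Gq_nonneg N q)
    (Γ := fun ν => 4 * povK q * Gq N q ν) ((Gq_meas N q).const_mul _) (M' := 4 * povK q * Hq N q)
    ?_ ?_ h0 (lsc_Gq hK hq0) ht).trans (ENNReal.ofReal_le_ofReal ?_)
  · intro ν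
    rw [abs_mul, abs_of_nonneg (by positivity : 0 ≤ 4 * povK q)]
    exact mul_le_mul_of_nonneg_left (Gq_abs N q ν) (by positivity)
  · intro c x hx
    rw [Gq_emp hx hq0]
    exact gen_pos hd hB hq hx c
  · obtain ⟨x0, hx0, hg0⟩ := mu0_emp hK h0
    have e : Gq N q μ0 = mo q μ0 := by rw [hx0, Gq_emp hg0 hq0]
    rw [e]
    have h1 : ∫ r in Set.Ioc 0 t, ∫ ω, 4 * povK q * Gq N q (μp r ω) ∂P ≤
        ∫ r in Set.Ioc 0 t, 4 * povK q * (C * mo q μ0) := by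
      simp only [integral_const_mul]
      refine mul_le_mul_of_nonneg_left ?_ (by positivity)
      rw [← integral_const_mul]
      refine setIntegral_mono_on (f := ph P μp N q) (g := fun _ => C * mo q μ0)
        (cont_int (ph_cont hd hB hK q) le_rfl) (integrableOn_const measure_Ioc_lt_top.ne) measurableSet_Ioc ?_
      intro r hr
      exact hprop hK h0 hr.1.le
    have h2 : ∫ r in Set.Ioc 0 t, 4 * povK q * (C * mo q μ0) = t * (4 * povK q * (C * mo q μ0)) := by
      simp [ht]
    linarith

lemma tv_bound (hd : 2 ≤ d) (hB : IsCollisionKernel B) [IsProbabilityMeasure P]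
    (hK : IsKacProcess B N P 𝓕 μp) {μ0 : Measure (Vd d)} (h0 : ∀ ω, μp 0 ω = μ0)
    {p : ℝ} (hp : 2 ≤ p) {t : ℝ} (ht : 0 ≤ t) :
    ∫⁻ ω, ⨆ s ∈ Set.Icc (0:ℝ) t, (∫⁻ v, wt p v ∂(tvMeasure (μp s ω) μ0)) ∂P ≤
      ENNReal.ofReal (KP p * ∫ r in Set.Ioc 0 t, ph P μp N (p + 1) r) := by
  obtain ⟨x0, rfl, hg0⟩ := mu0_emp hK h0
  have hp0 : 0 ≤ p := by linarith
  have hKP : 0 ≤ KP p := by unfold KP; positivity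
  have := emp_prob (x := x0) hg0.1
  classical
  set S : Finset (Vd d) := Finset.univ.image x0 with hSd
  have hS : emp x0 (↑S : Set (Vd d))ᶜ = 0 := by
    have := emp_ae (x := x0) hg0.1
    rw [ae_iff] at this
    refine measure_mono_null ?_ this
    intro v hv
    simpa [hSd] using hv
  have h1 : ∀ ω, ⨆ s ∈ Set.Icc (0:ℝ) t, (∫⁻ v, wt p v ∂(tvMeasure (μp s ω) (emp x0))) ≤
      ⨆ s ∈ Set.Icc (0:ℝ) t, ENNReal.ofReal (GP N p S (emp x0) (μp s ω)) := by
    intro ω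
    refine iSup₂_mono fun s hs => ?_
    have := mem_prob (hK.mem s ω)
    rw [GP_Phi hK hp0 hg0 S hS]
    exact tv_le_Phi p S _ _ hS
  refine (lintegral_mono h1).trans ?_
  have hH : 0 ≤ HP N p := by unfold HP; positivity
  refine (sup_bound hd hB hK (F := GP N p S (emp x0)) (clampF_meas _ (Phi_meas p S _))
    (clampF_abs hH _) (clampF_nonneg _ _)
    (Γ := fun ν => KP p * Gq N (p + 1) ν) ((Gq_meas N (p+1)).const_mul _)
    (M' := KP p * Hq N (p + 1)) ?_ ?_ h0 (lsc_GP hK hp0 hg0 S hS) ht).trans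
    (ENNReal.ofReal_le_ofReal ?_)
  · intro ν
    rw [abs_mul, abs_of_nonneg hKP]
    exact mul_le_mul_of_nonneg_left (Gq_abs N _ ν) hKP
  · intro c x hx
    rw [Gq_emp hx (by linarith)]
    exact gen_Phi hd hB hp hx S _ c
  · have e : GP N p S (emp x0) (emp x0) = 0 := by
      have := Phi_self p S (emp x0) hS
      simp [GP, clampF, this]
    rw [e, zero_add]
    simp only [integral_const_mul]
    exact le_rfl

lemma ph_int_bound (hd : 2 ≤ d) (hB : IsCollisionKernel B) {p q : ℝ} (hp : 2 ≤ p) (hpq : p < q) :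
    ∃ C : ℝ, 0 ≤ C ∧ ∀ {Ω : Type} [m : MeasurableSpace Ω] {P : Measure Ω}
      [IsProbabilityMeasure P] {𝓕 : Filtration ℝ m} {N : ℕ} {μp : ℝ → Ω → Measure (Vd d)},
      IsKacProcess B N P 𝓕 μp → ∀ {μ0}, (∀ ω, μp 0 ω = μ0) → ∀ {t : ℝ}, 0 ≤ t →
        ∫ r in Set.Ioc 0 t, ph P μp N (p + 1) r ≤ C * (t + t ^ (q - p)) * mo q μ0 := by
  rcases le_or_gt (p + 1) q with h | h
  · obtain ⟨C, hC, hprop⟩ := propag hd hB (show 2 ≤ p + 1 by linarith)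
    refine ⟨2 * C, by linarith, ?_⟩
    intro Ω m P _ 𝓕 N μp hK μ0 h0 t ht
    obtain ⟨x0, rfl, hg0⟩ := mu0_emp hK h0
    have h1 : ∫ r in Set.Ioc 0 t, ph P μp N (p + 1) r ≤ ∫ r in Set.Ioc 0 t, C * mo (p+1) (emp x0) := by
      refine setIntegral_mono_on (g := fun _ => C * mo (p+1) (emp x0))
        (cont_int (ph_cont hd hB hK _) le_rfl) (integrableOn_const measure_Ioc_lt_top.ne) measurableSet_Ioc ?_
      intro r hr
      exact hprop hK h0 hr.1.le
    have h2 : ∫ r in Set.Ioc 0 t, C * mo (p+1) (emp x0) = t * (C * mo (p+1) (emp x0)) := by simp [ht]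
    rw [h2] at h1
    refine h1.trans ?_
    have h3 := mo_mono2 hg0 (by linarith : 0 ≤ p + 1) h (by linarith)
    have h4 : 0 ≤ t ^ (q - p) := by positivity
    have h5 := mo_nonneg q (emp x0)
    calc t * (C * mo (p+1) (emp x0)) ≤ t * (C * (2 * mo q (emp x0))) := by gcongr
      _ ≤ (t + t ^ (q - p)) * (C * (2 * mo q (emp x0))) := by gcongr; linarith
      _ = _ := by ring
  · obtain ⟨C, hC, hcr⟩ := creation hd hB (show 2 ≤ q by linarith) h.le (by linarith)
    have hqp : 0 < q - p := by linarith
    have hqi : 1 ≤ (q - p)⁻¹ := by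
      rw [one_le_inv₀ hqp]; linarith
    refine ⟨C * (q - p)⁻¹, by positivity, ?_⟩
    intro Ω m P _ 𝓕 N μp hK μ0 h0 t ht
    have hii : IntervalIntegrable (fun r : ℝ => r ^ (q - (p + 1))) volume 0 t :=
      intervalIntegral.intervalIntegrable_rpow' (by linarith)
    have hi : IntegrableOn (fun r : ℝ => r ^ (q - (p + 1))) (Set.Ioc 0 t) :=
      (intervalIntegrable_iff_integrableOn_Ioc_of_le ht).1 hii
    have hi1 : IntegrableOn (fun r : ℝ => (1:ℝ)) (Set.Ioc 0 t) := by simp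
    have hi2 : IntegrableOn (fun r : ℝ => 1 + r ^ (q - (p + 1))) (Set.Ioc 0 t) := hi1.add hi
    have h1 : ∫ r in Set.Ioc 0 t, ph P μp N (p + 1) r ≤
        ∫ r in Set.Ioc 0 t, (C * mo q μ0) * (1 + r ^ (q - (p + 1))) := by
      apply setIntegral_mono_on (cont_int (ph_cont hd hB hK _) le_rfl) (hi2.const_mul _)
        measurableSet_Ioc
      intro r hr
      have := hcr hK h0 hr.1
      linarith
    refine h1.trans ?_
    rw [integral_const_mul, integral_add hi1 hi, ← intervalIntegral.integral_of_le ht,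
      ← intervalIntegral.integral_of_le ht, integral_rpow (Or.inl (by linarith)),
      show q - (p + 1) + 1 = q - p by ring, Real.zero_rpow hqp.ne']
    have h4 : 0 ≤ t ^ (q - p) := by positivity
    have h5 := mo_nonneg q μ0
    simp only [intervalIntegral.integral_const, sub_zero, smul_eq_mul, mul_one, div_eq_mul_inv]
    have : t + t ^ (q - p) * (q - p)⁻¹ ≤ (q - p)⁻¹ * (t + t ^ (q - p)) := by nlinarith
    calc C * mo q μ0 * (t + t ^ (q - p) * (q - p)⁻¹)
        ≤ C * mo q μ0 * ((q - p)⁻¹ * (t + t ^ (q - p))) := by gcongr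
      _ = _ := by ring

lemma tv_triv [IsProbabilityMeasure P]
    (hK : IsKacProcess B N P 𝓕 μp) {μ0 : Measure (Vd d)} (h0 : ∀ ω, μp 0 ω = μ0)
    {p C : ℝ} (hp : 2 ≤ p) {t : ℝ} (ht : 0 ≤ t) (hC : 0 ≤ C)
    (hsup : ∫⁻ ω, ⨆ s ∈ Set.Icc (0:ℝ) t, momentL p (μp s ω) ∂P ≤
          ENNReal.ofReal ((1 + C * t) * mo p μ0)) :
    ∫⁻ ω, ⨆ s ∈ Set.Icc (0:ℝ) t, (∫⁻ v, wt p v ∂(tvMeasure (μp s ω) μ0)) ∂P ≤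
      ENNReal.ofReal ((4 + C) * (t + 1) * mo p μ0) := by
  obtain ⟨x0, hx0, hg0⟩ := mu0_emp hK h0
  have hm := mo0_one_le hK h0 hp
  have hp0 : 0 ≤ p := by linarith
  have h1 : ∀ ω, ⨆ s ∈ Set.Icc (0:ℝ) t, (∫⁻ v, wt p v ∂(tvMeasure (μp s ω) μ0)) ≤
      ENNReal.ofReal (2 + mo p μ0) + ⨆ s ∈ Set.Icc (0:ℝ) t, momentL p (μp s ω) := by
    intro ω
    refine iSup₂_le fun s hs => ?_
    have l1 : momentL p (μp s ω) ≤ ⨆ s ∈ Set.Icc (0:ℝ) t, momentL p (μp s ω) :=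
      le_iSup₂ (f := fun s (_ : s ∈ Set.Icc (0:ℝ) t) => momentL p (μp s ω)) s hs
    refine le_trans ?_ (add_le_add le_rfl l1)
    obtain ⟨x, hx, hg⟩ := mem_emp (hK.mem s ω)
    have l2 : tvMeasure (μp s ω) μ0 ≤ μp s ω + μ0 :=
      add_le_add Measure.sub_le Measure.sub_le
    refine (lintegral_mono' l2 le_rfl).trans ?_
    rw [lintegral_add_measure, hx, hx0, wt_emp hg hp0, wt_emp hg0 hp0, momentL_emp p hp0 hg.1,
      ← ENNReal.ofReal_add (by linarith [mo_nonneg p (emp x)]) (by linarith [mo_nonneg p (emp x0)]),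
      ← ENNReal.ofReal_add (by linarith [mo_nonneg p (emp x0)]) (mo_nonneg _ _)]
    apply ENNReal.ofReal_le_ofReal; linarith
  refine (lintegral_mono h1).trans ?_
  rw [lintegral_add_left measurable_const]
  simp only [lintegral_const, measure_univ, mul_one]
  refine (add_le_add le_rfl hsup).trans ?_
  rw [← ENNReal.ofReal_add (by linarith) (by positivity)]
  apply ENNReal.ofReal_le_ofReal
  have a1 : 0 ≤ t * mo p μ0 := mul_nonneg ht (by linarith)
  have a2 : 0 ≤ C * mo p μ0 := mul_nonneg hC (by linarith)
  nlinarith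

end process
end KacModel

/-- Proposition 3.1 (moment estimates for the Kac process). -/
theorem kac_moment_estimates
    (d : ℕ) (hd : 2 ≤ d) (B : Vd d → Measure (Vd d)) (hB : IsCollisionKernel B)
    (q : ℝ) (hq : 2 < q) :
    ∃ C₂ : ℝ, 0 ≤ C₂ ∧
      ∀ p : ℝ, 2 ≤ p → p ≤ q →
        ∃ C₁ C₃ : ℝ, 0 ≤ C₁ ∧ 0 ≤ C₃ ∧
          ∀ (Ω : Type) (m : MeasurableSpace Ω) (P : Measure Ω),
            IsProbabilityMeasure P →
          ∀ (𝓕 : MeasureTheory.Filtration ℝ m) (N : ℕ)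
            (μp : ℝ → Ω → Measure (Vd d)),
            IsKacProcess B N P 𝓕 μp →
          ∀ μ0 : Measure (Vd d), (∀ ω, μp 0 ω = μ0) →
          ∀ t : ℝ, 0 ≤ t →
            (∫⁻ ω, momentL q (μp t ω) ∂P ≤
              ENNReal.ofReal C₁ * (1 + ENNReal.ofReal t ^ (p - q)) * momentL p μ0) ∧
            (∫⁻ ω, ⨆ s ∈ Set.Icc (0:ℝ) t, momentL q (μp s ω) ∂P ≤
              (1 + ENNReal.ofReal (C₂ * t)) * momentL q μ0) ∧
            (∫⁻ ω, ⨆ s ∈ Set.Icc (0:ℝ) t,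
                (∫⁻ v, (1 + (‖v‖₊ : ℝ≥0∞) ^ p) ∂(tvMeasure (μp s ω) μ0)) ∂P ≤
              ENNReal.ofReal C₃ * (ENNReal.ofReal t + ENNReal.ofReal t ^ (q - p)) *
                momentL q μ0) := by
  obtain ⟨C₂, hC₂, hsup⟩ := sup_moment hd hB hq
  refine ⟨C₂, hC₂, ?_⟩
  intro p hp hpq
  obtain ⟨C, hC, hcr⟩ := creation hd hB hp hpq hq
  have h3 : ∃ C₃ : ℝ, 0 ≤ C₃ ∧ ∀ {Ω : Type} [m : MeasurableSpace Ω] {P : Measure Ω}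
      [IsProbabilityMeasure P] {𝓕 : Filtration ℝ m} {N : ℕ} {μp : ℝ → Ω → Measure (Vd d)},
      IsKacProcess B N P 𝓕 μp → ∀ {μ0}, (∀ ω, μp 0 ω = μ0) → ∀ {t : ℝ}, 0 ≤ t →
      ∫⁻ ω, ⨆ s ∈ Set.Icc (0:ℝ) t, (∫⁻ v, wt p v ∂(tvMeasure (μp s ω) μ0)) ∂P ≤
        ENNReal.ofReal (C₃ * (t + t ^ (q - p)) * mo q μ0) := by
    rcases hpq.eq_or_lt with rfl | hlt
    · refine ⟨4 + C₂, by positivity, ?_⟩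
      intro Ω m P _ 𝓕 N μp hK μ0 h0 t ht
      rw [sub_self, Real.rpow_zero]
      exact tv_triv hK h0 hp ht hC₂ (hsup hK h0 ht)
    · obtain ⟨C', hC', hint⟩ := ph_int_bound hd hB hp hlt
      have hKP : 0 ≤ KP p := by unfold KP; positivity
      refine ⟨KP p * C', by positivity, ?_⟩
      intro Ω m P _ 𝓕 N μp hK μ0 h0 t ht
      refine (tv_bound hd hB hK h0 hp ht).trans (ENNReal.ofReal_le_ofReal ?_)
      have := mul_le_mul_of_nonneg_left (hint hK h0 ht) hKP
      linarith
  obtain ⟨C₃, hC₃, htv⟩ := h3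
  refine ⟨C + 1, C₃, by positivity, hC₃, ?_⟩
  intro Ω m P hP 𝓕 N μp hK μ0 h0 t ht
  obtain ⟨x0, hx0, hg0⟩ := mu0_emp hK h0
  have eM : ∀ r, 0 ≤ r → momentL r μ0 = ENNReal.ofReal (mo r μ0) := by
    intro r hr; rw [hx0, momentL_emp r hr hg0.1]
  have hp0 : 0 ≤ p := by linarith
  have hq0 : 0 ≤ q := by linarith
  have hmp := mo0_one_le hK h0 hp
  have hmq := mo0_one_le hK h0 hq.le
  refine ⟨?_, ?_, ?_⟩
  · rw [lint_moment hK hq0, eM p hp0]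
    rcases ht.eq_or_lt with rfl | ht'
    · rcases hpq.eq_or_lt with rfl | hlt
      · rw [ph_zero hK h0 hq0, sub_self, ENNReal.rpow_zero, ← ENNReal.ofReal_one,
          ← ENNReal.ofReal_add zero_le_one zero_le_one, ← ENNReal.ofReal_mul (by positivity),
          ← ENNReal.ofReal_mul (by positivity)]
        apply ENNReal.ofReal_le_ofReal
        nlinarith
      · rw [ENNReal.ofReal_zero, ENNReal.zero_rpow_of_neg (by linarith), add_top, ENNReal.mul_top
          (by simp; linarith), ENNReal.top_mul (by simp; linarith)]
        exact le_top
    · have hr : 0 < t ^ (p - q) := Real.rpow_pos_of_pos ht' _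
      rw [ENNReal.ofReal_rpow_of_pos ht', ← ENNReal.ofReal_one,
          ← ENNReal.ofReal_add zero_le_one hr.le, ← ENNReal.ofReal_mul (by positivity),
          ← ENNReal.ofReal_mul (by positivity)]
      apply ENNReal.ofReal_le_ofReal
      refine (hcr hK h0 ht').trans ?_
      gcongr
      linarith
  · refine (hsup hK h0 ht).trans ?_
    rw [eM q hq0, ← ENNReal.ofReal_one, ← ENNReal.ofReal_add zero_le_one (by positivity),
      ← ENNReal.ofReal_mul (by positivity)]
  · refine (htv hK h0 ht).trans ?_
    rw [eM q hq0, ENNReal.ofReal_rpow_of_nonneg ht (by linarith),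
      ← ENNReal.ofReal_add ht (by positivity), ← ENNReal.ofReal_mul hC₃,
      ← ENNReal.ofReal_mul (by positivity)]
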